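/- arXiv:1811.08142 — 2 statements merged into one kernel-verified Lean document; each statement's English description precedes it below -/
import Mathlib

section
/- For every R > 0 there exists a constant C_R > 0 such that for every T ∈ ℝ(X)^Γ with propagation ≤ R, every Hilbert space H' and every *-representation σ of ℝ(X)^Γ on H', one has ‖σ(T)‖ ≤ C_R · ‖T‖, where ‖T‖ denotes the operator norm of T on the defining Hilbert space H. -/
open scoped ZeroAtInfty
open Metric Filter

noncomputable section

variable {X : Type*} [MetricSpace X] {Γ : Type*} [Group Γ] [MulAction Γ X]
variable {H : Type*} [NormedAddCommGroup H] [InnerProductSpace ℂ H] [CompleteSpace H]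

/-- `T` has propagation at most `r` with respect to the representation `ρ` of `C₀(X)`. -/
def HasPropLE (ρ : C₀(X, ℂ) →⋆ₙₐ[ℂ] (H →L[ℂ] H)) (T : H →L[ℂ] H) (r : ℝ) : Prop :=
  ∀ f g : C₀(X, ℂ),
    (∀ x ∈ tsupport ⇑f, ∀ y ∈ tsupport ⇑g, r ≤ dist x y) → ρ f * T * ρ g = 0

/-- `T` is locally compact with respect to `ρ`. -/
def IsLocCompactOp (ρ : C₀(X, ℂ) →⋆ₙₐ[ℂ] (H →L[ℂ] H)) (T : H →L[ℂ] H) : Prop :=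
  ∀ f : C₀(X, ℂ), IsCompactOperator ⇑(ρ f * T) ∧ IsCompactOperator ⇑(T * ρ f)

/-- `T` is invariant under the unitary representation `u` of `Γ`. -/
def IsEquivariantOp (u : Γ →* unitary (H →L[ℂ] H)) (T : H →L[ℂ] H) : Prop :=
  ∀ γ : Γ, (u γ : H →L[ℂ] H) * T = T * (u γ : H →L[ℂ] H)

/-- `ρ` is covariant for the unitary representation `u`. -/
def CovariantRep (ρ : C₀(X, ℂ) →⋆ₙₐ[ℂ] (H →L[ℂ] H)) (u : Γ →* unitary (H →L[ℂ] H)) : Prop :=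
  ∀ (γ : Γ) (f g : C₀(X, ℂ)), (∀ x : X, g x = f (γ⁻¹ • x)) →
    (ρ g : H →L[ℂ] H) = (u γ : H →L[ℂ] H) * ρ f * star ((u γ : H →L[ℂ] H))

/-- `ρ` is ample: only `0` acts as a compact operator. -/
def AmpleRep (ρ : C₀(X, ℂ) →⋆ₙₐ[ℂ] (H →L[ℂ] H)) : Prop :=
  ∀ f : C₀(X, ℂ), IsCompactOperator ⇑(ρ f) → f = 0

/-- `ρ` is nondegenerate. -/
def NondegRep (ρ : C₀(X, ℂ) →⋆ₙₐ[ℂ] (H →L[ℂ] H)) : Prop :=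
  Dense (Submodule.span ℂ {w : H | ∃ (f : C₀(X, ℂ)) (v : H), ρ f v = w} : Set H)

/-- The algebraic equivariant Roe algebra `ℝ(X)^Γ`: Γ-invariant, locally compact,
finite propagation operators. -/
def RoeAlgSet (ρ : C₀(X, ℂ) →⋆ₙₐ[ℂ] (H →L[ℂ] H)) (u : Γ →* unitary (H →L[ℂ] H)) :
    Set (H →L[ℂ] H) :=
  {T | IsEquivariantOp u T ∧ IsLocCompactOp ρ T ∧ ∃ r : ℝ, 0 ≤ r ∧ HasPropLE ρ T r}

/-- `σ` is a `*`-representation of the `*`-algebra given by the subset `R ⊆ B(H)`. -/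
def IsStarRepOn {H' : Type*} [NormedAddCommGroup H'] [InnerProductSpace ℂ H']
    [CompleteSpace H'] (R : Set (H →L[ℂ] H)) (σ : (H →L[ℂ] H) → (H' →L[ℂ] H')) : Prop :=
  (∀ T ∈ R, ∀ S ∈ R, σ (T + S) = σ T + σ S) ∧
  (∀ (c : ℂ), ∀ T ∈ R, σ (c • T) = c • σ T) ∧
  (∀ T ∈ R, ∀ S ∈ R, σ (T * S) = σ T * σ S) ∧
  (∀ T ∈ R, σ (star T) = star (σ T))

/-- `X` has bounded geometry. -/
def BoundedGeometry (X : Type*) [MetricSpace X] : Prop :=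
  ∃ (Y : Set X) (c : ℝ), 0 < c ∧ (∀ x : X, ∃ y ∈ Y, dist x y < c) ∧
    ∀ r : ℝ, 0 < r → ∃ N : ℕ, ∀ x : X,
      (Y ∩ Metric.ball x r).Finite ∧ (Y ∩ Metric.ball x r).ncard ≤ N

namespace RoeBound

section CompactOperators

/-- Schauder's theorem for operators on a Hilbert space. -/
theorem isCompactOperator_star {K : H →L[ℂ] H} (hK : IsCompactOperator ⇑K) :
    IsCompactOperator ⇑(star K) := by
  have hA : IsCompactOperator ⇑(K * star K) := hK.comp_clm (star K)
  have htb : TotallyBounded (⇑(K * star K) '' Metric.ball 0 1) :=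
    (IsCompactOperator.isCompact_closure_image_ball (𝕜₁ := ℂ)
      (f := (K * star K : H →L[ℂ] H).toLinearMap)
      hA 1).totallyBounded.subset subset_closure
  refine (isCompactOperator_iff_isCompact_closure_image_ball (𝕜₁ := ℂ)
    (star K : H →L[ℂ] H).toLinearMap one_pos).2 ?_
  suffices h : TotallyBounded (⇑(star K) '' Metric.ball 0 1) from h.closure.isCompact_of_isClosed
    isClosed_closure
  refine Metric.totallyBounded_of_finite_discretization fun ε hε => ?_
  obtain ⟨t, ht, hcov⟩ := Metric.totallyBounded_iff.1 htb (ε ^ 2 / 4) (by positivity)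
  have key : ∀ z : ⇑(star K) '' Metric.ball 0 1, ∃ (x : H) (c : t),
      x ∈ Metric.ball (0 : H) 1 ∧ star K x = z ∧ dist ((K * star K) x) c < ε ^ 2 / 4 := by
    rintro ⟨_, x, hx, rfl⟩
    obtain ⟨c, hc, hxc⟩ := Set.mem_iUnion₂.1 (hcov ⟨x, hx, rfl⟩)
    exact ⟨x, ⟨c, hc⟩, hx, rfl, hxc⟩
  choose x c hx hxz hxc using key
  refine ⟨t, ht.fintype, c, fun z w hzw => ?_⟩
  have hd : dist ((K * star K) (x z)) ((K * star K) (x w)) < ε ^ 2 / 2 := by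
    have h1 := hxc z
    have h2 := hxc w
    rw [hzw] at h1
    have := dist_triangle_right ((K * star K) (x z)) ((K * star K) (x w)) (c w)
    linarith
  rw [dist_eq_norm, ← map_sub] at hd
  rw [← hxz, ← hxz, dist_eq_norm, ← map_sub]
  have hn : ‖x z - x w‖ ≤ 2 := by
    have h1 := hx z
    have h2 := hx w
    rw [mem_ball_zero_iff] at h1 h2
    have := norm_sub_le (x z) (x w)
    linarith
  have hsq : ‖star K (x z - x w)‖ ^ 2 ≤ ‖(K * star K) (x z - x w)‖ * ‖x z - x w‖ := by
    rw [← inner_self_eq_norm_sq (𝕜 := ℂ), ContinuousLinearMap.star_eq_adjoint,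
      ContinuousLinearMap.adjoint_inner_right]
    exact (Complex.re_le_norm _).trans (norm_inner_le_norm _ _)
  have : ‖star K (x z - x w)‖ ^ 2 < ε ^ 2 := by
    nlinarith [norm_nonneg ((K * star K) (x z - x w)), norm_nonneg (x z - x w)]
  exact lt_of_pow_lt_pow_left₀ 2 hε.le this

end CompactOperators

section RealFunctions

/-- A real-valued function in `C₀(X)`, seen as a complex-valued one. -/
def complexify (g : C₀(X, ℝ)) : C₀(X, ℂ) where
  toFun x := (g x : ℂ)
  continuous_toFun := Complex.continuous_ofReal.comp g.continuous
  zero_at_infty' := by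
    have := (Complex.continuous_ofReal.tendsto 0).comp g.zero_at_infty'
    simpa using! this

@[simp] theorem complexify_apply (g : C₀(X, ℝ)) (x : X) : complexify g x = (g x : ℂ) := rfl

theorem complexify_mul (g h : C₀(X, ℝ)) : complexify (g * h) = complexify g * complexify h := by
  ext x; simp

theorem complexify_add (g h : C₀(X, ℝ)) : complexify (g + h) = complexify g + complexify h := by
  ext x; simp

theorem complexify_sub (g h : C₀(X, ℝ)) : complexify (g - h) = complexify g - complexify h := by
  ext x; simp

theorem complexify_smul (c : ℝ) (g : C₀(X, ℝ)) : complexify (c • g) = (c : ℂ) • complexify g := by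
  ext x; simp

theorem complexify_sum {J : Type*} (F : Finset J) (g : J → C₀(X, ℝ)) :
    complexify (∑ j ∈ F, g j) = ∑ j ∈ F, complexify (g j) := by
  classical
  induction F using Finset.induction_on with
  | empty => ext x; simp
  | insert a s ha ih => rw [Finset.sum_insert ha, Finset.sum_insert ha, complexify_add, ih]

theorem star_complexify (g : C₀(X, ℝ)) : star (complexify g) = complexify g := by
  ext x; simp

theorem sum_apply {J : Type*} (F : Finset J) (g : J → C₀(X, ℝ)) (x : X) :
    (∑ j ∈ F, g j) x = ∑ j ∈ F, g j x := by
  classical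
  induction F using Finset.induction_on with
  | empty => simp
  | insert a s ha ih => rw [Finset.sum_insert ha, Finset.sum_insert ha,
      ZeroAtInftyContinuousMap.add_apply, ih]

theorem norm_le_of_forall {f : C₀(X, ℂ)} {c : ℝ} (hc : 0 ≤ c) (h : ∀ x, ‖f x‖ ≤ c) : ‖f‖ ≤ c := by
  rw [← ZeroAtInftyContinuousMap.norm_toBCF_eq_norm]
  exact (BoundedContinuousFunction.norm_le hc).2 h

/-- The pointwise square root of a function in `C₀(X)`. -/
def sqrtC0 (g : C₀(X, ℝ)) : C₀(X, ℝ) where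
  toFun x := √(g x)
  continuous_toFun := Real.continuous_sqrt.comp g.continuous
  zero_at_infty' := by
    have := (Real.continuous_sqrt.tendsto 0).comp g.zero_at_infty'
    simpa using! this

@[simp] theorem sqrtC0_apply (g : C₀(X, ℝ)) (x : X) : sqrtC0 g x = √(g x) := rfl

theorem sqrtC0_mul_self {g : C₀(X, ℝ)} (hg : ∀ x, 0 ≤ g x) : sqrtC0 g * sqrtC0 g = g := by
  ext x
  simp [Real.mul_self_sqrt (hg x)]

/-- A bounded continuous function supported in a compact set, as an element of `C₀(X)`. -/
def ofCompactSupport (f : X → ℝ) (hf : Continuous f) (K : Set X) (hK : IsCompact K)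
    (hfK : ∀ x, f x ≠ 0 → x ∈ K) : C₀(X, ℝ) where
  toFun := f
  continuous_toFun := hf
  zero_at_infty' := by
    refine tendsto_const_nhds.congr' ?_
    filter_upwards [hK.compl_mem_cocompact] with x hx
    by_contra h
    exact hx (hfK x (Ne.symm h))

/-- A cutoff function which is `1` on the `r`-neighbourhood of a compact set and supported in its
`(r + 1)`-neighbourhood. -/
theorem exists_cutoff [ProperSpace X] {K : Set X} (hK : IsCompact K) (r : ℝ) :
    ∃ k : C₀(X, ℝ), (∀ x, 0 ≤ k x) ∧ (∀ x, k x ≤ 1) ∧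
      (∀ x, (∃ y ∈ K, dist x y ≤ r) → k x = 1) ∧
      (∀ x, k x ≠ 0 → ∃ y ∈ K, dist x y ≤ r + 1) ∧ HasCompactSupport k := by
  rcases K.eq_empty_or_nonempty with rfl | hne
  · exact ⟨0, by simp, by simp, by simp, by simp, HasCompactSupport.zero⟩
  let f : X → ℝ := fun x => max 0 (min 1 (r + 1 - Metric.infDist x K))
  have hf : Continuous f := by
    have := Metric.continuous_infDist_pt K
    fun_prop
  have hsupp : ∀ x, f x ≠ 0 → ∃ y ∈ K, dist x y ≤ r + 1 := by
    intro x hx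
    obtain ⟨y, hy, hxy⟩ := hK.exists_infDist_eq_dist hne x
    refine ⟨y, hy, ?_⟩
    by_contra! h
    refine hx (max_eq_left ((min_le_right _ _).trans ?_))
    linarith
  have hthick : ∀ x, f x ≠ 0 → x ∈ Metric.cthickening (r + 1) K := by
    intro x hx
    obtain ⟨y, hy, hxy⟩ := hsupp x hx
    exact Metric.mem_cthickening_of_dist_le x y _ K hy hxy
  refine ⟨ofCompactSupport f hf _ hK.cthickening hthick, fun x => le_max_left _ _,
    fun x => max_le zero_le_one (min_le_left _ _), ?_, hsupp, ?_⟩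
  · rintro x ⟨y, hy, hxy⟩
    have h1 : Metric.infDist x K ≤ r := (Metric.infDist_le_dist_of_mem hy).trans hxy
    change max 0 (min 1 (r + 1 - Metric.infDist x K)) = 1
    rw [min_eq_left (by linarith), max_eq_right zero_le_one]
  · exact HasCompactSupport.intro hK.cthickening fun x hx => by
      by_contra h
      exact hx (hthick x h)

/-- Compactly supported cutoffs approximate every function in `C₀(X)`. -/
theorem exists_cutoff_norm_le [ProperSpace X] (f : C₀(X, ℂ)) {ε : ℝ} (hε : 0 < ε) :
    ∃ e : C₀(X, ℝ), HasCompactSupport e ∧ ‖complexify e * f - f‖ ≤ ε := by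
  obtain ⟨K, hK, hKf⟩ := Filter.mem_cocompact.1
    (f.zero_at_infty'.eventually (Metric.ball_mem_nhds (0 : ℂ) hε))
  obtain ⟨e, he0, he1, he, -, hec⟩ := exists_cutoff hK 0
  refine ⟨e, hec, norm_le_of_forall hε.le fun x => ?_⟩
  by_cases hx : x ∈ K
  · simp [he x ⟨x, hx, by simp⟩, hε.le]
  · have h1 : ‖f x‖ < ε := by simpa using! hKf hx
    have h2 : ‖(e x : ℂ) - 1‖ ≤ 1 := by
      rw [← Complex.ofReal_one, ← Complex.ofReal_sub, Complex.norm_real, Real.norm_eq_abs, abs_le]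
      constructor <;> linarith [he0 x, he1 x]
    calc ‖(complexify e * f - f) x‖ = ‖(e x : ℂ) - 1‖ * ‖f x‖ := by
          rw [← norm_mul]; congr 1; simp; ring
      _ ≤ 1 * ‖f x‖ := by gcongr
      _ ≤ ε := by linarith

end RealFunctions

section Propagation

variable {ρ : C₀(X, ℂ) →⋆ₙₐ[ℂ] (H →L[ℂ] H)}

theorem norm_rho_le (ρ : C₀(X, ℂ) →⋆ₙₐ[ℂ] (H →L[ℂ] H)) (f : C₀(X, ℂ)) : ‖ρ f‖ ≤ ‖f‖ :=
  NonUnitalStarAlgHom.norm_apply_le ρ f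

theorem continuous_rho (ρ : C₀(X, ℂ) →⋆ₙₐ[ℂ] (H →L[ℂ] H)) : Continuous ρ :=
  AddMonoidHomClass.continuous_of_bound ρ 1 fun f => by simpa using norm_rho_le ρ f

theorem eq_of_mul_rho_eq (hnd : NondegRep ρ) {A B : H →L[ℂ] H}
    (h : ∀ f, A * ρ f = B * ρ f) : A = B := by
  refine ContinuousLinearMap.ext_on hnd ?_
  rintro _ ⟨f, v, rfl⟩
  exact congrArg (fun T : H →L[ℂ] H => T v) (h f)

/-- An operator of propagation at most `r` only sees the `r`-neighbourhood of a support. -/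
theorem rho_mul_eq_rho_mul_mul_rho (hnd : NondegRep ρ) {T : H →L[ℂ] H} {r : ℝ}
    (hT : HasPropLE ρ T r) {f k : C₀(X, ℂ)}
    (hfk : ∀ x ∈ tsupport ⇑f, ∀ y, k y ≠ 1 → r ≤ dist x y) :
    ρ f * T = ρ f * T * ρ k := by
  refine eq_of_mul_rho_eq hnd fun e => ?_
  have hsupp : ∀ x ∈ tsupport ⇑f, ∀ y ∈ tsupport ⇑(e - k * e), r ≤ dist x y := by
    intro x hx
    have hcl : IsClosed {y | r ≤ dist x y} := isClosed_le continuous_const (by fun_prop)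
    refine fun y hy => closure_minimal (fun z hz => hfk x hx z fun hkz => ?_) hcl hy
    exact hz (by simp [hkz])
  have := hT f (e - k * e) hsupp
  rwa [map_sub, mul_sub, sub_eq_zero, map_mul, ← mul_assoc] at this

theorem tsupport_star_subset (f : C₀(X, ℂ)) : tsupport ⇑(star f) ⊆ tsupport ⇑f :=
  closure_mono fun x hx h => hx (by simp [h])

theorem hasPropLE_star {T : H →L[ℂ] H} {r : ℝ} (hT : HasPropLE ρ T r) :
    HasPropLE ρ (star T) r := by
  intro f g hfg
  have := hT (star g) (star f) fun x hx y hy => by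
    rw [dist_comm]
    exact hfg y (tsupport_star_subset f hy) x (tsupport_star_subset g hx)
  simpa [map_star, mul_assoc] using congrArg star this

theorem tsupport_mul_subset (e : C₀(X, ℝ)) (f : C₀(X, ℂ)) :
    tsupport ⇑(complexify e * f) ⊆ tsupport ⇑e ∩ tsupport ⇑f :=
  Set.subset_inter (closure_mono fun x hx h => hx (by simp [h]))
    (closure_mono fun x hx h => hx (by simp [h]))

/-- A property of `ρ f * T` which is closed only needs to be checked for compactly supported
modifications of `f`. -/
theorem rho_mem_of_cutoff [ProperSpace X] (f : C₀(X, ℂ)) {S : Set (H →L[ℂ] H)} (hS : IsClosed S)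
    (h : ∀ e : C₀(X, ℝ), HasCompactSupport e → ρ (complexify e * f) ∈ S) : ρ f ∈ S := by
  choose e hec he using fun n : ℕ =>
    exists_cutoff_norm_le f (Nat.one_div_pos_of_nat (α := ℝ) (n := n))
  have ht : Tendsto (fun n => complexify (e n) * f) atTop (nhds f) :=
    tendsto_iff_norm_sub_tendsto_zero.2
      (squeeze_zero (fun _ => norm_nonneg _) he tendsto_one_div_add_atTop_nhds_zero_nat)
  exact hS.mem_of_tendsto (((continuous_rho ρ).tendsto f).comp ht)
    (Eventually.of_forall fun n => h (e n) (hec n))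

theorem hasPropLE_mul [ProperSpace X] (hnd : NondegRep ρ) {T S : H →L[ℂ] H} {r s : ℝ}
    (hT : HasPropLE ρ T r) (hS : HasPropLE ρ S s) : HasPropLE ρ (T * S) (r + s + 1) := by
  intro f g hfg
  refine rho_mem_of_cutoff f (S := {A | A * (T * S) * ρ g = 0})
    (isClosed_eq (by fun_prop) continuous_const) fun e he => ?_
  obtain ⟨k, -, -, hk1, hk, -⟩ := exists_cutoff (he.isCompact.inter_right
    (isClosed_tsupport ⇑f)) r
  have h1 := rho_mul_eq_rho_mul_mul_rho hnd hT (f := complexify e * f) (k := complexify k)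
    fun x hx y hky => by
      by_contra! h
      refine hky ?_
      rw [complexify_apply, hk1 y ⟨x, tsupport_mul_subset e f hx, by rw [dist_comm]; exact h.le⟩,
        Complex.ofReal_one]
  have h2 : ρ (complexify k) * S * ρ g = 0 := by
    refine hS _ _ fun x hx y hy => ?_
    have hcl : IsClosed {z | s ≤ dist z y} := isClosed_le continuous_const (by fun_prop)
    refine closure_minimal (fun z hz => ?_) hcl hx
    obtain ⟨w, hw, hzw⟩ := hk z fun h => hz (by simp [h])
    have h3 := hfg w hw.2 y hy
    have h4 := dist_triangle_left w y z
    change s ≤ dist z y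
    linarith
  change ρ (complexify e * f) * (T * S) * ρ g = 0
  rw [← mul_assoc, h1, mul_assoc _ _ S, mul_assoc _ _ (ρ g), h2, mul_zero]

theorem isLocCompactOp_mul [ProperSpace X] (hnd : NondegRep ρ) {B T : H →L[ℂ] H} {r : ℝ}
    (hB : HasPropLE ρ B r) (hT : IsLocCompactOp ρ T) : IsLocCompactOp ρ (B * T) := by
  refine fun f => ⟨?_, ?_⟩
  · refine rho_mem_of_cutoff f (S := {A : H →L[ℂ] H | IsCompactOperator ⇑(A * (B * T))}) ?_
      fun e he => ?_
    · exact (isClosed_setOfPred_isCompactOperator (σ₁₂ := RingHom.id ℂ)).preimage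
        (f := fun A : H →L[ℂ] H => A * (B * T)) (by fun_prop)
    · obtain ⟨k, -, -, hk1, -, -⟩ := exists_cutoff he.isCompact r
      have h1 := rho_mul_eq_rho_mul_mul_rho hnd hB (f := complexify e * f) (k := complexify k)
        fun x hx y hky => by
          by_contra! h
          refine hky ?_
          rw [complexify_apply, hk1 y ⟨x, (tsupport_mul_subset e f hx).1,
            by rw [dist_comm]; exact h.le⟩, Complex.ofReal_one]
      have h2 := (hT (complexify k)).1.clm_comp (ρ (complexify e * f) * B)
      change IsCompactOperator ⇑(ρ (complexify e * f) * (B * T))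
      rw [← mul_assoc, h1, mul_assoc]
      exact h2
  · rw [mul_assoc]
    exact (hT f).2.clm_comp B

theorem isLocCompactOp_star {T : H →L[ℂ] H} (hT : IsLocCompactOp ρ T) :
    IsLocCompactOp ρ (star T) := fun f => by
  have h1 := isCompactOperator_star (hT (star f)).1
  have h2 := isCompactOperator_star (hT (star f)).2
  rw [star_mul, map_star, star_star] at h1 h2
  exact ⟨h2, h1⟩

theorem isEquivariantOp_star {u : Γ →* unitary (H →L[ℂ] H)} {T : H →L[ℂ] H}
    (hT : IsEquivariantOp u T) : IsEquivariantOp u (star T) := by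
  intro γ
  have h := congrArg star (hT γ⁻¹)
  have h1 : star ((u γ⁻¹ : unitary (H →L[ℂ] H)) : H →L[ℂ] H) = u γ := by
    rw [map_inv, ← Unitary.coe_star, ← Unitary.star_eq_inv, star_star]
  rw [star_mul, star_mul, h1] at h
  exact h.symm

theorem isEquivariantOp_mul {u : Γ →* unitary (H →L[ℂ] H)} {T S : H →L[ℂ] H}
    (hT : IsEquivariantOp u T) (hS : IsEquivariantOp u S) : IsEquivariantOp u (T * S) :=
  fun γ => by rw [← mul_assoc, hT γ, mul_assoc, hS γ, mul_assoc]

omit [MulAction Γ X] in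
theorem star_mem_roeAlgSet {u : Γ →* unitary (H →L[ℂ] H)} {T : H →L[ℂ] H}
    (hT : T ∈ RoeAlgSet ρ u) : star T ∈ RoeAlgSet ρ u :=
  let ⟨h1, h2, r, hr, h3⟩ := hT
  ⟨isEquivariantOp_star h1, isLocCompactOp_star h2, r, hr, hasPropLE_star h3⟩

omit [MulAction Γ X] in
theorem mul_mem_roeAlgSet [ProperSpace X] (hnd : NondegRep ρ) {u : Γ →* unitary (H →L[ℂ] H)}
    {B T : H →L[ℂ] H} (hB : IsEquivariantOp u B) (hBr : ∃ r : ℝ, 0 ≤ r ∧ HasPropLE ρ B r)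
    (hT : T ∈ RoeAlgSet ρ u) : B * T ∈ RoeAlgSet ρ u :=
  let ⟨h1, h2, s, hs, h3⟩ := hT
  let ⟨r, hr, h4⟩ := hBr
  ⟨isEquivariantOp_mul hB h1, isLocCompactOp_mul hnd h4 h2, r + s + 1, by positivity,
    hasPropLE_mul hnd h4 h3⟩

end Propagation

section QuadraticForm

/-- The quadratic form of the operator by which a real-valued function acts. -/
def quadForm (ρ : C₀(X, ℂ) →⋆ₙₐ[ℂ] (H →L[ℂ] H)) (g : C₀(X, ℝ)) (v : H) : ℝ :=
  (inner ℂ (ρ (complexify g) v) v).re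

variable (ρ : C₀(X, ℂ) →⋆ₙₐ[ℂ] (H →L[ℂ] H))

theorem quadForm_sub (g h : C₀(X, ℝ)) (v : H) :
    quadForm ρ (g - h) v = quadForm ρ g v - quadForm ρ h v := by
  simp [quadForm, complexify_sub]

theorem quadForm_smul (c : ℝ) (g : C₀(X, ℝ)) (v : H) :
    quadForm ρ (c • g) v = c * quadForm ρ g v := by
  simp [quadForm, complexify_smul]

theorem quadForm_mul_self (g : C₀(X, ℝ)) (v : H) :
    quadForm ρ (g * g) v = ‖ρ (complexify g) v‖ ^ 2 := by
  have h : ContinuousLinearMap.adjoint (ρ (complexify g)) = ρ (complexify g) := by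
    rw [← ContinuousLinearMap.star_eq_adjoint, ← map_star, star_complexify]
  have h2 := ContinuousLinearMap.adjoint_inner_left (ρ (complexify g)) v (ρ (complexify g) v)
  rw [h] at h2
  rw [quadForm, complexify_mul, map_mul, mul_apply_eq_comp, h2,
    inner_self_eq_norm_sq_to_K]
  norm_cast

theorem quadForm_nonneg {g : C₀(X, ℝ)} (hg : ∀ x, 0 ≤ g x) (v : H) : 0 ≤ quadForm ρ g v := by
  rw [← sqrtC0_mul_self hg, quadForm_mul_self]
  positivity

theorem quadForm_mono {g h : C₀(X, ℝ)} (hgh : ∀ x, g x ≤ h x) (v : H) :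
    quadForm ρ g v ≤ quadForm ρ h v := by
  have := quadForm_nonneg ρ (g := h - g) (fun x => by simpa using hgh x) v
  rw [quadForm_sub] at this
  linarith

theorem sum_le_finsum {J : Type*} {a : J → ℝ} (ha : ∀ j, 0 ≤ a j) (hf : a.support.Finite)
    (F : Finset J) : ∑ j ∈ F, a j ≤ ∑ᶠ j, a j := by
  classical
  rw [finsum_eq_sum_of_support_subset a (s := F ∪ hf.toFinset) (by simp)]
  exact Finset.sum_le_sum_of_subset_of_nonneg Finset.subset_union_left fun j _ _ => ha j

/-- A locally finite family of nonnegative functions summing to a constant acts by operators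
which sum strongly to that constant. -/
theorem hasSum_quadForm [ProperSpace X] (hnd : NondegRep ρ) {J : Type*} {g : J → C₀(X, ℝ)}
    {c : ℝ} (hg : ∀ j x, 0 ≤ g j x) (hlf : LocallyFinite fun j => Function.support (g j))
    (hsum : ∀ x, ∑ᶠ j, g j x = c) (v : H) :
    HasSum (fun j => quadForm ρ (g j) v) (c * ‖v‖ ^ 2) := by
  rcases isEmpty_or_nonempty X with hX | ⟨⟨x₀⟩⟩
  · have hH : ∀ w : H, w = 0 := by
      have : Submodule.span ℂ {w : H | ∃ (f : C₀(X, ℂ)) (v : H), ρ f v = w} = ⊥ := by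
        rw [Submodule.span_eq_bot]
        rintro _ ⟨f, v, rfl⟩
        have hf : f = 0 := by ext x; exact hX.elim x
        simp [hf]
      have hd := hnd.closure_eq
      rw [this] at hd
      intro w
      have hw : w ∈ closure ((⊥ : Submodule ℂ H) : Set H) := hd ▸ Set.mem_univ w
      simpa using hw
    simp [quadForm, hH v, hasSum_zero]
  have hfin : ∀ x, (Function.support fun j => g j x).Finite := fun x => hlf.point_finite x
  have hc : 0 ≤ c := hsum x₀ ▸ finsum_nonneg fun j => hg j x₀
  have hle : ∀ (F : Finset J) x, ∑ j ∈ F, g j x ≤ c := fun F x =>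
    hsum x ▸ sum_le_finsum (fun j => hg j x) (hfin x) F
  let A : Finset J → H →L[ℂ] H := fun F => ρ (complexify (∑ j ∈ F, g j))
  have hA : ∀ F, ‖A F‖ ≤ c := fun F => (norm_rho_le ρ _).trans <| norm_le_of_forall hc fun x => by
    rw [complexify_apply, Complex.norm_real, sum_apply, Real.norm_eq_abs, abs_of_nonneg
      (Finset.sum_nonneg fun j _ => hg j x)]
    exact hle F x
  have hC0 : ∀ f : C₀(X, ℂ), Tendsto (fun F => complexify (∑ j ∈ F, g j) * f) atTop
      (nhds ((c : ℂ) • f)) := by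
    classical
    intro f
    rw [Metric.tendsto_atTop]
    intro ε hε
    have hδ : 0 < ε / (2 * (c + 1)) := by positivity
    obtain ⟨K, hK, hKf⟩ := Filter.mem_cocompact.1
      (f.zero_at_infty'.eventually (Metric.ball_mem_nhds (0 : ℂ) hδ))
    refine ⟨(hlf.finite_nonempty_inter_compact hK).toFinset, fun F hF => ?_⟩
    rw [dist_eq_norm]
    refine (norm_le_of_forall (half_pos hε).le fun x => ?_).trans_lt (half_lt_self hε)
    have heq : (complexify (∑ j ∈ F, g j) * f - (c : ℂ) • f) x
        = ((∑ j ∈ F, g j x - c : ℝ) : ℂ) * f x := by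
      simp [sum_apply, sub_mul]
    rw [heq, norm_mul, Complex.norm_real, Real.norm_eq_abs]
    by_cases hx : x ∈ K
    · rw [← hsum x, finsum_eq_sum_of_support_subset (fun j => g j x) (s := F)]
      · simpa using (half_pos hε).le
      · intro j hj
        exact hF (by simpa using ⟨x, hj, hx⟩)
    · have h1 : ‖f x‖ < ε / (2 * (c + 1)) := by simpa using! hKf hx
      have h2 : |∑ j ∈ F, g j x - c| ≤ c := by
        rw [abs_le]
        have := hle F x
        have := Finset.sum_nonneg fun j (_ : j ∈ F) => hg j x
        constructor <;> linarith
      calc |∑ j ∈ F, g j x - c| * ‖f x‖ ≤ (c + 1) * (ε / (2 * (c + 1))) := by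
            gcongr
            linarith
        _ = ε / 2 := by field_simp
  have hstrong : ∀ w : H, Tendsto (fun F => A F w) atTop (nhds ((c : ℂ) • w)) := by
    have hequi : Equicontinuous fun F => (A F : H → H) := by
      refine (LipschitzWith.uniformEquicontinuous _ c.toNNReal fun F => ?_).equicontinuous
      exact (A F).lipschitz.weaken (by
        rw [← NNReal.coe_le_coe, coe_nnnorm, Real.coe_toNNReal _ hc]
        exact hA F)
    have hclosed := hequi.isClosed_setOfPred_tendsto (l := atTop)
      (f := fun w : H => (c : ℂ) • w) (by fun_prop)
    have hsub : (Submodule.span ℂ {w : H | ∃ (f : C₀(X, ℂ)) (v : H), ρ f v = w} : Set H) ⊆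
        {w | Tendsto (fun F => A F w) atTop (nhds ((c : ℂ) • w))} := by
      intro w hw
      induction hw using Submodule.span_induction with
      | mem w hw =>
        obtain ⟨f, v, rfl⟩ := hw
        have h := ((continuous_rho ρ).tendsto _).comp (hC0 f)
        have h' := ((ContinuousLinearMap.apply ℂ H v).continuous.tendsto _).comp h
        simpa [Function.comp_def, map_mul, map_smul] using h'
      | zero => simp
      | add x y _ _ hx hy => simpa using hx.add hy
      | smul a x _ hx =>
        have h := hx.const_smul a
        rw [smul_comm] at h
        simpa using h
    intro w
    have := closure_minimal hsub hclosed
    rw [hnd.closure_eq] at this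
    exact this (Set.mem_univ w)
  have h1 := (Complex.continuous_re.tendsto _).comp
    ((hstrong v).inner (𝕜 := ℂ) (tendsto_const_nhds (x := v)))
  have h2 : (inner ℂ ((c : ℂ) • v) v).re = c * ‖v‖ ^ 2 := by
    rw [inner_smul_left, inner_self_eq_norm_sq_to_K]
    change ((starRingEnd ℂ) (c : ℂ) * ((‖v‖ : ℝ) : ℂ) ^ 2).re = _
    rw [Complex.conj_ofReal]
    norm_cast
  rw [h2] at h1
  refine h1.congr fun F => ?_
  simp [A, quadForm, complexify_sum, map_sum, sum_inner]

end QuadraticForm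

section Isometries

omit [CompleteSpace H] in
theorem countable_of_orthonormal [TopologicalSpace.SeparableSpace H] {J : Type*} {b : J → H}
    (hb : Orthonormal ℂ b) : Countable J := by
  have hd : Pairwise (Function.onFun Disjoint fun j => Metric.ball (b j) (1 / 2)) := by
    intro i j hij
    refine Metric.ball_disjoint_ball ?_
    have h0 : inner ℂ (b i) (b j) = 0 := hb.2 hij
    have h1 : ‖b i - b j‖ ^ 2 = 2 := by
      rw [@norm_sub_sq ℂ, h0, hb.1 i, hb.1 j]
      norm_num
    rw [dist_eq_norm]
    nlinarith [norm_nonneg (b i - b j)]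
  have hc := Set.PairwiseDisjoint.countable_of_isOpen (a := Set.univ)
    (s := fun j => Metric.ball (b j) (1 / 2)) (fun i _ j _ hij => hd hij)
    (fun j _ => Metric.isOpen_ball) (fun j _ => Metric.nonempty_ball.2 (by norm_num))
  exact Set.countable_univ_iff.1 hc

/-- A separable Hilbert space embeds isometrically into each of its infinite-dimensional closed
subspaces. -/
theorem exists_linearIsometry_mem [TopologicalSpace.SeparableSpace H] (K : Submodule ℂ H)
    (hKc : IsClosed (K : Set H)) (hK : ¬ FiniteDimensional ℂ K) :
    ∃ W : H →ₗᵢ[ℂ] H, ∀ v, W v ∈ K := by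
  obtain ⟨w, b, -⟩ := exists_hilbertBasis ℂ H
  have : CompleteSpace K := hKc.completeSpace_coe
  obtain ⟨w', b', -⟩ := exists_hilbertBasis ℂ K
  have : Infinite w' := by
    by_contra h
    have : Finite w' := not_infinite_iff_finite.1 h
    have := Fintype.ofFinite w'
    exact hK b'.toOrthonormalBasis.toBasis.finiteDimensional_of_finite
  have := countable_of_orthonormal b.orthonormal
  obtain ⟨c, hc⟩ := exists_injective_nat w
  have ho : Orthonormal ℂ (fun i : w => b' (Infinite.natEmbedding w' (c i))) :=
    b'.orthonormal.comp (fun i : w => Infinite.natEmbedding w' (c i))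
      ((Infinite.natEmbedding w').injective.comp hc)
  exact ⟨K.subtypeₗᵢ.comp (ho.orthogonalFamily.linearIsometry.comp b.repr.toLinearIsometry),
    fun v => Subtype.coe_prop _⟩

theorem not_finiteDimensional_range {ρ : C₀(X, ℂ) →⋆ₙₐ[ℂ] (H →L[ℂ] H)} (hample : AmpleRep ρ)
    {f : C₀(X, ℂ)} (hf : f ≠ 0) :
    ¬ FiniteDimensional ℂ (ρ f).toLinearMap.range.topologicalClosure := by
  intro h
  refine hf (hample f ?_)
  have : ProperSpace (ρ f).toLinearMap.range.topologicalClosure := FiniteDimensional.proper ℂ _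
  have hmem : ∀ v, ρ f v ∈ (ρ f).toLinearMap.range.topologicalClosure := fun v =>
    Submodule.le_topologicalClosure _ ⟨v, rfl⟩
  have hcomp : IsCompactOperator ⇑((ρ f).codRestrict _ hmem) :=
    isCompactOperator_of_locallyCompactSpace_dom _
  exact hcomp.clm_comp (Submodule.subtypeL _)

/-- Summation of operators with pairwise orthogonal ranges. -/
theorem exists_hasSum_of_orthogonalFamily {J : Type*} {V : J → H →ₗᵢ[ℂ] H}
    (hV : OrthogonalFamily ℂ (fun _ : J => H) V) (S : J → H →L[ℂ] H) {q : H → ℝ} {M : ℝ}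
    (hq : ∀ v, HasSum (fun j => ‖S j v‖ ^ 2) (q v)) (hM : ∀ v, q v ≤ M ^ 2 * ‖v‖ ^ 2)
    (hM0 : 0 ≤ M) :
    ∃ B : H →L[ℂ] H, (∀ v, HasSum (fun j => V j (S j v)) (B v)) ∧ ∀ v, ‖B v‖ ^ 2 = q v := by
  have hs : ∀ v, Summable fun j => V j (S j v) := fun v =>
    (hV.summable_iff_norm_sq_summable fun j => S j v).2 (hq v).summable
  have hnorm : ∀ v, ‖∑' j, V j (S j v)‖ ^ 2 = q v := by
    intro v
    have h1 := ((hs v).hasSum.norm.pow 2)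
    refine tendsto_nhds_unique h1 ((hq v).congr fun F => ?_)
    exact (hV.norm_sum (fun j => S j v) F).symm
  let B₀ : H →ₗ[ℂ] H :=
    { toFun := fun v => ∑' j, V j (S j v)
      map_add' := fun v w => by simp only [map_add, (hs v).tsum_add (hs w)]
      map_smul' := fun c v => by
        simp only [map_smul, RingHom.id_apply, (hs v).tsum_const_smul] }
  refine ⟨B₀.mkContinuous M fun v => ?_, fun v => (hs v).hasSum, hnorm⟩
  refine le_of_sq_le_sq ?_ (by positivity)
  calc ‖B₀ v‖ ^ 2 = q v := hnorm v
    _ ≤ _ := by rw [mul_pow]; exact hM v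

end Isometries

section Translation

variable [IsIsometricSMul Γ X]

/-- The translate `x ↦ g (γ⁻¹ • x)` of a function vanishing at infinity. -/
def translate (γ : Γ) (g : C₀(X, ℝ)) : C₀(X, ℝ) where
  toFun x := g (γ⁻¹ • x)
  continuous_toFun := g.continuous.comp (continuous_const_smul _)
  zero_at_infty' :=
    g.zero_at_infty'.comp (Homeomorph.smul γ⁻¹).isClosedEmbedding.tendsto_cocompact

@[simp] theorem translate_apply (γ : Γ) (g : C₀(X, ℝ)) (x : X) :
    translate γ g x = g (γ⁻¹ • x) := rfl

variable {ρ : C₀(X, ℂ) →⋆ₙₐ[ℂ] (H →L[ℂ] H)} {u : Γ →* unitary (H →L[ℂ] H)}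

theorem rho_translate_mul (hcov : CovariantRep ρ u) (γ : Γ) (g : C₀(X, ℝ)) :
    ρ (complexify (translate γ g)) * (u γ : H →L[ℂ] H) = u γ * ρ (complexify g) := by
  rw [hcov γ (complexify g) (complexify (translate γ g)) (fun x => by simp), mul_assoc,
    Unitary.coe_star_mul_self, mul_one]

theorem quadForm_translate (hcov : CovariantRep ρ u) (γ : Γ) (g : C₀(X, ℝ)) (v : H) :
    quadForm ρ (translate γ g) v = quadForm ρ g (star (u γ : H →L[ℂ] H) v) := by
  rw [quadForm, hcov γ (complexify g) (complexify (translate γ g)) (fun x => by simp), quadForm,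
    mul_apply_eq_comp, mul_apply_eq_comp, ContinuousLinearMap.star_eq_adjoint,
    ContinuousLinearMap.adjoint_inner_right]

end Translation

section LocalFactor

theorem exists_norm_sq_eq_of_nonneg {Q : H →L[ℂ] H} (hQ : IsSelfAdjoint Q)
    (hpos : ∀ v, 0 ≤ (inner ℂ (Q v) v).re) :
    ∃ S : H →L[ℂ] H, ∀ v, ‖S v‖ ^ 2 = (inner ℂ (Q v) v).re := by
  have h0 : 0 ≤ Q := (ContinuousLinearMap.nonneg_iff_isPositive Q).2
    ((ContinuousLinearMap.isPositive_def').2 ⟨hQ, hpos⟩)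
  obtain ⟨S, rfl⟩ := CStarAlgebra.nonneg_iff_eq_star_mul_self.1 h0
  refine ⟨S, fun v => ?_⟩
  rw [mul_apply_eq_comp, ContinuousLinearMap.star_eq_adjoint,
    ContinuousLinearMap.adjoint_inner_left, inner_self_eq_norm_sq_to_K]
  norm_cast

variable {ρ : C₀(X, ℂ) →⋆ₙₐ[ℂ] (H →L[ℂ] H)}

theorem norm_sq_rho_mul_star_le (hnd : NondegRep ρ) {T : H →L[ℂ] H} {R m : ℝ}
    (hT : HasPropLE ρ T R) {φ κ θ : C₀(X, ℝ)} (hm : 0 ≤ m) (hφ : ∀ x, φ x ^ 2 ≤ m)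
    (hθ : ∀ x, m * κ x ^ 2 ≤ θ x) (hκ : ∀ x ∈ tsupport φ, ∀ y, κ y ≠ 1 → R ≤ dist x y) (v : H) :
    ‖ρ (complexify φ) (star T v)‖ ^ 2 ≤ ‖T‖ ^ 2 * quadForm ρ θ v := by
  have hsupp : tsupport ⇑(complexify φ) ⊆ tsupport φ :=
    closure_mono fun x hx h => hx (by simp [h])
  have h1 := rho_mul_eq_rho_mul_mul_rho hnd (hasPropLE_star hT) (f := complexify φ)
    (k := complexify κ) fun x hx y hy => hκ x (hsupp hx) y fun h => hy (by simp [h])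
  have h2 : ‖ρ (complexify φ)‖ ≤ √m := (norm_rho_le ρ _).trans <|
    norm_le_of_forall (Real.sqrt_nonneg m) fun x => by
      simpa using Real.abs_le_sqrt (hφ x)
  have h3 : ‖ρ (complexify φ) (star T v)‖ ≤ √m * (‖T‖ * ‖ρ (complexify κ) v‖) := by
    have : ρ (complexify φ) (star T v) = ρ (complexify φ) (star T (ρ (complexify κ) v)) :=
      congrArg (fun A : H →L[ℂ] H => A v) h1
    rw [this]
    refine (ContinuousLinearMap.le_of_opNorm_le _ h2 _).trans ?_
    gcongr
    exact ContinuousLinearMap.le_of_opNorm_le _ (norm_star T).le _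
  calc ‖ρ (complexify φ) (star T v)‖ ^ 2 ≤ (√m * (‖T‖ * ‖ρ (complexify κ) v‖)) ^ 2 := by gcongr
    _ = ‖T‖ ^ 2 * quadForm ρ (m • (κ * κ)) v := by
      rw [quadForm_smul, quadForm_mul_self, mul_pow, Real.sq_sqrt hm]; ring
    _ ≤ _ := by
      gcongr
      refine quadForm_mono ρ (fun x => ?_) v
      simpa [sq] using hθ x

theorem exists_localFactor (hnd : NondegRep ρ) {T : H →L[ℂ] H} {R m : ℝ}
    (hT : HasPropLE ρ T R) {φ κ θ : C₀(X, ℝ)} (hm : 0 ≤ m) (hφ : ∀ x, φ x ^ 2 ≤ m)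
    (hθ : ∀ x, m * κ x ^ 2 ≤ θ x) (hκ : ∀ x ∈ tsupport φ, ∀ y, κ y ≠ 1 → R ≤ dist x y) :
    ∃ S : H →L[ℂ] H, ∀ v,
      ‖S v‖ ^ 2 = ‖T‖ ^ 2 * quadForm ρ θ v - ‖ρ (complexify φ) (star T v)‖ ^ 2 := by
  have hform : ∀ v, (inner ℂ ((((‖T‖ ^ 2 : ℝ) : ℂ) • ρ (complexify θ) -
      T * ρ (complexify (φ * φ)) * star T) v) v).re =
      ‖T‖ ^ 2 * quadForm ρ θ v - ‖ρ (complexify φ) (star T v)‖ ^ 2 := by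
    intro v
    rw [← quadForm_mul_self, quadForm, quadForm]
    have : inner ℂ (T (ρ (complexify (φ * φ)) (star T v))) v =
        inner ℂ (ρ (complexify (φ * φ)) (star T v)) (star T v) := by
      rw [ContinuousLinearMap.star_eq_adjoint, ContinuousLinearMap.adjoint_inner_right]
    rw [_root_.sub_apply, _root_.smul_apply, inner_sub_left,
      mul_apply_eq_comp, mul_apply_eq_comp, this, inner_smul_left, Complex.conj_ofReal,
      Complex.sub_re, Complex.re_ofReal_mul]
  have hsa : IsSelfAdjoint (((‖T‖ ^ 2 : ℝ) : ℂ) • ρ (complexify θ) -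
      T * ρ (complexify (φ * φ)) * star T) := by
    rw [isSelfAdjoint_iff]
    simp only [star_sub, star_smul, star_mul, star_star, ← map_star, star_complexify, mul_assoc]
    simp
  obtain ⟨S, hS⟩ := exists_norm_sq_eq_of_nonneg hsa fun v => by
    rw [hform]
    linarith [norm_sq_rho_mul_star_le hnd hT hm hφ hθ hκ v]
  exact ⟨S, fun v => (hS v).trans (hform v)⟩

end LocalFactor

/-- The functions on `X` used to compare `T T*` with a multiple of `‖T‖²` for all operators `T` of
propagation at most `R`: the translates of `φ i ^ 2` form a partition of unity, those of `θ i` sum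
to the constant `bound`, `θ i` dominates `weight i` near the support of `φ i`, and the translates of
the `w i` are disjoint bumps. -/
structure EquivariantPartition (X : Type*) [MetricSpace X] (Γ : Type*) [Group Γ] [MulAction Γ X]
    (R : ℝ) where
  /-- representatives of the orbits -/
  index : Set X
  /-- the sum of the translates of `θ` -/
  bound : ℝ
  /-- a bound for the size of the supports -/
  radius : ℝ
  /-- a bound for `φ i ^ 2` -/
  weight : index → ℝ
  /-- the square root of a partition of unity -/
  φ : index → C₀(X, ℝ)
  /-- cutoff functions which are `1` near the support of `φ` -/
  κ : index → C₀(X, ℝ)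
  /-- functions dominating the cutoffs -/
  θ : index → C₀(X, ℝ)
  /-- disjoint bump functions -/
  w : index → C₀(X, ℝ)
  one_le_bound : 1 ≤ bound
  radius_nonneg : 0 ≤ radius
  weight_nonneg : ∀ i, 0 ≤ weight i
  φ_sq_le : ∀ i x, φ i x ^ 2 ≤ weight i
  κ_sq_le : ∀ i x, weight i * κ i x ^ 2 ≤ θ i x
  κ_eq_one : ∀ i, ∀ x ∈ tsupport (φ i), ∀ y, κ i y ≠ 1 → R ≤ dist x y
  dist_le_of_θ : ∀ i x, θ i x ≠ 0 → dist x i ≤ radius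
  dist_le_of_w : ∀ i x, w i x ≠ 0 → dist x i ≤ radius
  w_ne_zero : ∀ i, w i ≠ 0
  w_disjoint : ∀ j j' : index × Γ, j ≠ j' → ∀ x : X,
    w j.1 (j.2⁻¹ • x) * w j'.1 (j'.2⁻¹ • x) = 0
  locallyFinite_φ : LocallyFinite fun j : index × Γ => {x : X | φ j.1 (j.2⁻¹ • x) ≠ 0}
  locallyFinite_θ : LocallyFinite fun j : index × Γ => {x : X | θ j.1 (j.2⁻¹ • x) ≠ 0}
  finsum_φ : ∀ x : X, ∑ᶠ j : index × Γ, φ j.1 (j.2⁻¹ • x) ^ 2 = 1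
  finsum_θ : ∀ x : X, ∑ᶠ j : index × Γ, θ j.1 (j.2⁻¹ • x) = bound

section Defect

variable {ρ : C₀(X, ℂ) →⋆ₙₐ[ℂ] (H →L[ℂ] H)} {u : Γ →* unitary (H →L[ℂ] H)}

omit [CompleteSpace H] in
theorem eq_zero_of_mem_closure_range {E : Type*} [NormedAddCommGroup E] [NormedSpace ℂ E]
    {A : H →L[ℂ] H} {B : H →L[ℂ] E} (hBA : ∀ v, B (A v) = 0) {v : H}
    (hv : v ∈ A.toLinearMap.range.topologicalClosure) : B v = 0 := by
  have hle : A.toLinearMap.range.topologicalClosure ≤ B.toLinearMap.ker :=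
    Submodule.topologicalClosure_minimal _ (by rintro _ ⟨a, rfl⟩; exact hBA a) B.isClosed_ker
  exact hle hv

theorem adjoint_rho_complexify (g : C₀(X, ℝ)) :
    ContinuousLinearMap.adjoint (ρ (complexify g)) = ρ (complexify g) := by
  rw [← ContinuousLinearMap.star_eq_adjoint, ← map_star, star_complexify]

theorem star_unitary_apply (γ : Γ) (v : H) :
    star (u γ : H →L[ℂ] H) ((u γ : H →L[ℂ] H) v) = v := by
  rw [← mul_apply_eq_comp, Unitary.coe_star_mul_self]
  rfl

/-- The isometries `u γ ∘ W i`. -/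
def translateIsometry {ι : Type*} (u : Γ →* unitary (H →L[ℂ] H)) (W : ι → H →ₗᵢ[ℂ] H)
    (j : ι × Γ) : H →ₗᵢ[ℂ] H :=
  (Unitary.linearIsometryEquiv (u j.2)).toLinearIsometry.comp (W j.1)

theorem translateIsometry_apply {ι : Type*} (W : ι → H →ₗᵢ[ℂ] H) (j : ι × Γ) (v : H) :
    translateIsometry u W j v = (u j.2 : H →L[ℂ] H) (W j.1 v) := rfl

variable [IsIsometricSMul Γ X]

theorem inner_unitary_eq_zero (hcov : CovariantRep ρ u) {g h : C₀(X, ℝ)} {γ δ : Γ}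
    (hgh : translate γ g * translate δ h = 0) {v w : H}
    (hv : v ∈ (ρ (complexify g)).toLinearMap.range.topologicalClosure)
    (hw : w ∈ (ρ (complexify h)).toLinearMap.range.topologicalClosure) :
    inner ℂ ((u γ : H →L[ℂ] H) v) ((u δ : H →L[ℂ] H) w) = 0 := by
  have h1 : ρ (complexify g) * star (u γ : H →L[ℂ] H) * (u δ : H →L[ℂ] H) *
      ρ (complexify h) = 0 := by
    have h2 : star (u γ : H →L[ℂ] H) * ρ (complexify (translate γ g)) =
        ρ (complexify g) * star (u γ : H →L[ℂ] H) := by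
      have := congrArg star (rho_translate_mul hcov γ g)
      simpa only [star_mul, ← map_star, star_complexify] using this
    rw [← h2, mul_assoc, ← rho_translate_mul hcov, mul_assoc, ← mul_assoc (ρ _), ← map_mul,
      ← complexify_mul, hgh]
    have : complexify (0 : C₀(X, ℝ)) = 0 := by ext x; simp
    rw [this, map_zero, zero_mul, mul_zero]
  have h3 : (ρ (complexify g) * star (u γ : H →L[ℂ] H) * (u δ : H →L[ℂ] H)) w = 0 :=
    eq_zero_of_mem_closure_range (fun a => congrArg (fun A : H →L[ℂ] H => A a) h1) hw
  have h4 : innerSL ℂ (star (u γ : H →L[ℂ] H) ((u δ : H →L[ℂ] H) w)) v = 0 := by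
    refine eq_zero_of_mem_closure_range (fun a => ?_) hv
    rw [innerSL_apply_apply, ← adjoint_rho_complexify, ContinuousLinearMap.adjoint_inner_right]
    exact (congrArg (fun z => inner ℂ z a) h3).trans (inner_zero_left _)
  rw [innerSL_apply_apply, ContinuousLinearMap.star_eq_adjoint,
    ContinuousLinearMap.adjoint_inner_left] at h4
  rw [← inner_conj_symm, h4, map_zero]

variable {R : ℝ} (P : EquivariantPartition X Γ R) {T : H →L[ℂ] H}

theorem EquivariantPartition.hasSum_norm_sq [ProperSpace X] (hnd : NondegRep ρ)
    (hcov : CovariantRep ρ u) (hTu : IsEquivariantOp u T) {S : P.index → H →L[ℂ] H}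
    (hS : ∀ i v, ‖S i v‖ ^ 2 =
      ‖T‖ ^ 2 * quadForm ρ (P.θ i) v - ‖ρ (complexify (P.φ i)) (star T v)‖ ^ 2) (v : H) :
    HasSum (fun j : P.index × Γ => ‖(S j.1 * star (u j.2 : H →L[ℂ] H)) v‖ ^ 2)
      (P.bound * ‖T‖ ^ 2 * ‖v‖ ^ 2 - ‖star T v‖ ^ 2) := by
  have hθ0 : ∀ i x, 0 ≤ P.θ i x := fun i x =>
    (mul_nonneg (P.weight_nonneg i) (sq_nonneg _)).trans (P.κ_sq_le i x)
  have h1 := (hasSum_quadForm ρ hnd (g := fun j : P.index × Γ => translate j.2 (P.θ j.1))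
    (fun j x => hθ0 _ _) P.locallyFinite_θ P.finsum_θ v).mul_left (‖T‖ ^ 2)
  have h2 := hasSum_quadForm ρ hnd
    (g := fun j : P.index × Γ => translate j.2 (P.φ j.1 * P.φ j.1))
    (fun j x => mul_self_nonneg _)
    (P.locallyFinite_φ.subset fun j x hx h => hx (by simp [h]))
    (fun x => by simpa [sq] using P.finsum_φ x) (star T v)
  have h3 := h1.sub h2
  rw [one_mul, ← mul_assoc, mul_comm (‖T‖ ^ 2)] at h3
  refine h3.congr_fun fun j => ?_
  have hc : star T (star (u j.2 : H →L[ℂ] H) v) = star (u j.2 : H →L[ℂ] H) (star T v) := by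
    have := congrArg star (hTu j.2)
    rw [star_mul, star_mul] at this
    exact congrArg (fun A : H →L[ℂ] H => A v) this
  rw [mul_apply_eq_comp, hS, hc, quadForm_translate hcov, quadForm_translate hcov,
    quadForm_mul_self]

theorem EquivariantPartition.exists_defect [ProperSpace X] [TopologicalSpace.SeparableSpace H]
    (hnd : NondegRep ρ) (hample : AmpleRep ρ) (hcov : CovariantRep ρ u)
    (hTu : IsEquivariantOp u T) (hT : HasPropLE ρ T R) :
    ∃ B : H →L[ℂ] H, IsEquivariantOp u B ∧ (∃ r : ℝ, 0 ≤ r ∧ HasPropLE ρ B r) ∧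
      ∀ v, ‖B v‖ ^ 2 = P.bound * ‖T‖ ^ 2 * ‖v‖ ^ 2 - ‖star T v‖ ^ 2 := by
  choose S hS using fun i => exists_localFactor hnd hT (P.weight_nonneg i) (P.φ_sq_le i)
    (P.κ_sq_le i) (P.κ_eq_one i)
  have hw : ∀ i, complexify (P.w i) ≠ 0 := fun i h => P.w_ne_zero i <| by
    ext x
    simpa using congrArg (fun f : C₀(X, ℂ) => f x) h
  choose W hW using fun i => exists_linearIsometry_mem _
    (Submodule.isClosed_topologicalClosure _) (not_finiteDimensional_range hample (hw i))
  have horth : OrthogonalFamily ℂ (fun _ : P.index × Γ => H) (translateIsometry u W) := by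
    intro j j' hjj' a b
    exact inner_unitary_eq_zero hcov
      (by ext x; simpa using P.w_disjoint j j' hjj' x) (hW _ a) (hW _ b)
  obtain ⟨B, hB, hBn⟩ := exists_hasSum_of_orthogonalFamily horth
    (fun j => S j.1 * star (u j.2 : H →L[ℂ] H)) (M := √P.bound * ‖T‖)
    (P.hasSum_norm_sq hnd hcov hTu hS)
    (fun v => by
      rw [mul_pow, Real.sq_sqrt (zero_le_one.trans P.one_le_bound)]
      linarith [sq_nonneg ‖star T v‖])
    (by positivity)
  refine ⟨B, fun δ => ?_, ⟨P.radius + P.radius + 1, by linarith [P.radius_nonneg], ?_⟩, hBn⟩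
  · ext v
    have h1 := (hB v).mapL (u δ : H →L[ℂ] H)
    have h2 := hB ((u δ : H →L[ℂ] H) v)
    rw [← (Equiv.prodCongr (Equiv.refl P.index) (Equiv.mulLeft δ)).hasSum_iff] at h2
    refine (h1.congr_fun fun j => ?_).unique h2
    simp only [Function.comp_apply, translateIsometry_apply, mul_apply_eq_comp,
      Equiv.prodCongr_apply, Prod.map_fst, Prod.map_snd, Equiv.refl_apply, Equiv.coe_mulLeft,
      map_mul, Submonoid.coe_mul, star_mul, star_unitary_apply]
  · intro f g hfg
    ext v
    refine ((hB (ρ g v)).mapL (ρ f)).unique ?_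
    convert! hasSum_zero with j
    rw [translateIsometry_apply]
    by_cases hx : ∃ x, f x ≠ 0 ∧ P.w j.1 (j.2⁻¹ • x) ≠ 0
    · have hy : complexify (translate j.2 (P.θ j.1)) * g = 0 := by
        obtain ⟨x, hfx, hwx⟩ := hx
        ext y
        by_contra hy
        have hy' : P.θ j.1 (j.2⁻¹ • y) ≠ 0 ∧ g y ≠ 0 := by simpa using hy
        have h1 := hfg x (subset_closure hfx) y (subset_closure hy'.2)
        have h2 := P.dist_le_of_w _ _ hwx
        have h3 := P.dist_le_of_θ _ _ hy'.1
        rw [← dist_smul j.2⁻¹ x y] at h1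
        linarith [dist_triangle_right (j.2⁻¹ • x) (j.2⁻¹ • y) (j.1 : X)]
      have h0 : ‖(S j.1 * star (u j.2 : H →L[ℂ] H)) (ρ g v)‖ ^ 2 ≤ 0 := by
        rw [mul_apply_eq_comp, hS, ← quadForm_translate hcov, quadForm, ← mul_apply_eq_comp,
          ← map_mul, hy, map_zero]
        simp
      have h1 : (S j.1 * star (u j.2 : H →L[ℂ] H)) (ρ g v) = 0 :=
        norm_eq_zero.1 (pow_eq_zero_iff two_ne_zero |>.1 (h0.antisymm (sq_nonneg _)))
      rw [h1, map_zero, map_zero, map_zero]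
    · have hf : f * complexify (translate j.2 (P.w j.1)) = 0 := by
        ext x
        by_contra h
        exact hx ⟨x, by simpa using h⟩
      have h1 : ρ f * (u j.2 : H →L[ℂ] H) * ρ (complexify (P.w j.1)) = 0 := by
        rw [mul_assoc, ← rho_translate_mul hcov, ← mul_assoc, ← map_mul, hf, map_zero, zero_mul]
      exact eq_zero_of_mem_closure_range (B := ρ f * (u j.2 : H →L[ℂ] H))
        (fun a => congrArg (fun A : H →L[ℂ] H => A a) h1) (hW _ _)

end Defect

section NormBound

theorem norm_le_of_star_mul_self_eq {a b : H →L[ℂ] H} {c : ℝ} (hc : 0 ≤ c)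
    (h : star a * a * (star a * a) + star b * b = (c : ℂ) • (star a * a)) : ‖a‖ ≤ √c := by
  have h1 : ∀ v, ‖(star a * a) v‖ ≤ √c * ‖a‖ * ‖v‖ := by
    intro v
    have h2 : ∀ x : H →L[ℂ] H, (inner ℂ ((star x * x) v) v).re = ‖x v‖ ^ 2 := fun x => by
      rw [mul_apply_eq_comp, ContinuousLinearMap.star_eq_adjoint,
        ContinuousLinearMap.adjoint_inner_left, inner_self_eq_norm_sq_to_K]
      norm_cast
    have h3 := congrArg (fun x : H →L[ℂ] H => (inner ℂ (x v) v).re) h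
    have h4 : star (star a * a) * (star a * a) = star a * a * (star a * a) := by simp
    simp only [_root_.add_apply, inner_add_left, Complex.add_re, _root_.smul_apply,
      inner_smul_left, Complex.conj_ofReal, Complex.re_ofReal_mul] at h3
    rw [← h4, h2, h2, h2] at h3
    have h5 : ‖a v‖ ^ 2 ≤ (‖a‖ * ‖v‖) ^ 2 := by
      gcongr
      exact a.le_opNorm v
    refine le_of_sq_le_sq ?_ (by positivity)
    rw [mul_assoc, mul_pow, Real.sq_sqrt hc]
    nlinarith [sq_nonneg ‖b v‖]
  have h2 := ContinuousLinearMap.opNorm_le_bound _ (by positivity) h1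
  rw [CStarRing.norm_star_mul_self] at h2
  rcases (norm_nonneg a).eq_or_lt with h0 | h0
  · rw [← h0]; positivity
  · exact le_of_mul_le_mul_right h2 h0

theorem star_mul_self_eq_of_norm_sq {B T : H →L[ℂ] H} {c : ℝ}
    (h : ∀ v, ‖B v‖ ^ 2 = c * ‖v‖ ^ 2 - ‖star T v‖ ^ 2) :
    star B * B = (c : ℂ) • 1 - T * star T := by
  have h0 : ∀ (x : H →L[ℂ] H) v, inner ℂ ((star x * x) v) v = ((‖x v‖ ^ 2 : ℝ) : ℂ) := by
    intro x v
    rw [mul_apply_eq_comp, ContinuousLinearMap.star_eq_adjoint,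
      ContinuousLinearMap.adjoint_inner_left, inner_self_eq_norm_sq_to_K]
    norm_cast
  have h1 : ∀ v, inner ℂ ((T * star T) v) v = ((‖star T v‖ ^ 2 : ℝ) : ℂ) := fun v => by
    simpa using h0 (star T) v
  refine ContinuousLinearMap.coe_injective ((ext_inner_map _ _).1 fun v => ?_)
  change inner ℂ ((star B * B) v) v = inner ℂ (((c : ℂ) • 1 - T * star T : H →L[ℂ] H) v) v
  rw [h0, h, _root_.sub_apply, inner_sub_left, h1, _root_.smul_apply, inner_smul_left,
    Complex.conj_ofReal]
  change _ = (c : ℂ) * inner ℂ v v - _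
  rw [inner_self_eq_norm_sq_to_K]
  push_cast
  rfl

theorem EquivariantPartition.norm_le [ProperSpace X] [IsIsometricSMul Γ X]
    [TopologicalSpace.SeparableSpace H] {R : ℝ} (P : EquivariantPartition X Γ R)
    {ρ : C₀(X, ℂ) →⋆ₙₐ[ℂ] (H →L[ℂ] H)} {u : Γ →* unitary (H →L[ℂ] H)}
    (hnd : NondegRep ρ) (hample : AmpleRep ρ) (hcov : CovariantRep ρ u) {T : H →L[ℂ] H}
    (hTR : T ∈ RoeAlgSet ρ u) (hT : HasPropLE ρ T R) {H' : Type*} [NormedAddCommGroup H']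
    [InnerProductSpace ℂ H'] [CompleteSpace H'] {σ : (H →L[ℂ] H) → (H' →L[ℂ] H')}
    (hσ : IsStarRepOn (RoeAlgSet ρ u) σ) : ‖σ T‖ ≤ √P.bound * ‖T‖ := by
  obtain ⟨hadd, hsmul, hmul, hstar⟩ := hσ
  obtain ⟨B, hBu, hBr, hB⟩ := P.exists_defect hnd hample hcov hTR.1 hT
  have hP : 0 ≤ P.bound := zero_le_one.trans P.one_le_bound
  have hmulmem : ∀ {S S'}, S ∈ RoeAlgSet ρ u → S' ∈ RoeAlgSet ρ u → S * S' ∈ RoeAlgSet ρ u :=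
    fun hS hS' => mul_mem_roeAlgSet hnd hS.1 hS.2.2 hS'
  have hA := mul_mem_roeAlgSet hnd hBu hBr hTR
  have hTT := hmulmem (star_mem_roeAlgSet hTR) hTR
  have hAA := hmulmem (star_mem_roeAlgSet hA) hA
  have key : star T * T * (star T * T) + star (B * T) * (B * T) =
      ((P.bound * ‖T‖ ^ 2 : ℝ) : ℂ) • (star T * T) := by
    have h1 : star (B * T) * (B * T) = star T * (star B * B) * T := by
      simp only [star_mul, mul_assoc]
    rw [h1, star_mul_self_eq_of_norm_sq hB, mul_sub, sub_mul]
    simp only [mul_assoc, mul_smul_comm, smul_mul_assoc, one_mul, add_sub_cancel]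
  have h2 := congrArg σ key
  rw [hadd _ (hmulmem hTT hTT) _ hAA, hsmul _ _ hTT, hmul _ hTT _ hTT,
    hmul _ (star_mem_roeAlgSet hTR) _ hTR, hmul _ (star_mem_roeAlgSet hA) _ hA, hstar _ hTR,
    hstar _ hA] at h2
  have h3 := norm_le_of_star_mul_self_eq (by positivity) h2
  rwa [Real.sqrt_mul hP, Real.sqrt_sq (norm_nonneg T)] at h3

end NormBound

section OrbitSum

variable [IsIsometricSMul Γ X]

theorem dist_inv_smul_left (γ : Γ) (x y : X) : dist (γ⁻¹ • x) y = dist x (γ • y) := by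
  rw [← dist_smul γ, smul_inv_smul]

variable (Γ) {I : Set X}

/-- The sum of all translates of a family of functions. -/
def orbitSum (g : I → X → ℝ) (x : X) : ℝ := ∑ᶠ j : I × Γ, g j.1 (j.2⁻¹ • x)

omit [MetricSpace X] [IsIsometricSMul Γ X] in
theorem orbitSum_smul (g : I → X → ℝ) (γ : Γ) (x : X) :
    orbitSum Γ g (γ • x) = orbitSum Γ g x := by
  rw [orbitSum, orbitSum, ← finsum_comp_equiv (Equiv.prodCongr (Equiv.refl I) (Equiv.mulLeft γ))]
  simp [mul_smul]

omit [MetricSpace X] [IsIsometricSMul Γ X] in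
theorem orbitSum_mul (g : I → X → ℝ) {f : X → ℝ}
    (hf : ∀ (γ : Γ) x, f (γ • x) = f x) (x : X) :
    orbitSum Γ (fun i y => f y * g i y) x = f x * orbitSum Γ g x := by
  simp only [orbitSum, hf]
  rw [mul_finsum]

variable {Γ}
variable (hfin : ∀ (L : ℝ) (x : X), {j : I × Γ | dist x (j.2 • (j.1 : X)) ≤ L}.Finite)
  {g : I → X → ℝ} {L : ℝ} (hg : ∀ i x, g i x ≠ 0 → dist x i ≤ L)

include hfin hg

theorem locallyFinite_orbit :
    LocallyFinite fun j : I × Γ => {x : X | g j.1 (j.2⁻¹ • x) ≠ 0} := by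
  intro x
  refine ⟨Metric.ball x 1, Metric.ball_mem_nhds x one_pos, (hfin (L + 1) x).subset ?_⟩
  rintro j ⟨y, hy, hyx⟩
  have h1 := hg _ _ hy
  rw [dist_inv_smul_left] at h1
  have h2 := dist_triangle_left x (j.2 • (j.1 : X)) y
  have h3 := Metric.mem_ball.1 hyx
  exact h2.trans (by linarith)

theorem finite_support_orbit (x : X) :
    (Function.support fun j : I × Γ => g j.1 (j.2⁻¹ • x)).Finite :=
  (hfin L x).subset fun j hj => by simpa [dist_inv_smul_left] using hg _ _ hj

theorem continuous_orbitSum (hc : ∀ i, Continuous (g i)) : Continuous (orbitSum Γ g) :=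
  continuous_finsum (fun j => (hc j.1).comp (continuous_const_smul j.2⁻¹))
    (locallyFinite_orbit hfin hg)

theorem orbitSum_le {m : I → ℝ} {N : ℝ}
    (hN : ∀ (x : X) (F : Finset (I × Γ)), (∀ j ∈ F, dist x (j.2 • (j.1 : X)) ≤ L) →
      ∑ j ∈ F, m j.1 ≤ N) (hgm : ∀ i x, g i x ≤ m i) (x : X) : orbitSum Γ g x ≤ N := by
  rw [orbitSum, finsum_eq_sum _ (finite_support_orbit hfin hg x)]
  refine (Finset.sum_le_sum fun j _ => hgm _ _).trans (hN x _ fun j hj => ?_)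
  rw [← dist_inv_smul_left]
  exact hg _ _ (by simpa using hj)

theorem orbitSum_add {g' : I → X → ℝ} (hg' : ∀ i x, g' i x ≠ 0 → dist x i ≤ L) (x : X) :
    orbitSum Γ (fun i y => g i y + g' i y) x = orbitSum Γ g x + orbitSum Γ g' x :=
  finsum_add_distrib (finite_support_orbit hfin hg x) (finite_support_orbit hfin hg' x)

end OrbitSum

section Net

variable [IsIsometricSMul Γ X]

omit [IsIsometricSMul Γ X] in
theorem finite_dist_smul_le [ProperSpace X] [ProperlyDiscontinuousSMul Γ X] (x y : X) (L : ℝ) :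
    {γ : Γ | dist x (γ • y) ≤ L}.Finite := by
  refine (ProperlyDiscontinuousSMul.finite_disjoint_inter_image (Γ := Γ)
    (isCompact_singleton (x := y)) (isCompact_closedBall x L)).subset fun γ hγ => ?_
  exact ⟨γ • y, ⟨y, rfl, rfl⟩, by rwa [Metric.mem_closedBall, dist_comm]⟩

theorem exists_orbit_net (Γ : Type*) [Group Γ] [MulAction Γ X] [IsIsometricSMul Γ X] {s : ℝ}
    (hs : 0 < s) : ∃ I : Set X,
    (∀ x ∈ I, ∀ y ∈ I, ∀ γ : Γ, dist x (γ • y) < s → x = y) ∧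
      ∀ x, ∃ i ∈ I, ∃ γ : Γ, dist x (γ • i) < s := by
  obtain ⟨I, hI⟩ := zorn_subset
    {I : Set X | ∀ x ∈ I, ∀ y ∈ I, ∀ γ : Γ, dist x (γ • y) < s → x = y} fun c hc hchain =>
      ⟨⋃₀ c, fun x ⟨A, hA, hx⟩ y ⟨B, hB, hy⟩ => by
        rcases hchain.total hA hB with h | h
        · exact hc hB x (h hx) y hy
        · exact hc hA x hx y (h hy), fun A hA => Set.subset_sUnion_of_mem hA⟩
  refine ⟨I, hI.prop, fun x => ?_⟩
  by_contra! hx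
  have hins : insert x I ∈
      {I : Set X | ∀ x ∈ I, ∀ y ∈ I, ∀ γ : Γ, dist x (γ • y) < s → x = y} := by
    rintro y (rfl | hy) z (rfl | hz) γ h
    · rfl
    · exact absurd h (hx z hz γ).not_gt
    · refine absurd ?_ (hx y hy γ⁻¹).not_gt
      rwa [← dist_inv_smul_left, dist_comm] at h
    · exact hI.prop y hy z hz γ h
  have hxI : x ∈ I := hI.le_of_ge hins (Set.subset_insert x I) (Set.mem_insert x I)
  have := hx x hxI 1
  rw [one_smul, dist_self] at this
  linarith

end Net

section Weights

variable [IsIsometricSMul Γ X]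

variable (Γ) in
/-- The elements of `Γ` moving `i` by less than `s`. -/
def smallMoves (s : ℝ) (i : X) : Set Γ := {γ | dist i (γ • i) < s}

variable (Γ) in
/-- The inverse of the number of elements of `Γ` moving `i` by less than `s`. -/
def orbitWeight (s : ℝ) (i : X) : ℝ := ((smallMoves Γ s i).ncard : ℝ)⁻¹

omit [IsIsometricSMul Γ X] in
theorem finite_smallMoves [ProperSpace X] [ProperlyDiscontinuousSMul Γ X] (s : ℝ) (i : X) :
    (smallMoves Γ s i).Finite :=
  (finite_dist_smul_le i i s).subset fun _ h => le_of_lt (α := ℝ) h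

omit [IsIsometricSMul Γ X] in
theorem orbitWeight_nonneg (s : ℝ) (i : X) : 0 ≤ orbitWeight Γ s i := by
  unfold orbitWeight; positivity

omit [IsIsometricSMul Γ X] in
theorem ncard_mul_orbitWeight [ProperSpace X] [ProperlyDiscontinuousSMul Γ X] {s : ℝ} (hs : 0 < s)
    (i : X) : ((smallMoves Γ s i).ncard : ℝ) * orbitWeight Γ s i = 1 := by
  refine mul_inv_cancel₀ (Nat.cast_ne_zero.2 ?_)
  exact Set.ncard_ne_zero_of_mem (a := 1) (by simpa [smallMoves] using hs) (finite_smallMoves s i)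

variable {I : Set X} {s : ℝ}

theorem smallMoves_of_dist_lt (hI : ∀ x ∈ I, ∀ y ∈ I, ∀ γ : Γ, dist x (γ • y) < s → x = y)
    {j j' : I × Γ} (h : dist (j.2 • (j.1 : X)) (j'.2 • (j'.1 : X)) < s) :
    j.1 = j'.1 ∧ j.2⁻¹ * j'.2 ∈ smallMoves Γ s (j.1 : X) := by
  have h1 : dist (j.1 : X) ((j.2⁻¹ * j'.2) • (j'.1 : X)) < s := by
    rwa [mul_smul, dist_comm, dist_inv_smul_left, dist_comm]
  have h2 := Subtype.ext (hI _ j.1.2 _ j'.1.2 _ h1)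
  refine ⟨h2, ?_⟩
  rw [← h2] at h1
  exact h1

theorem exists_sum_orbitWeight_eq_one [ProperSpace X] [ProperlyDiscontinuousSMul Γ X] (hs : 0 < s)
    (hcover : ∀ x, ∃ i ∈ I, ∃ γ : Γ, dist x (γ • i) < s) (x : X) :
    ∃ F : Finset (I × Γ), (∀ j ∈ F, dist x (j.2 • (j.1 : X)) ≤ 2 * s) ∧
      ∑ j ∈ F, orbitWeight Γ s (j.1 : X) = 1 := by
  obtain ⟨i, hi, γ, hγ⟩ := hcover x
  have hfin := finite_smallMoves (Γ := Γ) s i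
  have hinj : Function.Injective fun δ : Γ => ((⟨i, hi⟩, γ * δ) : I × Γ) := fun δ δ' h => by
    simpa using h
  refine ⟨hfin.toFinset.map ⟨_, hinj⟩, fun j hj => ?_, ?_⟩
  · obtain ⟨δ, hδ, rfl⟩ := Finset.mem_map.1 hj
    have h1 : dist i (δ • i) < s := by simpa [smallMoves] using hδ
    rw [← dist_smul γ] at h1
    have h2 := dist_triangle x (γ • i) (γ • δ • i)
    simp only [Function.Embedding.coeFn_mk, mul_smul]
    linarith
  · rw [Finset.sum_map]
    simp only [Function.Embedding.coeFn_mk, Finset.sum_const, nsmul_eq_mul]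
    rw [← Set.ncard_eq_toFinset_card _ hfin, ncard_mul_orbitWeight hs]

theorem exists_orbitWeight_bound [ProperSpace X] [ProperlyDiscontinuousSMul Γ X]
    {Y : Set X} {c : ℝ} (hc : 0 < c) (hY : ∀ x : X, ∃ y ∈ Y, dist x y < c)
    (hbg : ∀ r : ℝ, 0 < r → ∃ N : ℕ, ∀ x : X,
      (Y ∩ Metric.ball x r).Finite ∧ (Y ∩ Metric.ball x r).ncard ≤ N)
    (hI : ∀ x ∈ I, ∀ y ∈ I, ∀ γ : Γ, dist x (γ • y) < 2 * c → x = y) (L : ℝ) :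
    ∃ N : ℕ, ∀ x : X, {j : I × Γ | dist x (j.2 • (j.1 : X)) ≤ L}.Finite ∧
      ∀ F : Finset (I × Γ), (∀ j ∈ F, dist x (j.2 • (j.1 : X)) ≤ L) →
        ∑ j ∈ F, orbitWeight Γ (2 * c) (j.1 : X) ≤ N := by
  classical
  choose f hfY hf using fun j : I × Γ => hY (j.2 • (j.1 : X))
  obtain ⟨N, hN⟩ := hbg (max L 0 + c) (by positivity)
  have hfibre : ∀ {j j' : I × Γ}, f j = f j' →
      j.1 = j'.1 ∧ j.2⁻¹ * j'.2 ∈ smallMoves Γ (2 * c) (j.1 : X) := fun {j j'} h => by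
    refine smallMoves_of_dist_lt hI ?_
    have h1 := hf j'
    rw [← h] at h1
    linarith [dist_triangle_right (j.2 • (j.1 : X)) (j'.2 • (j'.1 : X)) (f j), hf j]
  have hmaps : ∀ {x : X} {j : I × Γ}, dist x (j.2 • (j.1 : X)) ≤ L →
      f j ∈ Y ∩ Metric.ball x (max L 0 + c) := fun {x j} h => by
    refine ⟨hfY j, ?_⟩
    rw [Metric.mem_ball, dist_comm]
    linarith [dist_triangle x (j.2 • (j.1 : X)) (f j), hf j, le_max_left L 0]
  have hfibre' : ∀ j : I × Γ, {j' | f j' = f j} ⊆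
      (fun δ => (j.1, j.2 * δ)) '' smallMoves Γ (2 * c) (j.1 : X) := by
    intro j j' h
    obtain ⟨h1, h2⟩ := hfibre (j := j) (j' := j') (Eq.symm h)
    exact ⟨_, h2, Prod.ext h1 (by simp)⟩
  refine ⟨N, fun x => ⟨?_, fun F hF => ?_⟩⟩
  · refine ((hN x).1.preimage' (f := f) fun y _ => ?_).subset fun j hj => hmaps hj
    rcases (f ⁻¹' {y}).eq_empty_or_nonempty with h | ⟨j, rfl⟩
    · rw [h]; exact Set.finite_empty
    · exact ((finite_smallMoves _ _).image _).subset (hfibre' j)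
  · have h1 : ∀ y, ∑ j ∈ F with f j = y, orbitWeight Γ (2 * c) (j.1 : X) ≤ 1 := by
      intro y
      rcases (F.filter fun j => f j = y).eq_empty_or_nonempty with h | ⟨j, hj⟩
      · rw [h]; simp
      · have hjy := (Finset.mem_filter.1 hj).2
        have h2 : ∀ j' ∈ F.filter fun j => f j = y,
            orbitWeight Γ (2 * c) (j'.1 : X) = orbitWeight Γ (2 * c) (j.1 : X) := fun j' hj' => by
          rw [(hfibre ((Finset.mem_filter.1 hj').2.trans hjy.symm)).1]
        rw [Finset.sum_congr rfl h2, Finset.sum_const, nsmul_eq_mul,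
          ← ncard_mul_orbitWeight (Γ := Γ) (s := 2 * c) (by positivity) (j.1 : X)]
        gcongr
        · exact orbitWeight_nonneg _ _
        · rw [← Set.ncard_coe_finset]
          refine (Set.ncard_le_ncard (fun j' hj' => hfibre' j ?_)
            ((finite_smallMoves _ _).image _)).trans (Set.ncard_image_le (finite_smallMoves _ _))
          exact (Finset.mem_filter.1 hj').2.trans hjy.symm
    rw [← Finset.sum_fiberwise_of_maps_to (t := (hN x).1.toFinset) (g := f)
      fun j hj => by simpa using hmaps (hF j hj)]
    refine (Finset.sum_le_card_nsmul _ _ 1 fun y _ => h1 y).trans ?_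
    rw [nsmul_eq_mul, mul_one, ← Set.ncard_eq_toFinset_card _ (hN x).1]
    exact_mod_cast (hN x).2

end Weights

section Bumps

theorem exists_radius [ProperSpace X] [ProperlyDiscontinuousSMul Γ X]
    (hfree : ∀ (γ : Γ) (x : X), γ • x = x → γ = 1) {s : ℝ} (hs : 0 < s) (x : X) :
    ∃ ε : ℝ, 0 < ε ∧ ε ≤ s / 2 ∧ ∀ γ : Γ, γ ≠ 1 → 2 * ε ≤ dist x (γ • x) := by
  have h1 : ∀ᶠ ε : ℝ in nhdsWithin 0 (Set.Ioi 0), ∀ γ ∈ smallMoves Γ s x, γ ≠ 1 →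
      2 * ε ≤ dist x (γ • x) := by
    rw [Filter.eventually_all_finite (finite_smallMoves s x)]
    intro γ _
    by_cases hγ : γ = 1
    · exact Eventually.of_forall fun _ h => absurd hγ h
    · have hd : 0 < dist x (γ • x) := dist_pos.2 fun h => hγ (hfree γ x h.symm)
      filter_upwards [Ioo_mem_nhdsGT (half_pos hd)] with ε hε _
      linarith [hε.2]
  obtain ⟨ε, h, h0, h2⟩ := (h1.and (Ioo_mem_nhdsGT (half_pos hs))).exists
  refine ⟨ε, h0, h2.le, fun γ hγ => ?_⟩
  by_cases hm : γ ∈ smallMoves Γ s x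
  · exact h γ hm hγ
  · have : s ≤ dist x (γ • x) := not_lt.1 hm
    linarith

theorem exists_bump [ProperSpace X] {ε : ℝ} (hε : 0 < ε) (i : X) :
    ∃ w : C₀(X, ℝ), w ≠ 0 ∧ ∀ x, w x ≠ 0 → dist x i < ε := by
  have hsupp : ∀ x, max 0 (ε - dist x i) ≠ 0 → dist x i < ε := fun x hx => by
    by_contra! h
    exact hx (max_eq_left (by linarith))
  refine ⟨ofCompactSupport (fun x => max 0 (ε - dist x i)) (by fun_prop) (closedBall i ε)
    (isCompact_closedBall i ε) fun x hx => (hsupp x hx).le, fun h => ?_, hsupp⟩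
  have h1 : max 0 (ε - dist i i) = 0 := congrArg (fun f : C₀(X, ℝ) => f i) h
  rw [dist_self, sub_zero, max_eq_right hε.le] at h1
  exact hε.ne' h1

end Bumps

section Existence

variable [ProperSpace X] [IsIsometricSMul Γ X] {I : Set X}

theorem exists_orbit_partition
    (hfin : ∀ (L : ℝ) (x : X), {j : I × Γ | dist x (j.2 • (j.1 : X)) ≤ L}.Finite)
    {m : I → ℝ} (hm : ∀ i, 0 ≤ m i) {r : ℝ}
    (hr : ∀ x : X, ∃ F : Finset (I × Γ), (∀ j ∈ F, dist x (j.2 • (j.1 : X)) ≤ r) ∧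
      ∑ j ∈ F, m j.1 = 1) :
    ∃ p : I → C₀(X, ℝ), (∀ i x, 0 ≤ p i x) ∧ (∀ i x, p i x ≤ m i) ∧
      (∀ i x, p i x ≠ 0 → dist x i ≤ r + 1) ∧ ∀ x, orbitSum Γ (fun i => p i) x = 1 := by
  choose χ χ_nonneg χ_le χ_eq χ_supp _ using fun i : I =>
    exists_cutoff (isCompact_singleton (x := (i : X))) r
  have hχ : ∀ i x, m i * χ i x ≠ 0 → dist x i ≤ r + 1 := fun i x hx => by
    simpa using χ_supp i x (right_ne_zero_of_mul hx)
  obtain ⟨h, h_def⟩ : ∃ h : X → ℝ, h = orbitSum Γ fun i y => m i * χ i y := ⟨_, rfl⟩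
  have h_cont : Continuous h := h_def ▸
    continuous_orbitSum hfin hχ fun i => continuous_const.mul (χ i).continuous
  have h_inv : ∀ (γ : Γ) x, h (γ • x) = h x := h_def ▸ orbitSum_smul Γ _
  have one_le_h : ∀ x, 1 ≤ h x := fun x => by
    obtain ⟨F, hF, hF1⟩ := hr x
    rw [← hF1, h_def]
    refine le_trans (Finset.sum_le_sum fun j hj => ?_) (sum_le_finsum
      (fun j => mul_nonneg (hm j.1) (χ_nonneg j.1 _)) (finite_support_orbit hfin hχ x) F)
    have h1 : χ j.1 (j.2⁻¹ • x) = 1 := χ_eq j.1 _ ⟨_, rfl, by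
      rw [dist_inv_smul_left]
      exact hF j hj⟩
    rw [h1, mul_one]
  have h_pos : ∀ x, 0 < h x := fun x => zero_lt_one.trans_le (one_le_h x)
  have χ_mul_nonneg : ∀ i x, 0 ≤ m i * χ i x := fun i x => mul_nonneg (hm i) (χ_nonneg i x)
  refine ⟨fun i => ofCompactSupport (fun x => (h x)⁻¹ * (m i * χ i x))
      ((h_cont.inv₀ fun x => (h_pos x).ne').mul (continuous_const.mul (χ i).continuous))
      (closedBall (i : X) (r + 1)) (isCompact_closedBall _ _)
      fun x hx => hχ i x (right_ne_zero_of_mul hx),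
    fun i x => mul_nonneg (inv_nonneg.2 (h_pos x).le) (χ_mul_nonneg i x),
    fun i x => (mul_le_of_le_one_left (χ_mul_nonneg i x) (inv_le_one_of_one_le₀ (one_le_h x))).trans
      (mul_le_of_le_one_right (hm i) (χ_le i x)),
    fun i x hx => hχ i x (right_ne_zero_of_mul hx), fun x => ?_⟩
  refine (orbitSum_mul Γ (fun i y => m i * χ i y) (f := fun y => (h y)⁻¹)
    (fun γ x => by simp only [h_inv]) x).trans ?_
  rw [← h_def]
  exact inv_mul_cancel₀ (h_pos x).ne'

theorem exists_orbit_majorant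
    (hfin : ∀ (L : ℝ) (x : X), {j : I × Γ | dist x (j.2 • (j.1 : X)) ≤ L}.Finite)
    {m : I → ℝ} (hm : ∀ i, 0 ≤ m i) {r M : ℝ}
    (hM : ∀ (x : X) (F : Finset (I × Γ)), (∀ j ∈ F, dist x (j.2 • (j.1 : X)) ≤ r + 1) →
      ∑ j ∈ F, m j.1 ≤ M)
    {p : I → C₀(X, ℝ)} (p_nonneg : ∀ i x, 0 ≤ p i x)
    (p_supp : ∀ i x, p i x ≠ 0 → dist x i ≤ r + 1)
    (p_sum : ∀ x, orbitSum Γ (fun i => p i) x = 1) :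
    ∃ κ θ : I → C₀(X, ℝ), (∀ (i : I) (x : X), dist x i ≤ r → κ i x = 1) ∧
      (∀ i x, m i * κ i x ^ 2 ≤ θ i x) ∧ (∀ i x, θ i x ≠ 0 → dist x i ≤ r + 1) ∧
      ∀ x, orbitSum Γ (fun i => θ i) x = M := by
  choose κ κ_nonneg κ_le κ_eq κ_supp _ using fun i : I =>
    exists_cutoff (isCompact_singleton (x := (i : X))) r
  have hκ : ∀ i x, m i * κ i x ≠ 0 → dist x i ≤ r + 1 := fun i x hx => by
    simpa using κ_supp i x (right_ne_zero_of_mul hx)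
  obtain ⟨Ψ, Ψ_def⟩ : ∃ Ψ : X → ℝ, Ψ = orbitSum Γ fun i y => m i * κ i y := ⟨_, rfl⟩
  have Ψ_cont : Continuous Ψ := Ψ_def ▸
    continuous_orbitSum hfin hκ fun i => continuous_const.mul (κ i).continuous
  have Ψ_inv : ∀ (γ : Γ) x, Ψ (γ • x) = Ψ x := Ψ_def ▸ orbitSum_smul Γ _
  have Ψ_le : ∀ x, Ψ x ≤ M := Ψ_def ▸
    orbitSum_le hfin hκ hM fun i x => mul_le_of_le_one_right (hm i) (κ_le i x)
  have hp : ∀ i x, (M - Ψ x) * p i x ≠ 0 → dist x i ≤ r + 1 := fun i x hx =>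
    p_supp i x (right_ne_zero_of_mul hx)
  have hθ : ∀ i x, m i * κ i x + (M - Ψ x) * p i x ≠ 0 → dist x i ≤ r + 1 := fun i x hx => by
    by_contra hd
    exact hx (by rw [not_imp_comm.1 (hκ i x) hd, not_imp_comm.1 (hp i x) hd, add_zero])
  refine ⟨κ, fun i => ofCompactSupport (fun x => m i * κ i x + (M - Ψ x) * p i x)
      ((continuous_const.mul (κ i).continuous).add
        ((continuous_const.sub Ψ_cont).mul (p i).continuous))
      (closedBall (i : X) (r + 1)) (isCompact_closedBall _ _) (hθ i),
    fun i x hx => κ_eq i x ⟨_, rfl, hx⟩, fun i x => ?_, hθ, fun x => ?_⟩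
  · have h1 : κ i x ^ 2 ≤ κ i x := pow_le_of_le_one (κ_nonneg i x) (κ_le i x) two_ne_zero
    exact (mul_le_mul_of_nonneg_left h1 (hm i)).trans
      (le_add_of_nonneg_right (mul_nonneg (sub_nonneg.2 (Ψ_le x)) (p_nonneg i x)))
  · refine (orbitSum_add hfin hκ hp x).trans ?_
    rw [orbitSum_mul Γ (fun i => ⇑(p i)) (f := fun y => M - Ψ y) (fun γ x => by simp only [Ψ_inv]),
      p_sum, ← Ψ_def]
    ring

theorem exists_disjoint_bumps [ProperlyDiscontinuousSMul Γ X]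
    (hfree : ∀ (γ : Γ) (x : X), γ • x = x → γ = 1) {s : ℝ} (hs : 0 < s)
    (hI : ∀ x ∈ I, ∀ y ∈ I, ∀ γ : Γ, dist x (γ • y) < s → x = y) :
    ∃ w : I → C₀(X, ℝ), (∀ i, w i ≠ 0) ∧ (∀ i x, w i x ≠ 0 → dist x i ≤ s) ∧
      ∀ j j' : I × Γ, j ≠ j' → ∀ x : X, w j.1 (j.2⁻¹ • x) * w j'.1 (j'.2⁻¹ • x) = 0 := by
  choose ε ε_pos ε_le hε using fun i : I => exists_radius hfree hs (i : X)
  choose w w_ne hw using fun i : I => exists_bump (ε_pos i) (i : X)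
  refine ⟨w, w_ne, fun i x hx => (hw i x hx).le.trans ((ε_le i).trans (by linarith)), ?_⟩
  rintro ⟨i, γ⟩ ⟨i', γ'⟩ hne x
  by_contra hx
  have h1 := hw _ _ (left_ne_zero_of_mul hx)
  have h2 := hw _ _ (right_ne_zero_of_mul hx)
  rw [dist_inv_smul_left] at h1 h2
  have h3 : dist (γ • (i : X)) (γ' • (i' : X)) < ε i + ε i' :=
    (dist_triangle_left _ _ x).trans_lt (add_lt_add h1 h2)
  obtain rfl : i = i' := (smallMoves_of_dist_lt (j := (i, γ)) (j' := (i', γ')) hI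
    (h3.trans_le (by linarith [ε_le i, ε_le i']))).1
  have hγ : γ⁻¹ * γ' ≠ 1 := fun h => hne (Prod.ext rfl (inv_mul_eq_one.1 h))
  have h4 := hε i _ hγ
  rw [mul_smul, dist_comm, dist_inv_smul_left, dist_comm] at h4
  linarith

theorem exists_equivariantPartition [ProperlyDiscontinuousSMul Γ X]
    (hfree : ∀ (γ : Γ) (x : X), γ • x = x → γ = 1)
    (hbg : BoundedGeometry X) {R : ℝ} (hR : 0 ≤ R) : Nonempty (EquivariantPartition X Γ R) := by
  obtain ⟨Y, c, hc, hY, hYN⟩ := hbg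
  obtain ⟨I, hI, hcover⟩ := exists_orbit_net (X := X) Γ (s := 2 * c) (by positivity)
  choose N hN using exists_orbitWeight_bound (Γ := Γ) hc hY hYN hI
  have hfin : ∀ (L : ℝ) (x : X), {j : I × Γ | dist x (j.2 • (j.1 : X)) ≤ L}.Finite :=
    fun L x => (hN L x).1
  have hm : ∀ i : I, 0 ≤ orbitWeight Γ (2 * c) (i : X) := fun i => orbitWeight_nonneg _ _
  obtain ⟨p, p_nonneg, p_le, p_supp, p_sum⟩ := exists_orbit_partition hfin hm
    (exists_sum_orbitWeight_eq_one (by positivity) hcover)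
  set r : ℝ := 2 * (2 * c) + 1 + R with hr
  obtain ⟨κ, θ, κ_eq, hκθ, θ_supp, θ_sum⟩ := exists_orbit_majorant (r := r)
    (M := N (r + 1) + 1) hfin hm (fun x F hF => ((hN _ x).2 F hF).trans (by simp)) p_nonneg
    (fun i x hx => (p_supp i x hx).trans (by linarith)) p_sum
  obtain ⟨w, w_ne, w_supp, w_disj⟩ := exists_disjoint_bumps hfree (by positivity) hI
  have hφ : ∀ i x, sqrtC0 (p i) x ≠ 0 → dist x i ≤ 2 * (2 * c) + 1 := fun i x hx =>
    p_supp i x fun h => hx (by rw [sqrtC0_apply, h, Real.sqrt_zero])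
  have hφ_sq : ∀ i x, sqrtC0 (p i) x ^ 2 = p i x := fun i x => by
    rw [sqrtC0_apply, Real.sq_sqrt (p_nonneg i x)]
  exact ⟨{
    index := I
    bound := N (r + 1) + 1
    radius := r + 1
    weight := fun i => orbitWeight Γ (2 * c) (i : X)
    φ := fun i => sqrtC0 (p i)
    κ := κ
    θ := θ
    w := w
    one_le_bound := by simp
    radius_nonneg := by positivity
    weight_nonneg := hm
    φ_sq_le := fun i x => (hφ_sq i x).trans_le (p_le i x)
    κ_sq_le := hκθ
    κ_eq_one := fun i x hx y hy => by
      have h1 : dist x (i : X) ≤ 2 * (2 * c) + 1 :=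
        closure_minimal (s := Function.support (sqrtC0 (p i))) (fun z hz => hφ i z hz)
          (isClosed_closedBall (x := (i : X)) (ε := 2 * (2 * c) + 1)) hx
      have h2 : r < dist y (i : X) := not_le.1 fun h => hy (κ_eq i y h)
      linarith [dist_triangle_left y (i : X) x]
    dist_le_of_θ := θ_supp
    dist_le_of_w := fun i x hx => (w_supp i x hx).trans (by linarith)
    w_ne_zero := w_ne
    w_disjoint := w_disj
    locallyFinite_φ := locallyFinite_orbit (g := fun i => sqrtC0 (p i)) hfin hφ
    locallyFinite_θ := locallyFinite_orbit (g := fun i => θ i) hfin θ_supp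
    finsum_φ := fun x => by
      simp only [hφ_sq]
      exact p_sum x
    finsum_θ := θ_sum }⟩

end Existence

end RoeBound

/-- For every `R > 0` there is a constant `C_R > 0` such that for every
`T ∈ ℝ(X)^Γ` of propagation `≤ R` and every `*`-representation `σ` of `ℝ(X)^Γ` on a
Hilbert space `H'`, one has `‖σ(T)‖ ≤ C_R · ‖T‖`. -/
theorem norm_bound_for_representations_of_algebraic_Roe
    [ProperSpace X] [TopologicalSpace.SeparableSpace X]
    [ProperlyDiscontinuousSMul Γ X]
    (hiso : ∀ γ : Γ, Isometry fun x : X => γ • x)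
    (hfree : ∀ (γ : Γ) (x : X), γ • x = x → γ = 1)
    (hbg : BoundedGeometry X)
    [TopologicalSpace.SeparableSpace H]
    (ρ : C₀(X, ℂ) →⋆ₙₐ[ℂ] (H →L[ℂ] H)) (u : Γ →* unitary (H →L[ℂ] H))
    (hnd : NondegRep ρ) (hample : AmpleRep ρ) (hcov : CovariantRep ρ u)
    (R : ℝ) (hR : 0 < R) :
    ∃ C : ℝ, 0 < C ∧ ∀ T ∈ RoeAlgSet ρ u, HasPropLE ρ T R →
      ∀ (H' : Type) [NormedAddCommGroup H'] [InnerProductSpace ℂ H'] [CompleteSpace H']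
        (σ : (H →L[ℂ] H) → (H' →L[ℂ] H')),
        IsStarRepOn (RoeAlgSet ρ u) σ → ‖σ T‖ ≤ C * ‖T‖ := by
  have : IsIsometricSMul Γ X := ⟨hiso⟩
  obtain ⟨P⟩ := RoeBound.exists_equivariantPartition (Γ := Γ) hfree hbg hR.le
  exact ⟨√P.bound, Real.sqrt_pos.2 (zero_lt_one.trans_le P.one_le_bound),
    fun T hTR hT H' _ _ _ σ hσ => P.norm_le hnd hample hcov hTR hT hσ⟩
end
end

section
/- For every a ∈ 𝕊(X)^Γ there exists a constant C_a > 0 such that for every Hilbert space H₀ and every nondegenerate *-representation σ of 𝕊(X)^Γ on H₀, one has ‖σ(a)‖ ≤ C_a. -/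
open scoped ZeroAtInfty
open Metric Filter

noncomputable section

variable {X : Type*} [MetricSpace X] {Γ : Type*} [Group Γ] [MulAction Γ X]
variable {H : Type*} [NormedAddCommGroup H] [InnerProductSpace ℂ H] [CompleteSpace H]

/-- `T` is pseudolocal with respect to `ρ`. -/
def IsPseudolocalOp (ρ : C₀(X, ℂ) →⋆ₙₐ[ℂ] (H →L[ℂ] H)) (T : H →L[ℂ] H) : Prop :=
  ∀ f : C₀(X, ℂ), IsCompactOperator ⇑(ρ f * T - T * ρ f)

/-- The algebraic equivariant structure algebra `𝕊(X)^Γ`: Γ-invariant, pseudolocal,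
finite propagation operators. -/
def StructAlgSet (ρ : C₀(X, ℂ) →⋆ₙₐ[ℂ] (H →L[ℂ] H)) (u : Γ →* unitary (H →L[ℂ] H)) :
    Set (H →L[ℂ] H) :=
  {T | IsEquivariantOp u T ∧ IsPseudolocalOp ρ T ∧ ∃ r : ℝ, 0 ≤ r ∧ HasPropLE ρ T r}

/-- `σ` is a nondegenerate representation of the set `R ⊆ B(H)` on `H'`. -/
def IsNondegRepOn {H' : Type*} [NormedAddCommGroup H'] [InnerProductSpace ℂ H']
    [CompleteSpace H'] (R : Set (H →L[ℂ] H)) (σ : (H →L[ℂ] H) → (H' →L[ℂ] H')) : Prop :=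
  Dense (Submodule.span ℂ {w : H' | ∃ T ∈ R, ∃ v : H', σ T v = w} : Set H')

set_option linter.unusedSectionVars false

open ContinuousLinearMap in
/-- The adjoint of a compact operator between Hilbert spaces is compact. -/
theorem IsCompactOperator.adjoint_of_hilbert {K K' : Type*} [NormedAddCommGroup K]
    [InnerProductSpace ℂ K] [CompleteSpace K] [NormedAddCommGroup K'] [InnerProductSpace ℂ K']
    [CompleteSpace K'] {T : K →L[ℂ] K'} (hT : IsCompactOperator ⇑T) :
    IsCompactOperator ⇑(adjoint T) := by
  have hTT : IsCompactOperator ⇑(T ∘L adjoint T) := hT.comp_clm (adjoint T)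
  have htb : TotallyBounded ((T ∘L adjoint T : K' →L[ℂ] K') '' closedBall 0 1) :=
    (hTT.isCompact_closure_image_closedBall (𝕜₁ := ℂ) (f := (T ∘L adjoint T).toLinearMap)
      1).totallyBounded.subset subset_closure
  suffices h : TotallyBounded (adjoint T '' closedBall 0 1) by
    change IsCompactOperator ((adjoint T).toLinearMap)
    rw [isCompactOperator_iff_isCompact_closure_image_closedBall _ zero_lt_one]
    exact h.closure.isCompact_of_isClosed isClosed_closure
  rw [Metric.totallyBounded_iff]
  intro ε hε
  obtain ⟨t, hts, htf, htc⟩ := Metric.finite_approx_of_totallyBounded htb (ε ^ 2 / 2) (by positivity)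
  obtain ⟨s, hsB, hsf, htc⟩ := Set.exists_subset_image_finite_and
    (p := fun t => (T ∘L adjoint T : K' →L[ℂ] K') '' closedBall 0 1 ⊆ ⋃ y ∈ t, ball y (ε ^ 2 / 2)).1
    ⟨t, hts, htf, htc⟩
  refine ⟨adjoint T '' s, hsf.image _, ?_⟩
  rintro _ ⟨y, hy, rfl⟩
  obtain ⟨_, ⟨z, hz, rfl⟩, hyz⟩ := by simpa only [Set.mem_iUnion, exists_prop] using htc ⟨y, hy, rfl⟩
  simp only [Set.mem_iUnion, exists_prop]
  refine ⟨_, ⟨z, hz, rfl⟩, ?_⟩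
  have hz' := hsB hz
  rw [mem_closedBall, dist_zero_right] at hy hz'
  rw [mem_ball, dist_eq_norm, ← map_sub] at hyz ⊢
  have h1 : ‖adjoint T (y - z)‖ ^ 2 ≤ ‖y - z‖ * ‖(T ∘L adjoint T) (y - z)‖ := by
    have h2 := apply_norm_sq_eq_inner_adjoint_right (adjoint T) (y - z)
    rw [adjoint_adjoint] at h2
    rw [h2]
    exact (Complex.re_le_norm _).trans (norm_inner_le_norm _ _)
  have h3 : ‖y - z‖ ≤ 2 := (norm_sub_le _ _).trans (by linarith)
  refine lt_of_pow_lt_pow_left₀ 2 hε.le (h1.trans_lt ?_)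
  nlinarith [norm_nonneg (y - z), norm_nonneg ((T ∘L adjoint T) (y - z))]

/-- A family of isometries with pairwise orthogonal ranges. -/
structure IsOrthoIsom {ι G K : Type*} [NormedAddCommGroup G] [InnerProductSpace ℂ G]
    [CompleteSpace G] [NormedAddCommGroup K] [InnerProductSpace ℂ K] [CompleteSpace K]
    (V : ι → G →L[ℂ] K) : Prop where
  isom : ∀ i x, ContinuousLinearMap.adjoint (V i) (V i x) = x
  ortho : ∀ i j, i ≠ j → ∀ x, ContinuousLinearMap.adjoint (V i) (V j x) = 0

section OrthoIsom

open ContinuousLinearMap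

variable {ι G K K' : Type*} [NormedAddCommGroup G] [InnerProductSpace ℂ G]
    [CompleteSpace G] [NormedAddCommGroup K] [InnerProductSpace ℂ K] [CompleteSpace K]
    [NormedAddCommGroup K'] [InnerProductSpace ℂ K'] [CompleteSpace K']

theorem sum_norm_adjoint_sq_le {A : ι → G →L[ℂ] K} {C : ℝ}
    (hA : ∀ i j, i ≠ j → ∀ x, adjoint (A i) (A j x) = 0) (hn : ∀ i, ‖A i‖ ≤ C)
    (F : Finset ι) (x : K) : ∑ i ∈ F, ‖adjoint (A i) x‖ ^ 2 ≤ C ^ 2 * ‖x‖ ^ 2 := by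
  classical
  set S := ∑ i ∈ F, ‖adjoint (A i) x‖ ^ 2 with hS
  set y := ∑ i ∈ F, A i (adjoint (A i) x) with hy
  have hS0 : 0 ≤ S := Finset.sum_nonneg fun i _ => by positivity
  have h1 : (S : ℂ) = inner ℂ x y := by
    rw [hy, inner_sum, hS]
    push_cast
    refine Finset.sum_congr rfl fun i _ => ?_
    rw [← adjoint_inner_left, inner_self_eq_norm_sq_to_K]
    rfl
  have h2 : S ≤ ‖x‖ * ‖y‖ := by
    calc S = ‖(S : ℂ)‖ := by rw [Complex.norm_real, Real.norm_of_nonneg hS0]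
      _ ≤ _ := by rw [h1]; exact norm_inner_le_norm _ _
  have h3 : ((‖y‖ ^ 2 : ℝ) : ℂ) = ((∑ i ∈ F, ‖A i (adjoint (A i) x)‖ ^ 2 : ℝ) : ℂ) := by
    have := inner_self_eq_norm_sq_to_K (𝕜 := ℂ) y
    push_cast
    refine this.symm.trans ?_
    rw [hy, sum_inner]
    refine Finset.sum_congr rfl fun i hi => ?_
    rw [inner_sum, Finset.sum_eq_single_of_mem i hi]
    · rw [inner_self_eq_norm_sq_to_K]; rfl
    · intro j _ hji
      rw [← adjoint_inner_right, hA i j hji.symm, inner_zero_right]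
  have h4 : ‖y‖ ^ 2 ≤ C ^ 2 * S := by
    rw [Complex.ofReal_inj.1 h3, hS, Finset.mul_sum]
    refine Finset.sum_le_sum fun i _ => ?_
    rw [← mul_pow]
    gcongr
    exact (A i).le_of_opNorm_le (hn i) _
  have h5 : S ^ 2 ≤ (C ^ 2 * ‖x‖ ^ 2) * S := by
    calc S ^ 2 ≤ (‖x‖ * ‖y‖) ^ 2 := by gcongr
      _ = ‖x‖ ^ 2 * ‖y‖ ^ 2 := by ring
      _ ≤ ‖x‖ ^ 2 * (C ^ 2 * S) := by gcongr
      _ = _ := by ring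
  rcases hS0.eq_or_lt with h0 | h0
  · rw [← h0]; positivity
  · exact le_of_mul_le_mul_right (by rwa [← sq]) h0

theorem IsOrthoIsom.norm_apply {V : ι → G →L[ℂ] K} (hV : IsOrthoIsom V) (i : ι) (x : G) :
    ‖V i x‖ = ‖x‖ := by
  have h := apply_norm_sq_eq_inner_adjoint_right (V i) x
  rw [ContinuousLinearMap.comp_apply, hV.isom, inner_self_eq_norm_sq] at h
  exact (sq_eq_sq₀ (norm_nonneg _) (norm_nonneg _)).1 h

/-- An operator vanishing on all ranges of `V` and on their common orthogonal complement is `0`. -/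
theorem IsOrthoIsom.eq_zero {V : ι → G →L[ℂ] K} {D : K →L[ℂ] K'}
    (h0 : ∀ y, (∀ i, adjoint (V i) y = 0) → D y = 0) (h1 : ∀ i x, D (V i x) = 0) : D = 0 := by
  have h2 : D ∘L adjoint D = 0 := by
    refine ContinuousLinearMap.ext fun x => h0 (adjoint D x) fun i => ext_inner_left ℂ fun v => ?_
    rw [adjoint_inner_right, adjoint_inner_right, h1, inner_zero_left, inner_zero_right]
  have h3 : adjoint (adjoint D) ∘L adjoint D = 0 := by rwa [adjoint_adjoint]
  have h4 := (ContinuousLinearMap.adjoint_comp_self_eq_zero_iff (A := adjoint D)).1 h3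
  rw [← adjoint_adjoint D, h4, map_zero]

/-- Operators prescribed on the ranges of an orthogonal family of isometries. -/
theorem IsOrthoIsom.exists_glue {V : ι → G →L[ℂ] K} (hV : IsOrthoIsom V) {A : ι → G →L[ℂ] K'}
    {C : ℝ} (hC : 0 ≤ C)
    (hA : ∀ (F : Finset ι) x, ∑ i ∈ F, ‖adjoint (A i) x‖ ^ 2 ≤ C ^ 2 * ‖x‖ ^ 2) :
    ∃ L : K →L[ℂ] K', (∀ i x, L (V i x) = A i x) ∧
      ∀ y, (∀ i, adjoint (V i) y = 0) → L y = 0 := by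
  classical
  let W : ∀ _ : ι, G →ₗᵢ[ℂ] K := fun i => ⟨(V i).toLinearMap, hV.norm_apply i⟩
  have hW : OrthogonalFamily ℂ (fun _ : ι => G) W := by
    intro i j hij v w
    change inner ℂ (V i v) (V j w) = 0
    rw [← adjoint_inner_right, hV.ortho i j hij, inner_zero_right]
  have hA' : ∀ (F : Finset ι) x,
      ∑ i ∈ F, ‖adjoint (A i) x‖ ^ (2 : ENNReal).toReal ≤ (C * ‖x‖) ^ (2 : ENNReal).toReal := by
    intro F x
    simpa [mul_pow] using hA F x
  let R : K' →L[ℂ] lp (fun _ : ι => G) 2 := LinearMap.mkContinuous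
    { toFun := fun x => ⟨fun i => adjoint (A i) x, memℓp_gen' fun F => hA' F x⟩
      map_add' := fun x y => Subtype.ext <| funext fun i => map_add (adjoint (A i)) x y
      map_smul' := fun c x => Subtype.ext <| funext fun i => map_smul (adjoint (A i)) c x } C
    fun x => lp.norm_le_of_forall_sum_le (by simp) (by positivity) fun F => hA' F x
  have hR : ∀ x i, R x i = adjoint (A i) x := fun _ _ => rfl
  let T : K' →L[ℂ] K := hW.linearIsometry.toContinuousLinearMap ∘L R
  have hT : ∀ x, HasSum (fun i => V i (adjoint (A i) x)) (T x) := fun x =>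
    hW.hasSum_linearIsometry (R x)
  refine ⟨adjoint T, fun i x => ext_inner_right ℂ fun v => ?_, fun y hy =>
    ext_inner_right ℂ fun v => ?_⟩
  · rw [adjoint_inner_left, ← adjoint_inner_right]
    have h1 := (hT v).mapL (adjoint (V i))
    rw [h1.unique (hasSum_single i fun j hj => hV.ortho i j hj.symm _), hV.isom,
      adjoint_inner_right]
  · rw [adjoint_inner_left, inner_zero_left]
    have h1 := (hT v).mapL (innerSL ℂ y)
    have h2 : ∀ i, innerSL ℂ y (V i (adjoint (A i) v)) = 0 := fun i => by
      rw [innerSL_apply_apply, ← adjoint_inner_left, hy, inner_zero_left]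
    simp only [h2] at h1
    exact h1.unique hasSum_zero

end OrthoIsom

section Contraction

variable {H₀ : Type*} [NormedAddCommGroup H₀] [InnerProductSpace ℂ H₀] [CompleteSpace H₀]

/-- A `*`-representation of a set of operators is contractive on every norm closed `*`-algebra
contained in that set. -/
theorem IsStarRepOn.norm_le {R : Set (H →L[ℂ] H)} {σ : (H →L[ℂ] H) → (H₀ →L[ℂ] H₀)}
    (hσ : IsStarRepOn R σ) (D : NonUnitalStarSubalgebra ℂ (H →L[ℂ] H))
    (hD : IsClosed (D : Set (H →L[ℂ] H))) (hDR : (D : Set (H →L[ℂ] H)) ⊆ R)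
    {T : H →L[ℂ] H} (hT : T ∈ D) : ‖σ T‖ ≤ ‖T‖ := by
  obtain ⟨hadd, hsmul, hmul, hstar⟩ := hσ
  have : IsClosed (D : Set (H →L[ℂ] H)) := hD
  let π : D →⋆ₙₐ[ℂ] (H₀ →L[ℂ] H₀) :=
    { toFun := fun S => σ S
      map_smul' := fun c S => hsmul c S (hDR S.2)
      map_zero' := by
        have h := hsmul 0 (0 : D) (hDR (0 : D).2)
        simpa using h
      map_add' := fun S S' => hadd S (hDR S.2) S' (hDR S'.2)
      map_mul' := fun S S' => hmul S (hDR S.2) S' (hDR S'.2)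
      map_star' := fun S => hstar S (hDR S.2) }
  exact NonUnitalStarAlgHom.norm_apply_le π ⟨T, hT⟩

end Contraction

section ContinuousFunctions

/-- Translation by an isometric action preserves `C₀`. -/
theorem exists_translate (hiso : ∀ γ : Γ, Isometry fun x : X => γ • x) (γ : Γ) (f : C₀(X, ℂ)) :
    ∃ g : C₀(X, ℂ), ∀ x, g x = f (γ • x) := by
  let e : X ≃ₜ X :=
    { toFun := fun x => γ • x
      invFun := fun x => γ⁻¹ • x
      left_inv := fun x => inv_smul_smul γ x
      right_inv := fun x => smul_inv_smul γ x
      continuous_toFun := (hiso γ).continuous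
      continuous_invFun := (hiso γ⁻¹).continuous }
  exact ⟨⟨⟨fun x => f (γ • x), f.continuous.comp (hiso γ).continuous⟩,
    f.zero_at_infty'.comp e.isClosedEmbedding.tendsto_cocompact⟩, fun _ => rfl⟩

theorem dist_smul_left (hiso : ∀ γ : Γ, Isometry fun x : X => γ • x) (γ : Γ) (x y : X) :
    dist (γ • x) y = dist x (γ⁻¹ • y) := by
  have h := (hiso γ).dist_eq x (γ⁻¹ • y)
  simpa only [smul_inv_smul] using h

/-- The `C₀` function given by a continuous function with bounded support. -/
def boundedSupportC0 [ProperSpace X] (f : X → ℂ) (hf : Continuous f) (p : X) (R : ℝ)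
    (h : ∀ x, R ≤ dist x p → f x = 0) : C₀(X, ℂ) :=
  ⟨⟨f, hf⟩, by
    refine tendsto_const_nhds.congr' ?_
    have h1 : (closedBall p R)ᶜ ∈ cocompact X := (isCompact_closedBall p R).compl_mem_cocompact
    filter_upwards [h1] with x hx
    rw [Set.mem_compl_iff, mem_closedBall, not_le] at hx
    exact (h x hx.le).symm⟩

@[simp] theorem boundedSupportC0_apply [ProperSpace X] (f : X → ℂ) (hf : Continuous f) (p : X)
    (R : ℝ) (h : ∀ x, R ≤ dist x p → f x = 0) (x : X) :
    boundedSupportC0 f hf p R h x = f x := rfl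

theorem C0_sum_apply {ι : Type*} (F : Finset ι) (f : ι → C₀(X, ℂ)) (x : X) :
    (∑ i ∈ F, f i) x = ∑ i ∈ F, f i x := by
  classical
  induction F using Finset.induction_on with
  | empty => rfl
  | insert i F hi ih =>
    rw [Finset.sum_insert hi, Finset.sum_insert hi, ZeroAtInftyContinuousMap.add_apply, ih]

/-- The cutoff function which is `1` on `(-∞, R]` and `0` on `[R + 1, ∞)`. -/
def cutoff (R t : ℝ) : ℝ := max 0 (min 1 (R + 1 - t))

theorem continuous_cutoff (R : ℝ) : Continuous (cutoff R) := by unfold cutoff; fun_prop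

theorem cutoff_nonneg (R t : ℝ) : 0 ≤ cutoff R t := le_max_left _ _

theorem cutoff_le_one (R t : ℝ) : cutoff R t ≤ 1 := max_le zero_le_one (min_le_left _ _)

theorem cutoff_eq_one {R t : ℝ} (h : t ≤ R) : cutoff R t = 1 := by
  rw [cutoff, min_eq_left (by linarith), max_eq_right zero_le_one]

theorem cutoff_eq_zero {R t : ℝ} (h : R + 1 ≤ t) : cutoff R t = 0 :=
  max_eq_left ((min_le_right _ _).trans (by linarith))

/-- The radial cutoff function in `C₀(X)` around `p`. -/
def cutoffC0 [ProperSpace X] (R : ℝ) (p : X) : C₀(X, ℂ) :=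
  boundedSupportC0 (fun x => (cutoff R (dist x p) : ℂ)) (Complex.continuous_ofReal.comp
    ((continuous_cutoff R).comp (continuous_id.dist continuous_const))) p (R + 1)
    fun _ hx => by rw [cutoff_eq_zero hx, Complex.ofReal_zero]

@[simp] theorem cutoffC0_apply [ProperSpace X] (R : ℝ) (p x : X) :
    cutoffC0 R p x = (cutoff R (dist x p) : ℂ) := rfl

theorem C0_norm_le {f : C₀(X, ℂ)} {C : ℝ} (hC : 0 ≤ C) (h : ∀ x, ‖f x‖ ≤ C) : ‖f‖ ≤ C := by
  rw [← ZeroAtInftyContinuousMap.norm_toBCF_eq_norm]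
  exact (BoundedContinuousFunction.norm_le hC).2 h

/-- Functions of bounded support are dense in `C₀(X)`. -/
theorem dense_boundedSupport [ProperSpace X] (p : X) :
    Dense {g : C₀(X, ℂ) | ∃ R, ∀ x, R ≤ dist x p → g x = 0} := by
  intro f
  rw [Metric.mem_closure_iff]
  intro ε hε
  have h1 : ∀ᶠ x in cocompact X, ‖f x‖ < ε / 2 := by
    have h := f.zero_at_infty'.norm
    rw [norm_zero] at h
    exact h.eventually_lt_const (half_pos hε)
  obtain ⟨R, hR⟩ := closedBall_compl_subset_of_mem_cocompact h1 p
  refine ⟨f * cutoffC0 R p, ⟨R + 1, fun x hx => ?_⟩, ?_⟩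
  · rw [ZeroAtInftyContinuousMap.mul_apply, cutoffC0_apply, cutoff_eq_zero hx, Complex.ofReal_zero,
      mul_zero]
  rw [dist_eq_norm]
  refine (C0_norm_le (half_pos hε).le fun x => ?_).trans_lt (half_lt_self hε)
  rw [ZeroAtInftyContinuousMap.sub_apply, ZeroAtInftyContinuousMap.mul_apply, cutoffC0_apply]
  rcases le_or_gt (dist x p) R with hx | hx
  · rw [cutoff_eq_one hx, Complex.ofReal_one, mul_one, sub_self, norm_zero]
    exact (half_pos hε).le
  · have h2 : ‖f x‖ < ε / 2 := hR (by simpa using hx)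
    have h3 : f x - f x * (cutoff R (dist x p) : ℂ) = f x * ((1 - cutoff R (dist x p) : ℝ) : ℂ) := by
      push_cast; ring
    rw [h3, norm_mul, Complex.norm_real, Real.norm_of_nonneg (sub_nonneg.2 (cutoff_le_one _ _))]
    nlinarith [cutoff_nonneg R (dist x p), norm_nonneg (f x)]

/-- A closed property of elements of `C₀(X)` holding for functions of bounded support holds. -/
theorem C0_induction [ProperSpace X] (p : X) {P : C₀(X, ℂ) → Prop} (hP : IsClosed {f | P f})
    (h : ∀ f R, (∀ x, R ≤ dist x p → f x = 0) → P f) (f : C₀(X, ℂ)) : P f := by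
  refine closure_minimal (t := {f | P f}) ?_ hP (dense_boundedSupport p f)
  rintro g ⟨R, hg⟩
  exact h g R hg

end ContinuousFunctions

section Commutant

variable {ρ : C₀(X, ℂ) →⋆ₙₐ[ℂ] (H →L[ℂ] H)} {u : Γ →* unitary (H →L[ℂ] H)}

/-- `T` commutes with the image of `ρ`. -/
def CommutesRep (ρ : C₀(X, ℂ) →⋆ₙₐ[ℂ] (H →L[ℂ] H)) (T : H →L[ℂ] H) : Prop :=
  ∀ f, T * ρ f = ρ f * T

theorem CommutesRep.apply {T : H →L[ℂ] H} (hT : CommutesRep ρ T) (f : C₀(X, ℂ)) (x : H) :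
    T (ρ f x) = ρ f (T x) := DFunLike.congr_fun (hT f) x

theorem CommutesRep.star_op {T : H →L[ℂ] H} (hT : CommutesRep ρ T) : CommutesRep ρ (star T) := by
  intro f
  have h := congrArg Star.star (hT (Star.star f))
  rw [star_mul, star_mul, ← map_star, star_star] at h
  exact h.symm

theorem commutesRep_rep (f : C₀(X, ℂ)) : CommutesRep ρ (ρ f) := fun g => by
  rw [← map_mul, ← map_mul, mul_comm]

theorem CommutesRep.mul {S T : H →L[ℂ] H} (hS : CommutesRep ρ S) (hT : CommutesRep ρ T) :
    CommutesRep ρ (S * T) := fun f => by rw [mul_assoc, hT, ← mul_assoc, hS, mul_assoc]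

theorem unitary_mul_star (γ : Γ) : (u γ : H →L[ℂ] H) * star (u γ : H →L[ℂ] H) = 1 :=
  Unitary.coe_mul_star_self _

theorem unitary_star_mul (γ : Γ) : star (u γ : H →L[ℂ] H) * (u γ : H →L[ℂ] H) = 1 :=
  Unitary.coe_star_mul_self _

theorem unitary_star_eq (γ : Γ) : star (u γ : H →L[ℂ] H) = u γ⁻¹ := by
  rw [map_inv]; rfl

theorem unitary_coe_mul (γ γ' : Γ) : (u (γ * γ') : H →L[ℂ] H) = (u γ : H →L[ℂ] H) * u γ' := by
  rw [map_mul]; rfl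

theorem CovariantRep.mul_unitary (hcov : CovariantRep ρ u) {γ : Γ} {f g : C₀(X, ℂ)}
    (h : ∀ x, g (γ • x) = f x) : ρ g * (u γ : H →L[ℂ] H) = (u γ : H →L[ℂ] H) * ρ f := by
  rw [hcov γ f g fun x => by rw [← h, smul_inv_smul], mul_assoc, unitary_star_mul, mul_one]

theorem IsEquivariantOp.star_op {T : H →L[ℂ] H} (hT : IsEquivariantOp u T) :
    IsEquivariantOp u (star T) := by
  intro γ
  have h := congrArg Star.star (hT γ⁻¹)
  rw [star_mul, star_mul, unitary_star_eq, inv_inv] at h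
  exact h.symm

theorem IsEquivariantOp.mul {S T : H →L[ℂ] H} (hS : IsEquivariantOp u S)
    (hT : IsEquivariantOp u T) : IsEquivariantOp u (S * T) := fun γ => by
  rw [← mul_assoc, hS, mul_assoc, hT, mul_assoc]

theorem IsEquivariantOp.add {S T : H →L[ℂ] H} (hS : IsEquivariantOp u S)
    (hT : IsEquivariantOp u T) : IsEquivariantOp u (S + T) := fun γ => by
  rw [mul_add, hS, hT, add_mul]

theorem IsEquivariantOp.smul {T : H →L[ℂ] H} (c : ℂ) (hT : IsEquivariantOp u T) :
    IsEquivariantOp u (c • T) := fun γ => by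
  rw [mul_smul_comm, hT, smul_mul_assoc]

theorem isClosed_isEquivariantOp : IsClosed {T : H →L[ℂ] H | IsEquivariantOp u T} := by
  simp only [IsEquivariantOp, Set.ofPred_forall]
  exact isClosed_iInter fun γ => isClosed_eq (by fun_prop) (by fun_prop)

/-- Conjugation by the group preserves the commutant of `ρ`. -/
theorem CommutesRep.conj (hiso : ∀ γ : Γ, Isometry fun x : X => γ • x) (hcov : CovariantRep ρ u)
    {T : H →L[ℂ] H} (hT : CommutesRep ρ T) (γ : Γ) :
    CommutesRep ρ ((u γ : H →L[ℂ] H) * T * star (u γ : H →L[ℂ] H)) := by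
  intro f
  obtain ⟨g, hg⟩ := exists_translate hiso γ f
  have h := hcov.mul_unitary (f := g) (g := f) (γ := γ) fun x => (hg x).symm
  have h2 : star (u γ : H →L[ℂ] H) * ρ f = ρ g * star (u γ : H →L[ℂ] H) := by
    calc _ = star (u γ : H →L[ℂ] H) * (ρ f * (u γ : H →L[ℂ] H)) * star (u γ : H →L[ℂ] H) := by
          rw [mul_assoc, mul_assoc, unitary_mul_star, mul_one]
      _ = _ := by rw [h, ← mul_assoc, unitary_star_mul, one_mul]
  rw [mul_assoc, h2, ← mul_assoc, ← mul_assoc, ← mul_assoc, h, mul_assoc _ T, hT, mul_assoc _ (ρ g)]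

/-- The equivariant operators commuting with `ρ`. -/
def equivariantCommutant (ρ : C₀(X, ℂ) →⋆ₙₐ[ℂ] (H →L[ℂ] H)) (u : Γ →* unitary (H →L[ℂ] H)) :
    NonUnitalStarSubalgebra ℂ (H →L[ℂ] H) where
  carrier := {T | IsEquivariantOp u T ∧ CommutesRep ρ T}
  add_mem' hS hT := ⟨hS.1.add hT.1, fun f => by rw [add_mul, mul_add, hS.2 f, hT.2 f]⟩
  zero_mem' := ⟨fun γ => by rw [mul_zero, zero_mul], fun f => by rw [mul_zero, zero_mul]⟩
  smul_mem' c T hT := ⟨hT.1.smul c, fun f => by rw [smul_mul_assoc, hT.2 f, mul_smul_comm]⟩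
  mul_mem' hS hT := ⟨hS.1.mul hT.1, hS.2.mul hT.2⟩
  star_mem' hT := ⟨hT.1.star_op, hT.2.star_op⟩

theorem isClosed_equivariantCommutant :
    IsClosed (equivariantCommutant ρ u : Set (H →L[ℂ] H)) := by
  refine isClosed_isEquivariantOp.inter ?_
  change IsClosed {T | ∀ f, T * ρ f = ρ f * T}
  rw [Set.ofPred_forall]
  exact isClosed_iInter fun f => isClosed_eq (by fun_prop) (by fun_prop)

theorem CommutesRep.isPseudolocalOp {T : H →L[ℂ] H} (hT : CommutesRep ρ T) :
    IsPseudolocalOp ρ T := fun f => by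
  rw [hT f, sub_self]
  exact isCompactOperator_zero

theorem mul_eq_zero_of_tsupport_disjoint {f g : C₀(X, ℂ)} {r : ℝ} (hr : 0 < r)
    (h : ∀ x ∈ tsupport ⇑f, ∀ y ∈ tsupport ⇑g, r ≤ dist x y) : f * g = 0 := by
  ext x
  by_contra hx
  have hx' : f x ≠ 0 ∧ g x ≠ 0 := by simpa [not_or] using hx
  have := h x (subset_tsupport _ hx'.1) x (subset_tsupport _ hx'.2)
  rw [dist_self] at this
  linarith

theorem HasPropLE.mul_commutes {S T : H →L[ℂ] H} {r : ℝ} (hS : HasPropLE ρ S r)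
    (hT : CommutesRep ρ T) : HasPropLE ρ (S * T) r := fun f g h => by
  rw [← mul_assoc, mul_assoc, hT, ← mul_assoc, hS f g h, zero_mul]

theorem CommutesRep.hasPropLE {T : H →L[ℂ] H} (hT : CommutesRep ρ T) : HasPropLE ρ T 1 :=
  fun f g h => by
    rw [mul_assoc, hT, ← mul_assoc, ← map_mul, mul_eq_zero_of_tsupport_disjoint one_pos h, map_zero,
      zero_mul]

theorem equivariantCommutant_subset :
    (equivariantCommutant ρ u : Set (H →L[ℂ] H)) ⊆ StructAlgSet ρ u := fun _ hT =>
  ⟨hT.1, hT.2.isPseudolocalOp, 1, zero_le_one, hT.2.hasPropLE⟩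

theorem StructAlgSet.mul_mem_of_commutant {S T : H →L[ℂ] H} (hS : S ∈ StructAlgSet ρ u)
    (hT : T ∈ equivariantCommutant ρ u) : S * T ∈ StructAlgSet ρ u := by
  obtain ⟨r, hr, hp⟩ := hS.2.2
  refine ⟨hS.1.mul hT.1, fun f => ?_, r, hr, hp.mul_commutes hT.2⟩
  have h : ρ f * (S * T) - S * T * ρ f = (ρ f * S - S * ρ f) * T := by
    rw [sub_mul, mul_assoc S T, hT.2 f]
    simp only [mul_assoc]
  rw [h]
  exact (hS.2.1 f).comp_clm T

/-- In a nondegenerate representation, an operator killed by right multiplication by `ρ` is `0`. -/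
theorem NondegRep.eq_zero_of_mul {K : Type*} [NormedAddCommGroup K] [NormedSpace ℂ K]
    (hnd : NondegRep ρ) {T : H →L[ℂ] K}
    (h : ∀ f x, T (ρ f x) = 0) : T = 0 := by
  refine ContinuousLinearMap.ext_on hnd ?_
  rintro _ ⟨f, v, rfl⟩
  simpa using h f v

theorem NondegRep.eq_zero_of_apply (hnd : NondegRep ρ) {x : H} (h : ∀ f, ρ f x = 0) : x = 0 := by
  have h1 : innerSL ℂ x = 0 := hnd.eq_zero_of_mul fun f v => by
    rw [innerSL_apply_apply, ← ContinuousLinearMap.adjoint_inner_left,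
      ← ContinuousLinearMap.star_eq_adjoint, ← map_star, h, inner_zero_left]
  have h2 := DFunLike.congr_fun h1 x
  rw [innerSL_apply_apply] at h2
  exact inner_self_eq_zero.1 h2

end Commutant

section FundamentalDomain

variable {ρ : C₀(X, ℂ) →⋆ₙₐ[ℂ] (H →L[ℂ] H)} {u : Γ →* unitary (H →L[ℂ] H)}

theorem norm_rep_le (ρ : C₀(X, ℂ) →⋆ₙₐ[ℂ] (H →L[ℂ] H)) (f : C₀(X, ℂ)) : ‖ρ f‖ ≤ ‖f‖ :=
  NonUnitalStarAlgHom.norm_apply_le ρ f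

theorem continuous_rep (ρ : C₀(X, ℂ) →⋆ₙₐ[ℂ] (H →L[ℂ] H)) : Continuous ρ :=
  AddMonoidHomClass.continuous_of_bound ρ 1 fun f => by simpa using norm_rep_le ρ f

/-- A free, isometric, properly discontinuous action moves every point by a definite amount. -/
theorem exists_displacement [ProperSpace X] [ProperlyDiscontinuousSMul Γ X]
    (hfree : ∀ (γ : Γ) (x : X), γ • x = x → γ = 1) (p : X) :
    ∃ ε > 0, ∀ γ : Γ, γ ≠ 1 → ε ≤ dist (γ • p) p := by
  have hK := isCompact_closedBall p 1
  have hF := finite_disjoint_inter_image (Γ := Γ) hK hK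
  have h1 : ∀ᶠ ε in nhdsWithin (0 : ℝ) (Set.Ioi 0),
      ∀ γ ∈ {γ : Γ | ((γ • ·) '' closedBall p 1 ∩ closedBall p 1).Nonempty}, γ ≠ 1 →
        ε < dist (γ • p) p := by
    rw [eventually_all_finite hF]
    intro γ _
    by_cases hγ : γ = 1
    · exact Eventually.of_forall fun _ h => (h hγ).elim
    · have h0 : 0 < dist (γ • p) p := dist_pos.2 fun h => hγ (hfree γ p h)
      filter_upwards [Ioo_mem_nhdsGT h0] with ε hε _ using hε.2
  have h2 : ∀ᶠ ε in nhdsWithin (0 : ℝ) (Set.Ioi 0), ε ∈ Set.Ioo (0 : ℝ) 1 := Ioo_mem_nhdsGT one_pos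
  obtain ⟨ε, h3, h4⟩ := (h1.and h2).exists
  refine ⟨ε, h4.1, fun γ hγ => ?_⟩
  rcases le_or_gt (dist (γ • p) p) 1 with h | h
  · exact (h3 γ ⟨γ • p, ⟨p, mem_closedBall_self zero_le_one, rfl⟩, h⟩ hγ).le
  · exact (h4.2.trans h).le

/-- Bump functions whose translates have disjoint support. -/
theorem exists_bump [ProperSpace X] [ProperlyDiscontinuousSMul Γ X]
    (hiso : ∀ γ : Γ, Isometry fun x : X => γ • x)
    (hfree : ∀ (γ : Γ) (x : X), γ • x = x → γ = 1) (p : X) :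
    ∃ (h : X → ℝ) (f : C₀(X, ℂ)), Continuous h ∧ (∀ x, 0 ≤ h x) ∧ 0 < h p ∧
      (∀ x, f x = (h x : ℂ)) ∧ ∀ γ : Γ, γ ≠ 1 → ∀ x, h (γ • x) * h x = 0 := by
  obtain ⟨ε, hε, hγ⟩ := exists_displacement (Γ := Γ) hfree p
  have hc : Continuous fun x : X => max 0 (ε / 2 - dist x p) := by fun_prop
  refine ⟨_, boundedSupportC0 _ (Complex.continuous_ofReal.comp hc) p (ε / 2) fun x hx => ?_,
    hc, fun x => le_max_left _ _, ?_, fun x => rfl, fun γ h1 x => ?_⟩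
  · rw [Function.comp_apply, max_eq_left (by linarith : ε / 2 - dist x p ≤ 0), Complex.ofReal_zero]
  · simpa using hε
  · by_contra h
    have h2 : dist (γ • x) p < ε / 2 := by
      by_contra h'
      exact h (by rw [max_eq_left (by linarith : ε / 2 - dist (γ • x) p ≤ 0), zero_mul])
    have h3 : dist x p < ε / 2 := by
      by_contra h'
      exact h (by rw [max_eq_left (by linarith : ε / 2 - dist x p ≤ 0), mul_zero])
    have h4 := (hiso γ).dist_eq x p
    have h5 := dist_triangle_left (γ • p) p (γ • x)
    have h6 := hγ γ h1
    linarith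

/-- If `x` is killed by functions without common zero then it is `0`. -/
theorem NondegRep.eq_zero_of_local [ProperSpace X] [Nonempty X] (hnd : NondegRep ρ) {v : H}
    (hv : ∀ p : X, ∃ (h : X → ℝ) (f : C₀(X, ℂ)), Continuous h ∧ (∀ x, 0 ≤ h x) ∧ 0 < h p ∧
      (∀ x, f x = (h x : ℂ)) ∧ ρ f v = 0) : v = 0 := by
  obtain ⟨p⟩ := ‹Nonempty X›
  refine hnd.eq_zero_of_apply fun f => ?_
  refine C0_induction p (P := fun f => ρ f v = 0) ?_ ?_ f
  · have hρ := continuous_rep ρ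
    exact isClosed_eq (by fun_prop) continuous_const
  intro f R hf
  choose h k hc hpos hp hk hkv using hv
  obtain ⟨t, -, ht⟩ := (isCompact_closedBall p R).elim_nhds_subcover (fun q => {x | 0 < h q x})
    fun q _ => (isOpen_lt continuous_const (hc q)).mem_nhds (hp q)
  have hsc : Continuous fun x => ∑ q ∈ t, h q x := continuous_finsetSum _ fun q _ => hc q
  have hpos' : ∀ x ∈ closedBall p R, 0 < ∑ q ∈ t, h q x := by
    intro x hx
    obtain ⟨q, hq, hqx⟩ := by simpa only [Set.mem_iUnion, exists_prop] using ht hx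
    exact Finset.sum_pos' (fun q _ => hpos q x) ⟨q, hq, hqx⟩
  obtain ⟨δ, hδ, hδ'⟩ : ∃ δ > 0, ∀ x ∈ closedBall p R, δ ≤ ∑ q ∈ t, h q x := by
    rcases (closedBall p R).eq_empty_or_nonempty with he | hne
    · exact ⟨1, one_pos, by simp [he]⟩
    · obtain ⟨x, hx, hmin⟩ := (isCompact_closedBall p R).exists_isMinOn hne hsc.continuousOn
      exact ⟨_, hpos' x hx, fun y hy => hmin hy⟩
  have hne : ∀ x, ((max δ (∑ q ∈ t, h q x) : ℝ) : ℂ) ≠ 0 := fun x =>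
    Complex.ofReal_ne_zero.2 (lt_max_of_lt_left hδ).ne'
  let g : C₀(X, ℂ) := boundedSupportC0 (fun x => f x / ((max δ (∑ q ∈ t, h q x) : ℝ) : ℂ))
    (f.continuous.div (Complex.continuous_ofReal.comp (continuous_const.max hsc)) hne) p R
    fun x hx => by rw [hf x hx, zero_div]
  have hfg : f = ∑ q ∈ t, g * k q := by
    ext x
    rw [C0_sum_apply]
    simp only [ZeroAtInftyContinuousMap.mul_apply, hk, ← Finset.mul_sum]
    rcases le_or_gt R (dist x p) with hx | hx
    · simp [g, hf x hx]
    · have h1 := max_eq_right (hδ' x (mem_closedBall.2 hx.le))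
      have h2 := hne x
      simp only [g, boundedSupportC0_apply]
      rw [h1] at h2 ⊢
      rw [Complex.ofReal_sum] at h2 ⊢
      rw [div_mul_cancel₀ _ h2]
  rw [hfg, map_sum, sum_apply]
  exact Finset.sum_eq_zero fun q _ => by rw [map_mul, mul_apply_eq_comp, hkv, map_zero]

open ContinuousLinearMap in
/-- The representation space decomposes as an orthogonal direct sum of translates of a
subspace invariant under the commutant of `ρ`. -/
theorem exists_fundamental_domain [ProperSpace X] [Nonempty X] [ProperlyDiscontinuousSMul Γ X]
    (hiso : ∀ γ : Γ, Isometry fun x : X => γ • x)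
    (hfree : ∀ (γ : Γ) (x : X), γ • x = x → γ = 1) (hnd : NondegRep ρ) (hcov : CovariantRep ρ u) :
    ∃ E : Submodule ℂ H, IsClosed (E : Set H) ∧ (∀ T, CommutesRep ρ T → ∀ x ∈ E, T x ∈ E) ∧
      (∀ γ : Γ, γ ≠ 1 → ∀ x ∈ E, ∀ y ∈ E, inner ℂ ((u γ : H →L[ℂ] H) x) y = 0) ∧
      ∀ x, (∀ γ, ∀ e ∈ E, inner ℂ ((u γ : H →L[ℂ] H) e) x = 0) → x = 0 := by
  let S : Set (Submodule ℂ H) := {E | (∀ T, CommutesRep ρ T → ∀ x ∈ E, T x ∈ E) ∧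
      ∀ γ : Γ, γ ≠ 1 → ∀ x ∈ E, ∀ y ∈ E, inner ℂ ((u γ : H →L[ℂ] H) x) y = 0}
  have hchain : ∀ c ⊆ S, IsChain (· ≤ ·) c → ∃ ub ∈ S, ∀ z ∈ c, z ≤ ub := by
    intro c hc hch
    rcases c.eq_empty_or_nonempty with rfl | hne
    · refine ⟨⊥, ⟨fun T _ x hx => ?_, fun γ _ x hx y _ => ?_⟩, by simp⟩
      · rw [Submodule.mem_bot] at hx ⊢
        rw [hx, map_zero]
      · rw [(Submodule.mem_bot ℂ).1 hx, map_zero, inner_zero_left]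
    · have hd := hch.directedOn
      refine ⟨sSup c, ⟨fun T hT x hx => ?_, fun γ hγ x hx y hy => ?_⟩, fun z hz => le_sSup hz⟩
      · obtain ⟨E, hE, hx⟩ := (Submodule.mem_sSup_of_directed hne hd).1 hx
        exact (le_sSup hE : E ≤ sSup c) ((hc hE).1 T hT x hx)
      · obtain ⟨E, hE, hx⟩ := (Submodule.mem_sSup_of_directed hne hd).1 hx
        obtain ⟨E', hE', hy⟩ := (Submodule.mem_sSup_of_directed hne hd).1 hy
        rcases hch.total hE hE' with h | h
        · exact (hc hE').2 γ hγ x (h hx) y hy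
        · exact (hc hE).2 γ hγ x hx y (h hy)
  obtain ⟨E, ⟨hE1, hE2⟩, hmax⟩ := zorn_le₀ S hchain
  have hcl : E.topologicalClosure ≤ E := by
    refine hmax ⟨fun T hT x hx => ?_, fun γ hγ x hx y hy => ?_⟩ E.le_topologicalClosure
    · exact map_mem_closure T.continuous hx fun x hx => hE1 T hT x hx
    · have h1 : ∀ y ∈ E, inner ℂ ((u γ : H →L[ℂ] H) x) y = 0 := fun y hy =>
        closure_minimal (t := {x | inner ℂ ((u γ : H →L[ℂ] H) x) y = 0})
          (fun x hx => hE2 γ hγ x hx y hy) (isClosed_eq (by fun_prop) continuous_const) hx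
      exact closure_minimal (t := {y | inner ℂ ((u γ : H →L[ℂ] H) x) y = 0})
          (fun y hy => h1 y hy) (isClosed_eq (by fun_prop) continuous_const) hy
  refine ⟨E, isClosed_of_closure_subset hcl, hE1, hE2, fun x hx => ?_⟩
  have hMu : ∀ (γ : Γ) x y, inner ℂ ((u γ : H →L[ℂ] H) x) y
      = inner ℂ x ((u γ⁻¹ : H →L[ℂ] H) y) := fun γ x y => by
    rw [← unitary_star_eq, star_eq_adjoint, adjoint_inner_right]
  let M : Submodule ℂ H :=
    { carrier := {x | ∀ γ, ∀ e ∈ E, inner ℂ ((u γ : H →L[ℂ] H) e) x = 0}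
      add_mem' := fun hx hy γ e he => by rw [inner_add_right, hx γ e he, hy γ e he, add_zero]
      zero_mem' := fun γ e he => inner_zero_right _
      smul_mem' := fun c x hx γ e he => by rw [inner_smul_right, hx γ e he, mul_zero] }
  have hMT : ∀ T, CommutesRep ρ T → ∀ x ∈ M, T x ∈ M := by
    intro T hT x hx γ e he
    rw [← adjoint_inner_left, ← star_eq_adjoint]
    have h1 := hE1 _ (hT.star_op.conj hiso hcov γ⁻¹) e he
    have h2 := hx γ _ h1
    rw [← unitary_star_eq, star_star] at h2
    rwa [← mul_apply_eq_comp, ← mul_assoc, ← mul_assoc, unitary_mul_star, one_mul] at h2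
  have hM1 : ∀ x ∈ M, ∀ e ∈ E, inner ℂ e x = 0 := fun x hx e he => by
    simpa using hx 1 e he
  refine hnd.eq_zero_of_local fun p => ?_
  obtain ⟨h, f, hc, hpos, hp, hf, hdisj⟩ := exists_bump (Γ := Γ) hiso hfree p
  refine ⟨h, f, hc, hpos, hp, hf, ?_⟩
  have hfs : star f = f := by
    ext x
    simp [hf]
  have hfu : ∀ γ : Γ, γ ≠ 1 → ∀ m m', inner ℂ ((u γ : H →L[ℂ] H) (ρ f m)) (ρ f m') = 0 := by
    intro γ hγ m m'
    obtain ⟨g, hg⟩ := exists_translate hiso γ f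
    rw [← adjoint_inner_left, ← star_eq_adjoint, ← map_star, hfs]
    have h1 := hcov.mul_unitary (f := g) (g := f) (γ := γ) fun x => (hg x).symm
    have h2 : g * f = 0 := by
      ext x
      simp only [ZeroAtInftyContinuousMap.mul_apply, hg, hf, ← Complex.ofReal_mul, hdisj γ hγ]
      rfl
    rw [← mul_apply_eq_comp, ← mul_apply_eq_comp, h1, mul_assoc, ← map_mul, h2]
    simp
  have hEf : E ⊔ M.map (ρ f).toLinearMap ∈ S := by
    refine ⟨fun T hT x hx => ?_, fun γ hγ x hx y hy => ?_⟩
    · obtain ⟨e, he, _, ⟨m, hm, rfl⟩, rfl⟩ := Submodule.mem_sup.1 hx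
      rw [map_add]
      refine Submodule.add_mem_sup (hE1 T hT e he) ⟨T m, hMT T hT m hm, ?_⟩
      exact (hT.apply f m).symm
    · obtain ⟨e, he, _, ⟨m, hm, rfl⟩, rfl⟩ := Submodule.mem_sup.1 hx
      obtain ⟨e', he', _, ⟨m', hm', rfl⟩, rfl⟩ := Submodule.mem_sup.1 hy
      have h1 : inner ℂ ((u γ : H →L[ℂ] H) (ρ f m)) e' = 0 := by
        rw [hMu, ← inner_conj_symm, hMT _ (commutesRep_rep f) m hm γ⁻¹ e' he', map_zero]
      have h2 := hMT _ (commutesRep_rep f) m' hm' γ e he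
      have h3 := hE2 γ hγ e he e' he'
      have h4 := hfu γ hγ m m'
      change inner ℂ ((u γ : H →L[ℂ] H) (e + ρ f m)) (e' + ρ f m') = 0
      rw [map_add, inner_add_left, inner_add_right, inner_add_right, h1, h2, h3, h4]
      simp
  have h1 : ρ f x ∈ E := hmax hEf le_sup_left
    (Submodule.mem_sup_right ⟨x, hx, rfl⟩)
  exact inner_self_eq_zero.1 (hM1 _ (hMT _ (commutesRep_rep f) x hx) _ h1)

end FundamentalDomain

section OrthoIsomFamilies

open ContinuousLinearMap

variable {ι κ G K K' : Type*} [NormedAddCommGroup G] [InnerProductSpace ℂ G]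
    [CompleteSpace G] [NormedAddCommGroup K] [InnerProductSpace ℂ K] [CompleteSpace K]
    [NormedAddCommGroup K'] [InnerProductSpace ℂ K'] [CompleteSpace K']

theorem IsOrthoIsom.of_inner {V : ι → G →L[ℂ] K}
    (h1 : ∀ i x y, inner ℂ (V i x) (V i y) = inner ℂ x y)
    (h2 : ∀ i j, i ≠ j → ∀ x y, inner ℂ (V i x) (V j y) = 0) : IsOrthoIsom V where
  isom i x := ext_inner_right ℂ fun v => by rw [adjoint_inner_left, h1]
  ortho i j hij x := ext_inner_right ℂ fun v => by
    rw [adjoint_inner_left, h2 j i hij.symm, inner_zero_left]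

theorem IsOrthoIsom.inner_same {V : ι → G →L[ℂ] K} (hV : IsOrthoIsom V) (i : ι) (x y : G) :
    inner ℂ (V i x) (V i y) = inner ℂ x y := by
  rw [← adjoint_inner_left, hV.isom]

theorem IsOrthoIsom.inner_ne {V : ι → G →L[ℂ] K} (hV : IsOrthoIsom V) {i j : ι} (hij : i ≠ j)
    (x y : G) : inner ℂ (V i x) (V j y) = 0 := by
  rw [← adjoint_inner_right, hV.ortho i j hij, inner_zero_right]

theorem IsOrthoIsom.norm_le_one {V : ι → G →L[ℂ] K} (hV : IsOrthoIsom V) (i : ι) : ‖V i‖ ≤ 1 :=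
  opNorm_le_bound _ zero_le_one fun x => by rw [hV.norm_apply, one_mul]

/-- Gluing of operators with pairwise orthogonal ranges. -/
theorem IsOrthoIsom.exists_glue_of_ortho {V : ι → G →L[ℂ] K} (hV : IsOrthoIsom V)
    {A : ι → G →L[ℂ] K'} {C : ℝ} (hC : 0 ≤ C)
    (hA : ∀ i j, i ≠ j → ∀ x, adjoint (A i) (A j x) = 0) (hn : ∀ i, ‖A i‖ ≤ C) :
    ∃ L : K →L[ℂ] K', (∀ i x, L (V i x) = A i x) ∧
      ∀ y, (∀ i, adjoint (V i) y = 0) → L y = 0 :=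
  hV.exists_glue hC (sum_norm_adjoint_sq_le hA hn)

/-- The ranges of the family `V` span a dense subspace. -/
def IsTotalFamily (V : ι → G →L[ℂ] K) : Prop := ∀ y, (∀ i, adjoint (V i) y = 0) → y = 0

theorem IsTotalFamily.ext {V : ι → G →L[ℂ] K} (hV : IsTotalFamily V) {S T : K →L[ℂ] K'}
    (h : ∀ i x, S (V i x) = T (V i x)) : S = T := by
  rw [← sub_eq_zero]
  refine IsOrthoIsom.eq_zero (V := V) (fun y hy => ?_) fun i x => ?_
  · rw [hV y hy, map_zero]
  · rw [sub_apply, h, sub_self]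

/-- Operators prescribed on the ranges of a total family, jointly orthogonal and isometric. -/
theorem IsOrthoIsom.exists_glue_family {Z : Type*} {B : κ → G →L[ℂ] K} (hB : IsOrthoIsom B)
    (hBt : IsTotalFamily B) {A : Z → κ → G →L[ℂ] K'}
    (hA : IsOrthoIsom fun q : Z × κ => A q.1 q.2) :
    ∃ L : Z → K →L[ℂ] K', IsOrthoIsom L ∧ ∀ z i x, L z (B i x) = A z i x := by
  have h1 : ∀ z, ∃ L : K →L[ℂ] K', ∀ i x, L (B i x) = A z i x := fun z => by
    obtain ⟨L, hL, -⟩ := hB.exists_glue_of_ortho (A := A z) zero_le_one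
      (fun i j hij x => hA.ortho (z, i) (z, j) (by simpa using hij) x)
      fun i => hA.norm_le_one (z, i)
    exact ⟨L, hL⟩
  choose L hL using h1
  have h2 : ∀ z w i j x y, inner ℂ (B j y) (adjoint (L z) (L w (B i x)))
      = inner ℂ (A z j y) (A w i x) := fun z w i j x y => by
    rw [adjoint_inner_right, hL, hL]
  have h3 : ∀ i x v, (∀ j y, inner ℂ (B j y) v = inner ℂ (B j y) (B i x)) → v = B i x := by
    intro i x v hv
    rw [← sub_eq_zero]
    refine hBt _ fun j => ext_inner_left ℂ fun y => ?_
    rw [adjoint_inner_right, inner_sub_right, hv, sub_self, inner_zero_right]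
  refine ⟨L, ⟨fun z => ?_, fun z w hzw => ?_⟩, hL⟩
  · refine DFunLike.congr_fun (f := adjoint (L z) ∘L L z) (g := .id ℂ K)
      (hBt.ext fun i x => h3 i x _ fun j y => ?_)
    rw [ContinuousLinearMap.comp_apply, h2]
    by_cases hij : j = i
    · subst hij
      rw [hA.inner_same (z, j), hB.inner_same]
    · rw [hA.inner_ne (i := (z, j)) (j := (z, i)) (by simpa using hij), hB.inner_ne hij]
  · refine DFunLike.congr_fun (f := adjoint (L z) ∘L L w) (g := 0) (hBt.ext fun i x => ?_)
    refine hBt _ fun j => ext_inner_left ℂ fun y => ?_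
    rw [adjoint_inner_right, ContinuousLinearMap.comp_apply, h2, inner_zero_right]
    exact hA.inner_ne (i := (z, j)) (j := (w, i)) (by simp [hzw]) y x

end OrthoIsomFamilies

section EquivariantIsometries

open ContinuousLinearMap

variable {ρ : C₀(X, ℂ) →⋆ₙₐ[ℂ] (H →L[ℂ] H)} {u : Γ →* unitary (H →L[ℂ] H)}

/-- A very ample representation admits countably many isometries with orthogonal ranges in its
commutant. -/
theorem exists_commuting_isometries {H₁ : Type*} [NormedAddCommGroup H₁] [InnerProductSpace ℂ H₁]
    [CompleteSpace H₁] (ρ₁ : C₀(X, ℂ) →⋆ₙₐ[ℂ] (H₁ →L[ℂ] H₁))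
    (U : H ≃ₗᵢ[ℂ] lp (fun _ : ℕ => H₁) 2)
    (hU : ∀ (f : C₀(X, ℂ)) (v : H) (n : ℕ), (U (ρ f v)) n = ρ₁ f ((U v) n))
    (Z : Type*) [Countable Z] :
    ∃ θ : Z → H →L[ℂ] H, IsOrthoIsom θ ∧ ∀ z, CommutesRep ρ (θ z) := by
  classical
  have hs : ∀ n, ∃ j : H₁ →L[ℂ] H, ∀ x, U (j x) = lp.single 2 n x := fun n => by
    refine ⟨LinearMap.mkContinuous
      { toFun := fun x => U.symm (lp.single 2 n x)
        map_add' := fun x y => by rw [lp.single_add, map_add]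
        map_smul' := fun c x => by rw [lp.single_smul, map_smul]; rfl } 1 fun x => ?_, fun x => ?_⟩
    · rw [one_mul]
      change ‖U.symm (lp.single 2 n x)‖ ≤ ‖x‖
      rw [U.symm.norm_map, lp.norm_single (by simp)]
    · exact U.apply_symm_apply _
  choose j hj using hs
  have hjin : ∀ n x y, inner ℂ (j n x) y = inner ℂ x (U y n) := fun n x y => by
    rw [← U.inner_map_map, hj, lp.inner_single_left]
  have hjO : IsOrthoIsom j := by
    refine .of_inner (fun n x y => ?_) fun n m hnm x y => ?_
    · rw [hjin, hj, lp.single_apply_self]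
    · rw [hjin, hj, lp.single_apply_ne _ _ _ hnm, inner_zero_right]
  have hjT : IsTotalFamily j := by
    intro y hy
    have h1 : U y = 0 := by
      ext n
      refine ext_inner_left ℂ fun v => ?_
      rw [← hjin, ← adjoint_inner_right, hy]
      simp
    simpa using h1
  have hjρ : ∀ f n x, ρ f (j n x) = j n (ρ₁ f x) := by
    intro f n x
    apply U.injective
    ext m
    rw [hU, hj, hj]
    by_cases h : m = n
    · subst h
      rw [lp.single_apply_self, lp.single_apply_self]
    · rw [lp.single_apply_ne _ _ _ h, lp.single_apply_ne _ _ _ h, map_zero]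
  obtain ⟨e, he⟩ := exists_injective_nat (Z × ℕ)
  obtain ⟨θ, hθ, hθj⟩ := hjO.exists_glue_family hjT (A := fun z n => j (e (z, n)))
    (Z := Z) ⟨fun q x => hjO.isom _ x, fun q q' hq x => hjO.ortho _ _ (fun h => hq (he h)) x⟩
  refine ⟨θ, hθ, fun z f => hjT.ext fun n x => ?_⟩
  rw [mul_apply_eq_comp, mul_apply_eq_comp, hjρ, hθj, hθj, hjρ]

/-- Equivariant version of `exists_commuting_isometries`. -/
theorem exists_equivariant_isometries [ProperSpace X] [Nonempty X] [ProperlyDiscontinuousSMul Γ X]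
    (hiso : ∀ γ : Γ, Isometry fun x : X => γ • x)
    (hfree : ∀ (γ : Γ) (x : X), γ • x = x → γ = 1) (hnd : NondegRep ρ) (hcov : CovariantRep ρ u)
    {Z : Type*} [MulAction Γ Z] {θ : Z → H →L[ℂ] H} (hθ : IsOrthoIsom θ)
    (hθρ : ∀ z, CommutesRep ρ (θ z)) :
    ∃ V : Z → H →L[ℂ] H, IsOrthoIsom V ∧ (∀ z, CommutesRep ρ (V z)) ∧
      ∀ γ z x, (u γ : H →L[ℂ] H) (V z x) = V (γ • z) ((u γ : H →L[ℂ] H) x) := by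
  obtain ⟨E, hEc, hET, hEo, hEt⟩ := exists_fundamental_domain (Γ := Γ) hiso hfree hnd hcov
  have := hEc.completeSpace_coe
  have hui : ∀ (γ : Γ) x y, inner ℂ ((u γ : H →L[ℂ] H) x) ((u γ : H →L[ℂ] H) y) = inner ℂ x y :=
    fun γ x y => by
      rw [← adjoint_inner_right, ← star_eq_adjoint, ← mul_apply_eq_comp, unitary_star_mul]
      rfl
  have hum : ∀ (γ g : Γ) x, (u γ : H →L[ℂ] H) ((u g : H →L[ℂ] H) x) = (u (γ * g) : H →L[ℂ] H) x :=
    fun γ g x => by rw [← mul_apply_eq_comp, ← unitary_coe_mul]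
  have hun : ∀ g h : Γ, g ≠ h → ∀ x ∈ E, ∀ y ∈ E,
      inner ℂ ((u g : H →L[ℂ] H) x) ((u h : H →L[ℂ] H) y) = 0 := by
    intro g h hgh x hx y hy
    rw [← mul_inv_cancel_left h g, ← hum, hui]
    exact hEo _ (fun h2 => hgh (inv_mul_eq_one.1 h2).symm) x hx y hy
  let B : Γ → E →L[ℂ] H := fun g => (u g : H →L[ℂ] H) ∘L E.subtypeL
  have hB : IsOrthoIsom B := .of_inner (fun g x y => hui g x y)
    fun g h hgh x y => hun g h hgh x x.2 y y.2
  have hBt : IsTotalFamily B := fun y hy => hEt y fun γ e he => by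
    have h1 := adjoint_inner_right (B γ) ⟨e, he⟩ y
    rw [hy, inner_zero_right] at h1
    exact h1.symm
  let A : Z → Γ → E →L[ℂ] H := fun z g => (u g : H →L[ℂ] H) ∘L θ (g⁻¹ • z) ∘L E.subtypeL
  have hA : IsOrthoIsom fun q : Z × Γ => A q.1 q.2 := by
    refine .of_inner (fun q x y => (hui _ _ _).trans (hθ.inner_same _ _ _)) ?_
    rintro ⟨z, g⟩ ⟨w, h⟩ hne x y
    by_cases hgh : g = h
    · subst hgh
      refine (hui _ _ _).trans (hθ.inner_ne (fun h1 => hne ?_) _ _)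
      rw [show z = w from smul_left_cancel g⁻¹ h1]
    · exact hun g h hgh _ (hET _ (hθρ _) x x.2) _ (hET _ (hθρ _) y y.2)
  obtain ⟨V, hV, hVB⟩ := hB.exists_glue_family hBt hA
  have hVE : ∀ z g, ∀ x ∈ E, V z ((u g : H →L[ℂ] H) x) = (u g : H →L[ℂ] H) (θ (g⁻¹ • z) x) :=
    fun z g x hx => hVB z g ⟨x, hx⟩
  refine ⟨V, hV, fun z f => hBt.ext fun g x => ?_, fun γ z x => ?_⟩
  · obtain ⟨f', hf'⟩ := exists_translate hiso g f
    have h1 : ∀ x, ρ f ((u g : H →L[ℂ] H) x) = (u g : H →L[ℂ] H) (ρ f' x) := fun x =>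
      DFunLike.congr_fun (hcov.mul_unitary (f := f') (g := f) (γ := g) fun x => (hf' x).symm) x
    change V z (ρ f ((u g : H →L[ℂ] H) x)) = ρ f (V z ((u g : H →L[ℂ] H) x))
    rw [h1, hVE _ _ _ (hET _ (commutesRep_rep f') x x.2), hVE _ _ _ x.2, h1,
      (hθρ _).apply]
  · refine DFunLike.congr_fun (f := (u γ : H →L[ℂ] H) * V z) (g := V (γ • z) * (u γ : H →L[ℂ] H))
      (hBt.ext fun g x => ?_) x
    change (u γ : H →L[ℂ] H) (V z ((u g : H →L[ℂ] H) x))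
      = V (γ • z) ((u γ : H →L[ℂ] H) ((u g : H →L[ℂ] H) x))
    rw [hVE _ _ _ x.2, hum, hum, hVE _ _ _ x.2, mul_inv_rev, mul_smul, inv_smul_smul]

end EquivariantIsometries

section Net

/-- The part of the orbit of `z` at distance less than `s` from `z`. -/
def localOrbit (Γ : Type*) [Group Γ] [MulAction Γ X] (s : ℝ) (z : X) : Set X :=
  {y | (∃ γ : Γ, y = γ • z) ∧ dist y z < s}

theorem finite_localOrbit [ProperSpace X] [ProperlyDiscontinuousSMul Γ X] (s : ℝ) (z : X) :
    (localOrbit Γ s z).Finite := by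
  rcases le_or_gt s 0 with hs | hs
  · convert Set.finite_empty
    ext y
    simp only [localOrbit, Set.mem_ofPred_eq, Set.mem_empty_iff_false, iff_false, not_and, not_lt]
    exact fun _ => hs.trans dist_nonneg
  have hK := isCompact_closedBall z s
  refine ((finite_disjoint_inter_image (Γ := Γ) hK hK).image (· • z)).subset ?_
  rintro _ ⟨⟨γ, rfl⟩, h⟩
  exact ⟨γ, ⟨γ • z, ⟨z, mem_closedBall_self hs.le, rfl⟩, h.le⟩, rfl⟩

theorem localOrbit_smul (hiso : ∀ γ : Γ, Isometry fun x : X => γ • x) (s : ℝ) (γ : Γ) (z : X) :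
    localOrbit Γ s (γ • z) = (fun x => γ • x) '' localOrbit Γ s z := by
  ext y
  constructor
  · rintro ⟨⟨γ', rfl⟩, h⟩
    refine ⟨γ⁻¹ • γ' • γ • z, ⟨⟨γ⁻¹ * γ' * γ, by simp only [mul_smul]⟩, ?_⟩, smul_inv_smul _ _⟩
    rwa [dist_smul_left hiso, inv_inv]
  · rintro ⟨_, ⟨⟨γ', rfl⟩, h⟩, rfl⟩
    refine ⟨⟨γ * γ' * γ⁻¹, by simp only [mul_smul, inv_smul_smul]⟩, ?_⟩
    rwa [(hiso γ).dist_eq]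

/-- The weight of `z`: the inverse of the cardinality of its local orbit. -/
def orbitWeight (Γ : Type*) [Group Γ] [MulAction Γ X] (s : ℝ) (z : X) : ℝ :=
  ((localOrbit Γ s z).ncard : ℝ)⁻¹

theorem orbitWeight_nonneg (s : ℝ) (z : X) : 0 ≤ orbitWeight Γ s z :=
  inv_nonneg.2 (Nat.cast_nonneg _)

theorem orbitWeight_smul (hiso : ∀ γ : Γ, Isometry fun x : X => γ • x) (s : ℝ) (γ : Γ) (z : X) :
    orbitWeight Γ s (γ • z) = orbitWeight Γ s z := by
  rw [orbitWeight, orbitWeight, localOrbit_smul hiso,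
    Set.ncard_image_of_injective _ (MulAction.injective γ)]

theorem exists_card_separated_le (hbg : BoundedGeometry X) :
    ∃ s : ℝ, 0 < s ∧ ∀ R : ℝ, ∃ N : ℕ, ∀ (x : X) (S : Finset X), (∀ p ∈ S, dist x p < R) →
      (∀ p ∈ S, ∀ q ∈ S, p ≠ q → s ≤ dist p q) → S.card ≤ N := by
  classical
  obtain ⟨Y, c, hc, hY, hN⟩ := hbg
  choose y hyY hy using hY
  refine ⟨2 * c, by linarith, fun R => ?_⟩
  rcases le_or_gt R 0 with hR | hR
  · refine ⟨0, fun x S hS _ => ?_⟩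
    rw [Nat.le_zero, Finset.card_eq_zero, Finset.eq_empty_iff_forall_notMem]
    exact fun p hp => (hS p hp).not_ge (hR.trans dist_nonneg)
  obtain ⟨N, hN⟩ := hN (R + c) (by linarith)
  refine ⟨N, fun x S hS hsep => ?_⟩
  have hinj : Set.InjOn y S := by
    intro p hp q hq hpq
    by_contra hne
    have h1 := hsep p hp q hq hne
    have h2 := dist_triangle_right p q (y p)
    have h3 := hy p
    have h4 := hy q
    rw [← hpq] at h4
    linarith
  rw [← Finset.card_image_of_injOn hinj, ← Set.ncard_coe_finset]
  refine (Set.ncard_le_ncard ?_ (hN x).1).trans (hN x).2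
  intro q hq
  obtain ⟨p, hp, rfl⟩ := Finset.mem_image.1 hq
  refine ⟨hyY p, ?_⟩
  rw [mem_ball']
  have h1 := hS p hp
  have h2 := dist_triangle x p (y p)
  have h3 := hy p
  linarith

/-- There is an invariant net whose points in distinct orbits are separated. -/
theorem exists_invariant_net (hiso : ∀ γ : Γ, Isometry fun x : X => γ • x) {s : ℝ} (hs : 0 < s) :
    ∃ Z : SubMulAction Γ X, (∀ z ∈ Z, ∀ z' ∈ Z, (∃ γ : Γ, z' = γ • z) ∨ s ≤ dist z' z) ∧
      ∀ x, ∃ z ∈ Z, dist x z < s := by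
  let S : Set (Set X) := {Z | (∀ γ : Γ, ∀ z ∈ Z, γ • z ∈ Z) ∧
    ∀ z ∈ Z, ∀ z' ∈ Z, (∃ γ : Γ, z' = γ • z) ∨ s ≤ dist z' z}
  obtain ⟨Z, ⟨hZ1, hZ2⟩, hmax⟩ := zorn_subset S fun c hc hch => by
    refine ⟨⋃₀ c, ⟨?_, ?_⟩, fun z hz => Set.subset_sUnion_of_mem hz⟩
    · rintro γ z ⟨A, hA, hz⟩
      exact ⟨A, hA, (hc hA).1 γ z hz⟩
    · rintro z ⟨A, hA, hz⟩ z' ⟨A', hA', hz'⟩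
      rcases hch.total hA hA' with h | h
      · exact (hc hA').2 z (h hz) z' hz'
      · exact (hc hA).2 z hz z' (h hz')
  refine ⟨⟨Z, fun γ _ hz => hZ1 γ _ hz⟩, hZ2, fun x => ?_⟩
  by_contra! hx
  have hx' : ∀ z ∈ Z, s ≤ dist x z := hx
  have hmem : Z ∪ Set.range (fun γ : Γ => γ • x) ∈ S := by
    refine ⟨?_, ?_⟩
    · rintro γ z (hz | ⟨γ', rfl⟩)
      · exact Or.inl (hZ1 γ z hz)
      · exact Or.inr ⟨γ * γ', mul_smul _ _ _⟩
    · rintro z (hz | ⟨γ, rfl⟩) z' (hz' | ⟨γ', rfl⟩)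
      · exact hZ2 z hz z' hz'
      · right
        rw [dist_smul_left hiso]
        exact hx' _ (hZ1 _ _ hz)
      · right
        rw [dist_comm, dist_smul_left hiso]
        exact hx' _ (hZ1 _ _ hz')
      · exact Or.inl ⟨γ' * γ⁻¹, by simp only [mul_smul, inv_smul_smul]⟩
  have h1 : x ∈ Z := hmax hmem Set.subset_union_left (Or.inr ⟨1, one_smul _ _⟩)
  have h2 := hx' x h1
  rw [dist_self] at h2
  linarith

/-- A locally finite invariant net with invariant weights, uniformly bounded on balls of fixed
radius and bounded below on balls of large radius. -/
theorem exists_weighted_net [ProperSpace X] [ProperlyDiscontinuousSMul Γ X]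
    (hiso : ∀ γ : Γ, Isometry fun x : X => γ • x) (hbg : BoundedGeometry X) :
    ∃ (Z : SubMulAction Γ X) (w : Z → ℝ) (s : ℝ), 0 < s ∧ (∀ z, 0 ≤ w z) ∧
      (∀ (γ : Γ) z, w (γ • z) = w z) ∧ (∀ (x : X) R, {z : Z | dist x z < R}.Finite) ∧
      (∀ R, ∃ C : ℝ, 0 ≤ C ∧ ∀ (x : X) (F : Finset Z), (∀ z ∈ F, dist x z < R) →
        ∑ z ∈ F, w z ≤ C) ∧
      ∀ (x : X) (F : Finset Z), (∀ z : Z, dist x z < s → z ∈ F) → 1 ≤ ∑ z ∈ F, w z := by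
  classical
  obtain ⟨s, hs, hN⟩ := exists_card_separated_le hbg
  obtain ⟨Z, hZ, hnet⟩ := exists_invariant_net hiso hs
  have hcover : ∀ R, ∃ N : ℕ, ∀ x, ∃ S : Finset X, S.card ≤ N ∧
      ∀ z ∈ Z, dist x z < R → ∃ p ∈ S, z ∈ localOrbit Γ s p := by
    intro R
    obtain ⟨N, hN⟩ := hN R
    refine ⟨N, fun x => ?_⟩
    let 𝒮 : Set (Finset X) := {S | (∀ p ∈ S, p ∈ Z ∧ dist x p < R) ∧
      ∀ p ∈ S, ∀ q ∈ S, p ≠ q → s ≤ dist p q}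
    have hcard : ∀ S ∈ 𝒮, S.card ≤ N := fun S hS => hN x S (fun p hp => (hS.1 p hp).2) hS.2
    have hbdd : BddAbove (Finset.card '' 𝒮) := ⟨N, by
      rintro _ ⟨S, hS, rfl⟩
      exact hcard S hS⟩
    obtain ⟨S, hS, hSmax⟩ := Nat.sSup_mem (s := Finset.card '' 𝒮) ⟨0, ∅, by simp [𝒮], rfl⟩ hbdd
    refine ⟨S, hcard S hS, fun z hz hxz => ?_⟩
    by_contra! hno
    have hsep : ∀ p ∈ S, s ≤ dist z p := by
      intro p hp
      rcases hZ p (hS.1 p hp).1 z hz with h | h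
      · by_contra! h'
        exact hno p hp ⟨h, h'⟩
      · exact h
    have hzS : z ∉ S := fun h => by
      have := hsep z h
      rw [dist_self] at this
      linarith
    have hins : insert z S ∈ 𝒮 := by
      refine ⟨fun p hp => ?_, fun p hp q hq hpq => ?_⟩
      · rcases Finset.mem_insert.1 hp with rfl | hp
        · exact ⟨hz, hxz⟩
        · exact hS.1 p hp
      · rcases Finset.mem_insert.1 hp with h | h <;> rcases Finset.mem_insert.1 hq with h' | h'
        · exact (hpq (h.trans h'.symm)).elim
        · rw [h]
          exact hsep q h'
        · rw [h', dist_comm]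
          exact hsep p h
        · exact hS.2 p h q h' hpq
    have := le_csSup hbdd ⟨_, hins, rfl⟩
    rw [← hSmax, Finset.card_insert_of_notMem hzS] at this
    omega
  refine ⟨Z, fun z => orbitWeight Γ s (z : X), 2 * s, by linarith,
    fun z => orbitWeight_nonneg _ _, fun γ z => orbitWeight_smul hiso _ _ _, fun x R => ?_,
    fun R => ?_, fun x F hF => ?_⟩
  · obtain ⟨N, hN⟩ := hcover R
    obtain ⟨S, -, hS⟩ := hN x
    have hfin : (⋃ p ∈ S, localOrbit Γ s p).Finite :=
      S.finite_toSet.biUnion fun p _ => finite_localOrbit s p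
    refine (hfin.preimage (f := ((↑) : Z → X)) Subtype.val_injective.injOn).subset fun z hz => ?_
    obtain ⟨p, hp, hzp⟩ := hS z z.2 hz
    simp only [Set.mem_preimage, Set.mem_iUnion]
    exact ⟨p, hp, hzp⟩
  · obtain ⟨N, hN⟩ := hcover R
    refine ⟨N, Nat.cast_nonneg _, fun x F hF => ?_⟩
    obtain ⟨S, hSN, hS⟩ := hN x
    calc ∑ z ∈ F, orbitWeight Γ s (z : X)
        ≤ ∑ z ∈ F, ∑ p ∈ S, if (z : X) ∈ localOrbit Γ s p then orbitWeight Γ s (z : X) else 0 := by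
          refine Finset.sum_le_sum fun z hz => ?_
          obtain ⟨p, hp, hzp⟩ := hS z z.2 (hF z hz)
          refine le_trans ?_ (Finset.single_le_sum (fun q _ => ?_) hp)
          · rw [if_pos hzp]
          · split_ifs
            exacts [orbitWeight_nonneg _ _, le_rfl]
      _ = ∑ p ∈ S, ∑ z ∈ F, if (z : X) ∈ localOrbit Γ s p then orbitWeight Γ s (z : X) else 0 :=
          Finset.sum_comm
      _ ≤ ∑ p ∈ S, (1 : ℝ) := by
          refine Finset.sum_le_sum fun p _ => ?_
          rw [← Finset.sum_filter]
          have h1 : ∀ z ∈ F.filter (fun z : Z => (z : X) ∈ localOrbit Γ s p),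
              orbitWeight Γ s (z : X) = orbitWeight Γ s p := by
            intro z hz
            obtain ⟨⟨γ, hγ⟩, -⟩ := (Finset.mem_filter.1 hz).2
            rw [hγ, orbitWeight_smul hiso]
          rw [Finset.sum_congr rfl h1, Finset.sum_const, nsmul_eq_mul, orbitWeight]
          refine mul_inv_le_one_of_le₀ ?_ (Nat.cast_nonneg _)
          rw [← Finset.card_map (Function.Embedding.subtype _), ← Set.ncard_coe_finset]
          refine Nat.cast_le.2 (Set.ncard_le_ncard ?_ (finite_localOrbit s p))
          intro y hy
          obtain ⟨z, hz, rfl⟩ := Finset.mem_map.1 hy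
          exact (Finset.mem_filter.1 hz).2
      _ = S.card := by simp
      _ ≤ N := Nat.cast_le.2 hSN
  · obtain ⟨z₀, hz₀, hxz⟩ := hnet x
    have hfin := finite_localOrbit (Γ := Γ) s z₀
    have hmem : ∀ y ∈ localOrbit Γ s z₀, y ∈ Z := by
      rintro _ ⟨⟨γ, rfl⟩, -⟩
      exact Z.smul_mem γ hz₀
    have hpos : 0 < (localOrbit Γ s z₀).ncard := by
      rw [Set.ncard_pos hfin]
      exact ⟨z₀, ⟨1, (one_smul _ _).symm⟩, by rwa [dist_self]⟩
    have hw : ∀ y ∈ hfin.toFinset, orbitWeight Γ s y = orbitWeight Γ s z₀ := by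
      intro y hy
      obtain ⟨⟨γ, rfl⟩, -⟩ := hfin.mem_toFinset.1 hy
      exact orbitWeight_smul hiso _ _ _
    calc (1 : ℝ) = ∑ y ∈ hfin.toFinset, orbitWeight Γ s y := by
          rw [Finset.sum_congr rfl hw, Finset.sum_const, nsmul_eq_mul, orbitWeight,
            Set.ncard_eq_toFinset_card _ hfin, mul_inv_cancel₀]
          rw [← Set.ncard_eq_toFinset_card _ hfin]
          exact_mod_cast hpos.ne'
      _ ≤ ∑ y ∈ F.map (Function.Embedding.subtype _), orbitWeight Γ s y := by
          refine Finset.sum_le_sum_of_subset_of_nonneg ?_ fun y _ _ => orbitWeight_nonneg _ _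
          intro y hy
          have hy' := hfin.mem_toFinset.1 hy
          refine Finset.mem_map.2 ⟨⟨y, hmem y hy'⟩, hF _ ?_, rfl⟩
          have h1 := dist_triangle_right x y z₀
          have h2 := hy'.2
          change dist x y < 2 * s
          linarith
      _ = _ := by rw [Finset.sum_map]; rfl

theorem countable_of_finite_balls {Z : Set X} [Nonempty X]
    (h : ∀ (x : X) R, {z : Z | dist x z < R}.Finite) : Countable Z := by
  obtain ⟨x⟩ := ‹Nonempty X›
  rw [← Set.countable_univ_iff]
  refine (Set.countable_iUnion fun n : ℕ => (h x n).countable).mono fun z _ => ?_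
  obtain ⟨n, hn⟩ := exists_nat_gt (dist x z)
  exact Set.mem_iUnion.2 ⟨n, hn⟩

end Net

section Partition

/-- An equivariant family of bump functions `φ`, `ψ`, `χ` indexed by a net `Z`, with
`∑ c_z φ_z = 1`, `ψ_z = c_z` on the `r`-neighbourhood of the support of `φ_z`, and `χ_z = 1` on
the supports of `φ_z` and `ψ_z`. -/
structure IsEquivariantPartition (Z : SubMulAction Γ X) (c : Z → ℝ) (A r : ℝ)
    (φ ψ χ : Z → C₀(X, ℂ)) : Prop where
  φ_smul : ∀ (γ : Γ) z x, φ (γ • z) (γ • x) = φ z x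
  ψ_smul : ∀ (γ : Γ) z x, ψ (γ • z) (γ • x) = ψ z x
  χ_smul : ∀ (γ : Γ) z x, χ (γ • z) (γ • x) = χ z x
  φ_star : ∀ z, star (φ z) = φ z
  ψ_star : ∀ z, star (ψ z) = ψ z
  χ_star : ∀ z, star (χ z) = χ z
  φ_bound : ∃ C : ℝ, 0 ≤ C ∧ ∀ (F : Finset Z) x, ∑ z ∈ F, ‖φ z x‖ ^ 2 ≤ C
  ψ_bound : ∃ C : ℝ, 0 ≤ C ∧ ∀ (F : Finset Z) x, ∑ z ∈ F, ‖ψ z x‖ ^ 2 ≤ C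
  χ_bound : ∀ z x, ‖χ z x‖ ≤ 1
  φ_supp : ∀ (z : Z) (x : X), A ≤ dist x z → φ z x = 0
  ψ_eq : ∀ (z : Z) (x : X), dist x z < A + r → ψ z x = c z
  ψ_supp : ∀ (z : Z) (x : X), A + r + 1 ≤ dist x z → ψ z x = 0
  χ_eq : ∀ (z : Z) (x : X), dist x z ≤ A + r + 1 → χ z x = 1
  χ_supp : ∀ (z : Z) (x : X), A + r + 2 ≤ dist x z → χ z x = 0
  sum_eq : ∀ (x : X) (F : Finset Z), (∀ z : Z, dist x z < A → z ∈ F) →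
    ∑ z ∈ F, (c z : ℂ) * φ z x = 1

theorem sum_sq_le_of_weight {ι : Type*} {w : ι → ℝ} {C : ℝ} {P : ι → Prop} {f : ι → ℂ}
    (hC : ∀ F : Finset ι, (∀ z ∈ F, P z) → ∑ z ∈ F, w z ≤ C)
    (hf : ∀ z, P z → ‖f z‖ ^ 2 ≤ w z) (hf0 : ∀ z, ¬ P z → f z = 0) (F : Finset ι) :
    ∑ z ∈ F, ‖f z‖ ^ 2 ≤ C := by
  classical
  calc ∑ z ∈ F, ‖f z‖ ^ 2 = ∑ z ∈ F.filter P, ‖f z‖ ^ 2 := by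
        rw [Finset.sum_filter]
        refine Finset.sum_congr rfl fun z _ => ?_
        split_ifs with h
        · rfl
        · rw [hf0 z h]
          simp
    _ ≤ ∑ z ∈ F.filter P, w z :=
        Finset.sum_le_sum fun z hz => hf z (Finset.mem_filter.1 hz).2
    _ ≤ C := hC _ fun z hz => (Finset.mem_filter.1 hz).2

theorem exists_equivariantPartition [ProperSpace X]
    [ProperlyDiscontinuousSMul Γ X] (hiso : ∀ γ : Γ, Isometry fun x : X => γ • x)
    (hbg : BoundedGeometry X) (r : ℝ) :
    ∃ (Z : SubMulAction Γ X) (c : Z → ℝ) (A : ℝ) (φ ψ χ : Z → C₀(X, ℂ)), 0 < A ∧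
      (∀ (x : X) R, {z : Z | dist x z < R}.Finite) ∧
      IsEquivariantPartition Z c A r φ ψ χ := by
  classical
  obtain ⟨Z, w, s, hs, hw0, hwγ, hfin, hup, hlow⟩ := exists_weighted_net hiso hbg
  have hdist : ∀ (γ : Γ) (x : X) (z : Z), dist (γ • x) ((γ • z : Z) : X) = dist x z :=
    fun γ x z => (hiso γ).dist_eq x z
  let k : Z → X → ℝ := fun z x => w z * cutoff s (dist x z)
  have hk0 : ∀ z x, 0 ≤ k z x := fun z x => mul_nonneg (hw0 z) (cutoff_nonneg _ _)
  have hkc : ∀ z, Continuous (k z) := fun z =>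
    continuous_const.mul ((continuous_cutoff s).comp (continuous_id.dist continuous_const))
  have hks : ∀ (z : Z) (x : X), s + 1 ≤ dist x (z : X) → k z x = 0 := fun z x h => by
    simp only [k, cutoff_eq_zero h, mul_zero]
  let g : X → ℝ := fun x => ∑ᶠ z, k z x
  have hg : ∀ (x : X) (F : Finset Z), (∀ z : Z, dist x z < s + 1 → z ∈ F) →
      g x = ∑ z ∈ F, k z x := fun x F hF => by
    refine finsum_eq_sum_of_support_subset _ fun z hz => hF z ?_
    by_contra! h
    exact hz (hks z x h)
  have hgc : Continuous g := by
    refine continuous_finsum hkc fun x => ⟨ball x 1, ball_mem_nhds x one_pos,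
      (hfin x (s + 2)).subset ?_⟩
    rintro z ⟨y, hy, hyx⟩
    have h1 : dist y z < s + 1 := by
      by_contra! h
      exact hy (hks z y h)
    have h2 := dist_triangle_left x z y
    rw [mem_ball] at hyx
    change dist x z < s + 2
    linarith
  have hg1 : ∀ x, 1 ≤ g x := fun x => by
    rw [hg x (hfin x (s + 1)).toFinset fun z hz => by simpa using hz]
    calc 1 ≤ ∑ z ∈ (hfin x s).toFinset, w z := hlow x _ fun z hz => by simpa using hz
      _ = ∑ z ∈ (hfin x s).toFinset, k z x := by
          refine Finset.sum_congr rfl fun z hz => ?_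
          have h : dist x z < s := by simpa using hz
          simp only [k, cutoff_eq_one h.le, mul_one]
      _ ≤ _ := by
          refine Finset.sum_le_sum_of_subset_of_nonneg (fun z hz => ?_) fun z _ _ => hk0 z x
          have h : dist x z < s := by simpa using hz
          simpa using h.trans (lt_add_one s)
  have hgγ : ∀ (γ : Γ) x, g (γ • x) = g x := fun γ x => by
    refine (finsum_comp_equiv (MulAction.toPerm γ : Equiv.Perm Z)).symm.trans
      (finsum_congr fun z => ?_)
    simp only [k, MulAction.toPerm_apply, hwγ, hdist]
  have hgne : ∀ x, g x ≠ 0 := fun x => (zero_lt_one.trans_le (hg1 x)).ne'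
  let φ₀ : Z → X → ℝ := fun z x => √(w z) * cutoff s (dist x z) / g x
  have hφc : ∀ z, Continuous (φ₀ z) := fun z => (continuous_const.mul ((continuous_cutoff s).comp
    (continuous_id.dist continuous_const))).div hgc hgne
  have hφs : ∀ (z : Z) (x : X), s + 1 ≤ dist x (z : X) → φ₀ z x = 0 := fun z x h => by
    simp only [φ₀, cutoff_eq_zero h, mul_zero, zero_div]
  let φ : Z → C₀(X, ℂ) := fun z => boundedSupportC0 (fun x => (φ₀ z x : ℂ))
    (Complex.continuous_ofReal.comp (hφc z)) z (s + 1) fun x h => by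
      rw [hφs z x h, Complex.ofReal_zero]
  have hφ : ∀ z x, φ z x = (φ₀ z x : ℂ) := fun _ _ => rfl
  let ψ : Z → C₀(X, ℂ) := fun z => (√(w z) : ℂ) • cutoffC0 (s + 1 + r) (z : X)
  have hψ : ∀ z x, ψ z x = ((√(w z) * cutoff (s + 1 + r) (dist x z) : ℝ) : ℂ) := fun z x => by
    simp [ψ]
  let χ : Z → C₀(X, ℂ) := fun z => cutoffC0 (s + 1 + r + 1) (z : X)
  have hχ : ∀ z x, χ z x = (cutoff (s + 1 + r + 1) (dist x z) : ℂ) := fun _ _ => rfl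
  refine ⟨Z, fun z => √(w z), s + 1, φ, ψ, χ, by linarith, hfin, ?_⟩
  constructor
  · intro γ z x
    simp only [hφ, φ₀, hwγ, hdist, hgγ]
  · intro γ z x
    simp only [hψ, hwγ, hdist]
  · intro γ z x
    simp only [hχ, hdist]
  · intro z
    ext x
    rw [ZeroAtInftyContinuousMap.star_apply, hφ]
    exact Complex.conj_ofReal _
  · intro z
    ext x
    rw [ZeroAtInftyContinuousMap.star_apply, hψ]
    exact Complex.conj_ofReal _
  · intro z
    ext x
    rw [ZeroAtInftyContinuousMap.star_apply, hχ]
    exact Complex.conj_ofReal _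
  · obtain ⟨C, hC, hCw⟩ := hup (s + 1)
    refine ⟨C, hC, fun F x => sum_sq_le_of_weight (P := fun z : Z => dist x z < s + 1)
      (hCw x) (fun z _ => ?_) (fun z hz => ?_) F⟩
    · rw [hφ, Complex.norm_real, Real.norm_eq_abs, sq_abs, div_pow, mul_pow, Real.sq_sqrt (hw0 z)]
      refine (div_le_self (by positivity [hw0 z]) (one_le_pow₀ (hg1 x))).trans ?_
      exact mul_le_of_le_one_right (hw0 z) (pow_le_one₀ (cutoff_nonneg _ _) (cutoff_le_one _ _))
    · rw [hφ, hφs z x (not_lt.1 hz), Complex.ofReal_zero]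
  · obtain ⟨C, hC, hCw⟩ := hup (s + 1 + r + 1)
    refine ⟨C, hC, fun F x => sum_sq_le_of_weight (P := fun z : Z => dist x z < s + 1 + r + 1)
      (hCw x) (fun z _ => ?_) (fun z hz => ?_) F⟩
    · rw [hψ, Complex.norm_real, Real.norm_eq_abs, sq_abs, mul_pow, Real.sq_sqrt (hw0 z)]
      exact mul_le_of_le_one_right (hw0 z) (pow_le_one₀ (cutoff_nonneg _ _) (cutoff_le_one _ _))
    · rw [hψ, cutoff_eq_zero (not_lt.1 hz), mul_zero, Complex.ofReal_zero]
  · intro z x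
    rw [hχ, Complex.norm_real, Real.norm_of_nonneg (cutoff_nonneg _ _)]
    exact cutoff_le_one _ _
  · intro z x h
    rw [hφ, hφs z x h, Complex.ofReal_zero]
  · intro z x h
    rw [hψ, cutoff_eq_one h.le, mul_one]
  · intro z x h
    rw [hψ, cutoff_eq_zero h, mul_zero, Complex.ofReal_zero]
  · intro z x h
    rw [hχ, cutoff_eq_one h, Complex.ofReal_one]
  · intro z x h
    rw [hχ, cutoff_eq_zero (by linarith), Complex.ofReal_zero]
  · intro x F hF
    have h1 : ∀ z, √(w z) * φ₀ z x = k z x / g x := fun z => by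
      simp only [φ₀, k]
      rw [← mul_div_assoc, ← mul_assoc, Real.mul_self_sqrt (hw0 z)]
    simp only [hφ, ← Complex.ofReal_mul, h1, ← Complex.ofReal_sum]
    rw [← Finset.sum_div, ← hg x F hF, div_self (hgne x), Complex.ofReal_one]

end Partition

section Frame

open ContinuousLinearMap

variable {ρ : C₀(X, ℂ) →⋆ₙₐ[ℂ] (H →L[ℂ] H)} {u : Γ →* unitary (H →L[ℂ] H)}

/-- An equivariant family of isometries with orthogonal ranges commuting with `ρ`. -/
structure IsEquivariantFrame (ρ : C₀(X, ℂ) →⋆ₙₐ[ℂ] (H →L[ℂ] H)) (u : Γ →* unitary (H →L[ℂ] H))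
    {Z : Type*} [MulAction Γ Z] (V : Z → H →L[ℂ] H) : Prop where
  ortho : IsOrthoIsom V
  commutes : ∀ z, CommutesRep ρ (V z)
  smul : ∀ γ z x, (u γ : H →L[ℂ] H) (V z x) = V (γ • z) ((u γ : H →L[ℂ] H) x)

namespace IsEquivariantFrame

variable {Z : Type*} [MulAction Γ Z] {V : Z → H →L[ℂ] H}

theorem ext {K : Type*} [NormedAddCommGroup K] [InnerProductSpace ℂ K] [CompleteSpace K]
    {S T : H →L[ℂ] K} (h0 : ∀ y, (∀ z, adjoint (V z) y = 0) → S y = T y)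
    (h1 : ∀ z x, S (V z x) = T (V z x)) : S = T := by
  rw [← sub_eq_zero]
  refine IsOrthoIsom.eq_zero (V := V) (fun y hy => ?_) fun z x => ?_
  · rw [sub_apply, h0 y hy, sub_self]
  · rw [sub_apply, h1, sub_self]

theorem adjoint_rep (hV : IsEquivariantFrame ρ u V) (z : Z) (f : C₀(X, ℂ)) (y : H) :
    adjoint (V z) (ρ f y) = ρ f (adjoint (V z) y) :=
  (hV.commutes z).star_op.apply f y

theorem adjoint_unitary (hV : IsEquivariantFrame ρ u V) (z : Z) (γ : Γ) (y : H) :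
    adjoint (V z) ((u γ : H →L[ℂ] H) y) = (u γ : H →L[ℂ] H) (adjoint (V (γ⁻¹ • z)) y) := by
  refine ext_inner_left ℂ fun v => ?_
  rw [adjoint_inner_right, ← adjoint_inner_left, ← adjoint_inner_left (u γ : H →L[ℂ] H),
    adjoint_inner_right, ← star_eq_adjoint, unitary_star_eq, hV.smul]

theorem adjoint_rep_eq_zero (hV : IsEquivariantFrame ρ u V) {y : H}
    (hy : ∀ z, adjoint (V z) y = 0) (f : C₀(X, ℂ)) (z : Z) : adjoint (V z) (ρ f y) = 0 := by
  rw [hV.adjoint_rep, hy, map_zero]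

theorem adjoint_unitary_eq_zero (hV : IsEquivariantFrame ρ u V) {y : H}
    (hy : ∀ z, adjoint (V z) y = 0) (γ : Γ) (z : Z) :
    adjoint (V z) ((u γ : H →L[ℂ] H) y) = 0 := by
  rw [hV.adjoint_unitary, hy, map_zero]

/-- A glued operator is equivariant when its blocks are. -/
theorem isEquivariantOp (hV : IsEquivariantFrame ρ u V) {L : H →L[ℂ] H} {A : Z → H →L[ℂ] H}
    (hL : ∀ z x, L (V z x) = A z x) (hL0 : ∀ y, (∀ z, adjoint (V z) y = 0) → L y = 0)
    (hA : ∀ γ z x, (u γ : H →L[ℂ] H) (A z x) = A (γ • z) ((u γ : H →L[ℂ] H) x)) :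
    IsEquivariantOp u L := by
  intro γ
  refine ext (V := V) (fun y hy => ?_) fun z x => ?_
  · rw [mul_apply_eq_comp, mul_apply_eq_comp, hL0 y hy, hL0 _ (hV.adjoint_unitary_eq_zero hy γ),
      map_zero]
  · rw [mul_apply_eq_comp, mul_apply_eq_comp, hL, hV.smul, hL, hA]

/-- A glued operator commutes with `ρ` when its blocks do. -/
theorem commutesRep (hV : IsEquivariantFrame ρ u V) {L : H →L[ℂ] H} {A : Z → H →L[ℂ] H}
    (hL : ∀ z x, L (V z x) = A z x) (hL0 : ∀ y, (∀ z, adjoint (V z) y = 0) → L y = 0)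
    (hA : ∀ z, CommutesRep ρ (A z)) : CommutesRep ρ L := by
  intro f
  refine ext (V := V) (fun y hy => ?_) fun z x => ?_
  · rw [mul_apply_eq_comp, mul_apply_eq_comp, hL0 y hy, hL0 _ (hV.adjoint_rep_eq_zero hy f),
      map_zero]
  · rw [mul_apply_eq_comp, mul_apply_eq_comp, hL, ← (hV.commutes z).apply, hL, (hA z).apply]

end IsEquivariantFrame

/-- The Bessel inequality for multiplication operators. -/
theorem sum_norm_adjoint_rep_sq_le (ρ : C₀(X, ℂ) →⋆ₙₐ[ℂ] (H →L[ℂ] H)) {Z : Type*}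
    {φ : Z → C₀(X, ℂ)} {C : ℝ} (hC : 0 ≤ C)
    (hφ : ∀ (F : Finset Z) x, ∑ z ∈ F, ‖φ z x‖ ^ 2 ≤ C) (F : Finset Z) (x : H) :
    ∑ z ∈ F, ‖adjoint (ρ (φ z)) x‖ ^ 2 ≤ C * ‖x‖ ^ 2 := by
  set g : C₀(X, ℂ) := ∑ z ∈ F, φ z * star (φ z) with hg
  have hgn : ‖g‖ ≤ C := C0_norm_le hC fun x => by
    rw [hg, C0_sum_apply]
    refine (norm_sum_le _ _).trans (le_trans (le_of_eq ?_) (hφ F x))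
    refine Finset.sum_congr rfl fun z _ => ?_
    rw [ZeroAtInftyContinuousMap.mul_apply, ZeroAtInftyContinuousMap.star_apply, norm_mul,
      norm_star, sq]
  have h1 : ((∑ z ∈ F, ‖adjoint (ρ (φ z)) x‖ ^ 2 : ℝ) : ℂ) = inner ℂ x (ρ g x) := by
    rw [hg, map_sum, sum_apply, inner_sum]
    push_cast
    refine Finset.sum_congr rfl fun z _ => ?_
    rw [map_mul, map_star, mul_apply_eq_comp, ← adjoint_inner_left, star_eq_adjoint,
      inner_self_eq_norm_sq_to_K]
    rfl
  calc ∑ z ∈ F, ‖adjoint (ρ (φ z)) x‖ ^ 2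
      = ‖((∑ z ∈ F, ‖adjoint (ρ (φ z)) x‖ ^ 2 : ℝ) : ℂ)‖ := by
        rw [Complex.norm_real, Real.norm_of_nonneg (Finset.sum_nonneg fun _ _ => by positivity)]
    _ ≤ ‖x‖ * ‖ρ g x‖ := by rw [h1]; exact norm_inner_le_norm _ _
    _ ≤ ‖x‖ * (C * ‖x‖) := by
        gcongr
        exact (ρ g).le_of_opNorm_le ((norm_rep_le ρ g).trans hgn) x
    _ = C * ‖x‖ ^ 2 := by ring

/-- Gluing multiplication operators along an equivariant frame gives an element of the
equivariant commutant. -/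
theorem IsEquivariantFrame.exists_glue_rep (hcov : CovariantRep ρ u) {Z : Type*} [MulAction Γ Z]
    {V : Z → H →L[ℂ] H} (hV : IsEquivariantFrame ρ u V) {φ : Z → C₀(X, ℂ)}
    (hφ : ∃ C : ℝ, 0 ≤ C ∧ ∀ (F : Finset Z) x, ∑ z ∈ F, ‖φ z x‖ ^ 2 ≤ C)
    (hφγ : ∀ (γ : Γ) z x, φ (γ • z) (γ • x) = φ z x) :
    ∃ L ∈ equivariantCommutant ρ u, ∀ z x, L (V z x) = ρ (φ z) x := by
  obtain ⟨C, hC, hφ⟩ := hφ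
  obtain ⟨L, hL, hL0⟩ := hV.ortho.exists_glue (A := fun z => ρ (φ z)) (Real.sqrt_nonneg C)
    fun F x => by
      rw [Real.sq_sqrt hC]
      exact sum_norm_adjoint_rep_sq_le ρ hC hφ F x
  refine ⟨L, ⟨hV.isEquivariantOp hL hL0 fun γ z x => ?_,
    hV.commutesRep hL hL0 fun z => commutesRep_rep _⟩, hL⟩
  exact (DFunLike.congr_fun (hcov.mul_unitary (hφγ γ z)) x).symm

end Frame

section BlockAlgebra

open ContinuousLinearMap

variable {ρ : C₀(X, ℂ) →⋆ₙₐ[ℂ] (H →L[ℂ] H)} {u : Γ →* unitary (H →L[ℂ] H)}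

theorem IsPseudolocalOp.add {S T : H →L[ℂ] H} (hS : IsPseudolocalOp ρ S)
    (hT : IsPseudolocalOp ρ T) : IsPseudolocalOp ρ (S + T) := fun f => by
  have h : ρ f * (S + T) - (S + T) * ρ f = (ρ f * S - S * ρ f) + (ρ f * T - T * ρ f) := by
    rw [mul_add, add_mul]; abel
  rw [h]
  exact (hS f).add (hT f)

theorem IsPseudolocalOp.smul (c : ℂ) {T : H →L[ℂ] H} (hT : IsPseudolocalOp ρ T) :
    IsPseudolocalOp ρ (c • T) := fun f => by
  rw [mul_smul_comm, smul_mul_assoc, ← smul_sub]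
  exact (hT f).smul c

theorem IsPseudolocalOp.mul {S T : H →L[ℂ] H} (hS : IsPseudolocalOp ρ S)
    (hT : IsPseudolocalOp ρ T) : IsPseudolocalOp ρ (S * T) := fun f => by
  have h : ρ f * (S * T) - S * T * ρ f = (ρ f * S - S * ρ f) * T + S * (ρ f * T - T * ρ f) := by
    rw [sub_mul, mul_sub]; simp only [mul_assoc]; abel
  rw [h]
  exact ((hS f).comp_clm T).add ((hT f).clm_comp S)

theorem IsPseudolocalOp.star_op {T : H →L[ℂ] H} (hT : IsPseudolocalOp ρ T) :
    IsPseudolocalOp ρ (star T) := fun f => by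
  have h : ρ f * star T - star T * ρ f = -star (ρ (star f) * T - T * ρ (star f)) := by
    rw [star_sub, star_mul, star_mul, ← map_star, star_star, neg_sub]
  rw [h]
  exact (hT (star f)).adjoint_of_hilbert.neg

theorem isClosed_isPseudolocalOp : IsClosed {T : H →L[ℂ] H | IsPseudolocalOp ρ T} := by
  simp only [IsPseudolocalOp, Set.ofPred_forall]
  exact isClosed_iInter fun f => isClosed_setOfPred_isCompactOperator.preimage
    (f := fun T : H →L[ℂ] H => ρ f * T - T * ρ f) (by fun_prop)

/-- Pseudolocality only has to be checked on functions of bounded support. -/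
theorem isPseudolocalOp_of_boundedSupport [ProperSpace X] (p : X) {T : H →L[ℂ] H}
    (h : ∀ (f : C₀(X, ℂ)) R, (∀ x, R ≤ dist x p → f x = 0) →
      IsCompactOperator ⇑(ρ f * T - T * ρ f)) : IsPseudolocalOp ρ T := by
  have hρ := continuous_rep ρ
  exact C0_induction p (isClosed_setOfPred_isCompactOperator.preimage
    (f := fun f => ρ f * T - T * ρ f) (by fun_prop)) h

/-- `T` vanishes off the ranges of `V`, preserves each of them, and its block at `z` is supported
in the ball of radius `R` around `z`. -/
structure IsBlockDiagonal (ρ : C₀(X, ℂ) →⋆ₙₐ[ℂ] (H →L[ℂ] H)) {Z : SubMulAction Γ X} (V : Z → H →L[ℂ] H)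
    (R : ℝ) (T : H →L[ℂ] H) : Prop where
  vanish : ∀ y, (∀ z, adjoint (V z) y = 0) → T y = 0
  preserve : ∀ z x, V z (adjoint (V z) (T (V z x))) = T (V z x)
  supp : ∀ (z : Z) (f : C₀(X, ℂ)), (∀ x : X, dist x z ≤ R → f x = 0) → ∀ x, T (V z (ρ f x)) = 0

namespace IsBlockDiagonal

variable {Z : SubMulAction Γ X} {V : Z → H →L[ℂ] H} {R : ℝ} {S T : H →L[ℂ] H}

theorem add (hS : IsBlockDiagonal ρ V R S) (hT : IsBlockDiagonal ρ V R T) :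
    IsBlockDiagonal ρ V R (S + T) where
  vanish y hy := by rw [add_apply, hS.vanish y hy, hT.vanish y hy, add_zero]
  preserve z x := by rw [add_apply, map_add, map_add, hS.preserve, hT.preserve]
  supp z f hf x := by rw [add_apply, hS.supp z f hf, hT.supp z f hf, add_zero]

theorem smul (c : ℂ) (hT : IsBlockDiagonal ρ V R T) : IsBlockDiagonal ρ V R (c • T) where
  vanish y hy := by rw [smul_apply, hT.vanish y hy, smul_zero]
  preserve z x := by rw [smul_apply, map_smul, map_smul, hT.preserve]
  supp z f hf x := by rw [smul_apply, hT.supp z f hf, smul_zero]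

theorem zero : IsBlockDiagonal ρ V R (0 : H →L[ℂ] H) where
  vanish y hy := by rw [zero_apply]
  preserve z x := by rw [zero_apply, map_zero, map_zero]
  supp z f hf x := by rw [zero_apply]

theorem mul (hS : IsBlockDiagonal ρ V R S) (hT : IsBlockDiagonal ρ V R T) :
    IsBlockDiagonal ρ V R (S * T) where
  vanish y hy := by rw [mul_apply_eq_comp, hT.vanish y hy, map_zero]
  preserve z x := by
    rw [mul_apply_eq_comp, ← hT.preserve, hS.preserve]
  supp z f hf x := by rw [mul_apply_eq_comp, hT.supp z f hf, map_zero]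

theorem isClosed_isBlockDiagonal : IsClosed {T : H →L[ℂ] H | IsBlockDiagonal ρ V R T} := by
  have h : {T : H →L[ℂ] H | IsBlockDiagonal ρ V R T} =
      {T | ∀ y, (∀ z, adjoint (V z) y = 0) → T y = 0} ∩
      ({T | ∀ z x, V z (adjoint (V z) (T (V z x))) = T (V z x)} ∩
      {T | ∀ (z : Z) (f : C₀(X, ℂ)), (∀ x : X, dist x z ≤ R → f x = 0) →
        ∀ x, T (V z (ρ f x)) = 0}) :=
    Set.ext fun T => ⟨fun h => ⟨h.1, h.2, h.3⟩, fun h => ⟨h.1, h.2.1, h.2.2⟩⟩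
  rw [h]
  simp only [Set.ofPred_forall]
  refine IsClosed.inter ?_ (IsClosed.inter ?_ ?_)
  · exact isClosed_iInter fun y => isClosed_iInter fun _ => isClosed_eq (by fun_prop) (by fun_prop)
  · exact isClosed_iInter fun y => isClosed_iInter fun _ => isClosed_eq (by fun_prop) (by fun_prop)
  · exact isClosed_iInter fun z => isClosed_iInter fun f => isClosed_iInter fun _ =>
      isClosed_iInter fun x => isClosed_eq (by fun_prop) (by fun_prop)

/-- Block diagonal operators with blocks of radius `R` have propagation at most `2 R + 1`. -/
theorem hasPropLE (hVρ : ∀ z, CommutesRep ρ (V z)) (hT : IsBlockDiagonal ρ V R T)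
    (hT' : IsBlockDiagonal ρ V R (star T)) : HasPropLE ρ T (2 * R + 1) := by
  intro f g hfg
  refine IsOrthoIsom.eq_zero (V := V) (fun y hy => ?_) fun z x => ?_
  · have hy' : ∀ z, adjoint (V z) (ρ g y) = 0 := fun z => by
      rw [← star_eq_adjoint, (hVρ z).star_op.apply, star_eq_adjoint, hy, map_zero]
    rw [mul_apply_eq_comp, mul_apply_eq_comp, hT.vanish _ hy', map_zero]
  rw [mul_apply_eq_comp, mul_apply_eq_comp, ← (hVρ z).apply]
  by_cases hg : ∀ x, dist x (z : X) ≤ R → g x = 0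
  · rw [hT.supp z g hg, map_zero]
  push Not at hg
  obtain ⟨p, hp, hgp⟩ := hg
  have hf : ∀ x : X, dist x (z : X) ≤ R → star f x = 0 := by
    intro y hy
    by_contra hfy
    have hfy' : f y ≠ 0 := fun h => hfy (by rw [ZeroAtInftyContinuousMap.star_apply, h, star_zero])
    have h1 := hfg y (subset_tsupport _ hfy') p (subset_tsupport _ hgp)
    have h2 := dist_triangle_right y p z
    linarith
  rw [← hT.preserve, ← (hVρ z).apply]
  suffices h : ∀ v, ρ f (adjoint (V z) (T (V z v))) = 0 by rw [h, map_zero]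
  intro v
  refine ext_inner_right ℂ fun w => ?_
  rw [← adjoint_inner_right, adjoint_inner_left, ← adjoint_inner_right, inner_zero_left,
    ← star_eq_adjoint, ← star_eq_adjoint, ← map_star, hT'.supp z _ hf, inner_zero_right]

end IsBlockDiagonal

/-- The `*`-algebra of equivariant, pseudolocal, block diagonal operators. -/
def blockAlgebra (ρ : C₀(X, ℂ) →⋆ₙₐ[ℂ] (H →L[ℂ] H)) (u : Γ →* unitary (H →L[ℂ] H)) {Z : SubMulAction Γ X}
    (V : Z → H →L[ℂ] H) (R : ℝ) : NonUnitalStarSubalgebra ℂ (H →L[ℂ] H) where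
  carrier := {T | IsEquivariantOp u T ∧ IsPseudolocalOp ρ T ∧ IsBlockDiagonal ρ V R T ∧
    IsBlockDiagonal ρ V R (star T)}
  add_mem' hS hT := ⟨hS.1.add hT.1, hS.2.1.add hT.2.1, hS.2.2.1.add hT.2.2.1, by
    rw [star_add]; exact hS.2.2.2.add hT.2.2.2⟩
  zero_mem' := ⟨fun γ => by rw [mul_zero, zero_mul], fun f => by
    rw [mul_zero, zero_mul, sub_zero]; exact isCompactOperator_zero, .zero, by
    rw [star_zero]; exact .zero⟩
  smul_mem' c T hT := ⟨hT.1.smul c, hT.2.1.smul c, hT.2.2.1.smul c, by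
    rw [star_smul]; exact hT.2.2.2.smul _⟩
  mul_mem' hS hT := ⟨hS.1.mul hT.1, hS.2.1.mul hT.2.1, hS.2.2.1.mul hT.2.2.1, by
    rw [star_mul]; exact hT.2.2.2.mul hS.2.2.2⟩
  star_mem' hT := ⟨hT.1.star_op, hT.2.1.star_op, hT.2.2.2, by
    rw [star_star]; exact hT.2.2.1⟩

variable {Z : SubMulAction Γ X} {V : Z → H →L[ℂ] H} {R : ℝ}

theorem isClosed_blockAlgebra : IsClosed (blockAlgebra ρ u V R : Set (H →L[ℂ] H)) :=
  isClosed_isEquivariantOp.inter <| isClosed_isPseudolocalOp.inter <|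
    IsBlockDiagonal.isClosed_isBlockDiagonal.inter <|
    IsBlockDiagonal.isClosed_isBlockDiagonal.preimage continuous_star

theorem blockAlgebra_subset (hVρ : ∀ z, CommutesRep ρ (V z)) (hR : 0 ≤ R) :
    (blockAlgebra ρ u V R : Set (H →L[ℂ] H)) ⊆ StructAlgSet ρ u := fun _ hT =>
  ⟨hT.1, hT.2.1, 2 * R + 1, by positivity, hT.2.2.1.hasPropLE hVρ hT.2.2.2⟩

end BlockAlgebra

section Compression

open ContinuousLinearMap

variable {ρ : C₀(X, ℂ) →⋆ₙₐ[ℂ] (H →L[ℂ] H)} {u : Γ →* unitary (H →L[ℂ] H)}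

/-- The compression of `a` by `ρ χ`. -/
def compress (ρ : C₀(X, ℂ) →⋆ₙₐ[ℂ] (H →L[ℂ] H)) (a : H →L[ℂ] H) (χ : C₀(X, ℂ)) : H →L[ℂ] H :=
  ρ χ * a * ρ χ

theorem compress_apply (a : H →L[ℂ] H) (χ : C₀(X, ℂ)) (x : H) :
    compress ρ a χ x = ρ χ (a (ρ χ x)) := rfl

theorem norm_compress_le (a : H →L[ℂ] H) {χ : C₀(X, ℂ)} (hχ : ∀ x, ‖χ x‖ ≤ 1) :
    ‖compress ρ a χ‖ ≤ ‖a‖ := by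
  have h1 : ‖ρ χ‖ ≤ 1 := (norm_rep_le ρ χ).trans (C0_norm_le zero_le_one hχ)
  calc ‖compress ρ a χ‖ ≤ ‖ρ χ‖ * ‖a‖ * ‖ρ χ‖ :=
        (norm_mul_le _ _).trans (by gcongr; exact norm_mul_le _ _)
    _ ≤ 1 * ‖a‖ * 1 := by gcongr
    _ = ‖a‖ := by ring

theorem star_compress (a : H →L[ℂ] H) {χ : C₀(X, ℂ)} (hχ : star χ = χ) :
    star (compress ρ a χ) = compress ρ (star a) χ := by
  rw [compress, compress, star_mul, star_mul, ← map_star, hχ, mul_assoc]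

theorem IsPseudolocalOp.compress {a : H →L[ℂ] H} (ha : IsPseudolocalOp ρ a) (χ : C₀(X, ℂ)) :
    IsPseudolocalOp ρ (compress ρ a χ) :=
  ((commutesRep_rep χ).isPseudolocalOp.mul ha).mul (commutesRep_rep χ).isPseudolocalOp

theorem unitary_compress (hcov : CovariantRep ρ u) {a : H →L[ℂ] H} (ha : IsEquivariantOp u a)
    {χ χ' : C₀(X, ℂ)} {γ : Γ} (hχ : ∀ x, χ' (γ • x) = χ x) (x : H) :
    (u γ : H →L[ℂ] H) (compress ρ a χ x) = compress ρ a χ' ((u γ : H →L[ℂ] H) x) := by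
  have h := fun y => DFunLike.congr_fun (hcov.mul_unitary hχ) y
  have h' := fun y => DFunLike.congr_fun (ha γ) y
  simp only [mul_apply_eq_comp] at h h'
  rw [compress_apply, compress_apply, h, ← h', h]

/-- The block diagonal operator with blocks the compressions of `a`. -/
theorem IsEquivariantFrame.exists_blockDiagonal [ProperSpace X] (p : X) (hcov : CovariantRep ρ u)
    {Z : SubMulAction Γ X} {V : Z → H →L[ℂ] H} (hV : IsEquivariantFrame ρ u V)
    (hfin : ∀ (x : X) R, {z : Z | dist x z < R}.Finite) {χ : Z → C₀(X, ℂ)} {R : ℝ}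
    (hχγ : ∀ (γ : Γ) z x, χ (γ • z) (γ • x) = χ z x) (hχs : ∀ z, star (χ z) = χ z)
    (hχ1 : ∀ z x, ‖χ z x‖ ≤ 1) (hχR : ∀ (z : Z) (x : X), R ≤ dist x z → χ z x = 0)
    {a : H →L[ℂ] H} (hae : IsEquivariantOp u a) (hap : IsPseudolocalOp ρ a) :
    ∃ b ∈ blockAlgebra ρ u V R, (∀ z x, b (V z x) = V z (compress ρ a (χ z) x)) ∧
      ∀ y, (∀ z, adjoint (V z) y = 0) → b y = 0 := by
  classical
  obtain ⟨b, hb, hb0⟩ := hV.ortho.exists_glue_of_ortho (A := fun z => V z * compress ρ a (χ z))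
    (norm_nonneg a) (fun z w hzw x => by
      rw [← star_eq_adjoint, star_mul, mul_apply_eq_comp, mul_apply_eq_comp, star_eq_adjoint (V z),
        hV.ortho.ortho z w hzw, map_zero])
    fun z => (norm_mul_le _ _).trans <| (mul_le_mul (hV.ortho.norm_le_one z)
      (norm_compress_le a (hχ1 z)) (norm_nonneg _) zero_le_one).trans_eq (one_mul _)
  simp only [mul_apply_eq_comp] at hb
  -- the blocks of `b`
  have hVb : ∀ z, adjoint (V z) * b = compress ρ a (χ z) * adjoint (V z) := fun z => by
    refine IsEquivariantFrame.ext (V := V) (fun y hy => ?_) fun w x => ?_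
    · rw [mul_apply_eq_comp, mul_apply_eq_comp, hb0 y hy, hy, map_zero, map_zero]
    · rw [mul_apply_eq_comp, mul_apply_eq_comp, hb]
      by_cases hzw : z = w
      · rw [hzw, hV.ortho.isom, hV.ortho.isom]
      · rw [hV.ortho.ortho z w hzw, hV.ortho.ortho z w hzw, map_zero]
  have hsb : ∀ z x, star b (V z x) = V z (compress ρ (star a) (χ z) x) := fun z x => by
    have h := congrArg star (hVb z)
    rw [star_mul, star_mul, ← star_eq_adjoint, star_star, star_compress a (hχs z)] at h
    exact DFunLike.congr_fun h x
  have hsb0 : ∀ y, (∀ z, adjoint (V z) y = 0) → star b y = 0 := fun y hy => by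
    refine ext_inner_right ℂ fun v => ?_
    rw [star_eq_adjoint, adjoint_inner_left, inner_zero_left]
    have h : innerSL ℂ y ∘L b = 0 := IsOrthoIsom.eq_zero (V := V)
      (fun v hv => by rw [comp_apply, hb0 v hv, map_zero])
      fun z x => by
        rw [comp_apply, hb, innerSL_apply_apply, ← adjoint_inner_left, hy, inner_zero_left]
    exact DFunLike.congr_fun h v
  have hdiag : ∀ (a' b' : H →L[ℂ] H), (∀ z x, b' (V z x) = V z (compress ρ a' (χ z) x)) →
      (∀ y, (∀ z, adjoint (V z) y = 0) → b' y = 0) → IsBlockDiagonal ρ V R b' := by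
    refine fun a' b' h h0 => ⟨h0, fun z x => by rw [h, hV.ortho.isom], fun z f hf x => ?_⟩
    have hχf : χ z * f = 0 := by
      ext y
      rw [ZeroAtInftyContinuousMap.mul_apply, ZeroAtInftyContinuousMap.zero_apply]
      rcases le_total (dist y z) R with hy | hy
      · rw [hf y hy, mul_zero]
      · rw [hχR z y hy, zero_mul]
    rw [h, compress_apply, ← mul_apply_eq_comp (ρ (χ z)) (ρ f), ← map_mul, hχf, map_zero, zero_apply,
      map_zero, map_zero, map_zero]
  refine ⟨b, ⟨?_, ?_, hdiag a b hb hb0, hdiag (star a) (star b) hsb hsb0⟩, hb, hb0⟩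
  · refine hV.isEquivariantOp (A := fun z => V z * compress ρ a (χ z)) hb hb0 fun γ z x => ?_
    rw [mul_apply_eq_comp, mul_apply_eq_comp, hV.smul, unitary_compress hcov hae (hχγ γ z)]
  · refine isPseudolocalOp_of_boundedSupport p fun f R' hf => ?_
    set F := (hfin p (R' + R)).toFinset with hF
    have hzero : ∀ z ∉ F, χ z * f = 0 := fun z hz => by
      have hz' : R' + R ≤ dist p z := by simpa [hF] using hz
      ext y
      rw [ZeroAtInftyContinuousMap.mul_apply, ZeroAtInftyContinuousMap.zero_apply]
      rcases le_or_gt R (dist y z) with hy | hy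
      · rw [hχR z y hy, zero_mul]
      · rw [hf y, mul_zero]
        have := dist_triangle_left p (z : X) y
        linarith
    have hsum : ρ f * b - b * ρ f = ∑ z ∈ F, V z *
        (ρ f * compress ρ a (χ z) - compress ρ a (χ z) * ρ f) * adjoint (V z) := by
      refine IsEquivariantFrame.ext (V := V) (fun y hy => ?_) fun w x => ?_
      · rw [sub_apply, mul_apply_eq_comp, mul_apply_eq_comp, hb0 y hy,
          hb0 _ (hV.adjoint_rep_eq_zero hy f), map_zero, sub_zero, sum_apply]
        refine (Finset.sum_eq_zero fun z _ => ?_).symm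
        rw [mul_apply_eq_comp, hy, map_zero]
      · have h1 : (ρ f * b - b * ρ f) (V w x) =
            V w ((ρ f * compress ρ a (χ w) - compress ρ a (χ w) * ρ f) x) := by
          rw [sub_apply, mul_apply_eq_comp, mul_apply_eq_comp, hb, ← (hV.commutes w).apply,
            ← (hV.commutes w).apply, hb, sub_apply, map_sub, mul_apply_eq_comp, mul_apply_eq_comp]
        rw [h1, sum_apply]
        by_cases hw : w ∈ F
        · rw [Finset.sum_eq_single_of_mem w hw fun z _ hz => by
            rw [mul_apply_eq_comp, hV.ortho.ortho z w hz, map_zero]]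
          rw [mul_apply_eq_comp, hV.ortho.isom, mul_apply_eq_comp]
        · rw [Finset.sum_eq_zero fun z hz => by
            rw [mul_apply_eq_comp, hV.ortho.ortho z w (by rintro rfl; exact hw hz), map_zero]]
          have h2 : ρ (χ w) * ρ f = 0 := by rw [← map_mul, hzero w hw, map_zero]
          have h3 : ρ f * ρ (χ w) = 0 := by rw [commutesRep_rep f (χ w), h2]
          rw [compress, mul_assoc _ _ (ρ f), h2, mul_zero, mul_assoc, ← mul_assoc, h3, zero_mul,
            sub_zero, zero_apply, map_zero]
    rw [hsum]
    refine Finset.sum_induction _ (fun T : H →L[ℂ] H => IsCompactOperator ⇑T)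
      (fun S T hS hT => hS.add hT) isCompactOperator_zero fun z _ => ?_
    exact ((hap.compress (χ z) f).clm_comp (V z)).comp_clm _

end Compression

section Factorization

open ContinuousLinearMap

variable {ρ : C₀(X, ℂ) →⋆ₙₐ[ℂ] (H →L[ℂ] H)} {u : Γ →* unitary (H →L[ℂ] H)}

namespace IsEquivariantPartition

variable {Z : SubMulAction Γ X} {c : Z → ℝ} {A r : ℝ} {φ ψ χ : Z → C₀(X, ℂ)}

theorem φ_mul_χ (h : IsEquivariantPartition Z c A r φ ψ χ) (hr : 0 ≤ r) (z : Z) :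
    φ z * χ z = φ z := by
  ext x
  rw [ZeroAtInftyContinuousMap.mul_apply]
  rcases le_total A (dist x z) with hx | hx
  · rw [h.φ_supp z x hx, zero_mul]
  · rw [h.χ_eq z x (by linarith), mul_one]

theorem χ_mul_ψ (h : IsEquivariantPartition Z c A r φ ψ χ) (z : Z) : χ z * ψ z = ψ z := by
  ext x
  rw [ZeroAtInftyContinuousMap.mul_apply]
  rcases le_total (A + r + 1) (dist x z) with hx | hx
  · rw [h.ψ_supp z x hx, mul_zero]
  · rw [h.χ_eq z x hx, one_mul]

/-- Operators of propagation at most `r` do not distinguish `ψ_z` from `c_z` near `φ_z`. -/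
theorem rep_mul_prop (h : IsEquivariantPartition Z c A r φ ψ χ) {a : H →L[ℂ] H}
    (ha : HasPropLE ρ a r) (z : Z) (f : C₀(X, ℂ)) :
    ρ (φ z) * a * ρ (ψ z) * ρ f = (c z : ℂ) • (ρ (φ z) * a * ρ f) := by
  rw [mul_assoc _ _ (ρ f), ← map_mul, ← mul_smul_comm, ← map_smul, ← sub_eq_zero, ← mul_sub,
    ← map_sub]
  refine ha _ _ fun x hx y hy => ?_
  have h1 : dist x z ≤ A := by
    refine closure_minimal (t := closedBall (z : X) A) (fun x hx => ?_) isClosed_closedBall hx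
    rw [mem_closedBall]
    by_contra hlt
    exact hx (h.φ_supp z x (not_le.1 hlt).le)
  have h2 : A + r ≤ dist y z := by
    refine closure_minimal (t := {y : X | A + r ≤ dist y z}) (fun y hy => ?_)
      (isClosed_le continuous_const (continuous_id.dist continuous_const)) hy
    by_contra hlt
    refine hy ?_
    rw [ZeroAtInftyContinuousMap.sub_apply, ZeroAtInftyContinuousMap.mul_apply,
      ZeroAtInftyContinuousMap.smul_apply, h.ψ_eq z y (not_le.1 hlt), smul_eq_mul, sub_self]
  have := dist_triangle_left y (z : X) x
  linarith

/-- An operator of propagation at most `r` factors through its block diagonal compressions. -/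
theorem factorization [ProperSpace X] (p : X) (h : IsEquivariantPartition Z c A r φ ψ χ)
    (hr : 0 ≤ r) (hfin : ∀ (x : X) R, {z : Z | dist x z < R}.Finite) (hnd : NondegRep ρ)
    {V : Z → H →L[ℂ] H} (hV : IsEquivariantFrame ρ u V) {a b L M : H →L[ℂ] H}
    (ha : HasPropLE ρ a r) (hb : ∀ z x, b (V z x) = V z (compress ρ a (χ z) x))
    (hb0 : ∀ y, (∀ z, adjoint (V z) y = 0) → b y = 0)
    (hL : ∀ z x, L (V z x) = ρ (φ z) x) (hM : ∀ z x, M (V z x) = ρ (ψ z) x) :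
    a = L * (b * star M) := by
  classical
  have hM' : ∀ z, adjoint (V z) * star M = ρ (ψ z) := fun z => by
    have h1 : M * V z = ρ (ψ z) := ContinuousLinearMap.ext (hM z)
    rw [← star_eq_adjoint, ← star_mul, h1, ← map_star, h.ψ_star]
  have key : ∀ (g : C₀(X, ℂ)) R, (∀ x, R ≤ dist x p → g x = 0) → ∀ f,
      ρ g * (a - L * (b * star M)) * ρ f = 0 := by
    intro g R hg f
    set F := (hfin p (R + A)).toFinset with hF
    have hFmem : ∀ z : Z, dist p z < R + A → z ∈ F := fun z hz => by simpa [hF] using hz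
    have hzero : ∀ z ∉ F, ρ g * ρ (φ z) = 0 := fun z hz => by
      have hz' : R + A ≤ dist p z := not_lt.1 fun h => hz (hFmem z h)
      have h1 : g * φ z = 0 := by
        ext y
        rw [ZeroAtInftyContinuousMap.mul_apply, ZeroAtInftyContinuousMap.zero_apply]
        rcases le_or_gt A (dist y z) with hy | hy
        · rw [h.φ_supp z y hy, mul_zero]
        · rw [hg y, zero_mul]
          have := dist_triangle_left p (z : X) y
          linarith
      rw [← map_mul, h1, map_zero]
    have hsum : ρ g * (L * b) =
        ∑ z ∈ F, ρ g * ρ (φ z) * compress ρ a (χ z) * adjoint (V z) := by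
      refine IsEquivariantFrame.ext (V := V) (fun y hy => ?_) fun w x => ?_
      · rw [mul_apply_eq_comp, mul_apply_eq_comp, hb0 y hy, map_zero, map_zero, sum_apply]
        refine (Finset.sum_eq_zero fun z _ => ?_).symm
        rw [mul_apply_eq_comp, hy, map_zero]
      · have h1 : (ρ g * (L * b)) (V w x) = (ρ g * ρ (φ w)) (compress ρ a (χ w) x) := by
          rw [mul_apply_eq_comp, mul_apply_eq_comp, hb, hL, mul_apply_eq_comp]
        rw [h1, sum_apply]
        by_cases hw : w ∈ F
        · rw [Finset.sum_eq_single_of_mem w hw fun z _ hz => by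
            rw [mul_apply_eq_comp, hV.ortho.ortho z w hz, map_zero]]
          rw [mul_apply_eq_comp _ (adjoint (V w)), hV.ortho.isom, mul_apply_eq_comp _ (compress _ _ _)]
        · rw [Finset.sum_eq_zero fun z hz => by
            rw [mul_apply_eq_comp, hV.ortho.ortho z w (by rintro rfl; exact hw hz), map_zero]]
          rw [hzero w hw, zero_apply]
    have hterm : ∀ z, ρ g * ρ (φ z) * compress ρ a (χ z) * adjoint (V z) * star M * ρ f =
        ρ (g * ((c z : ℂ) • φ z)) * (a * ρ f) := fun z => by
      calc _ = ρ g * (ρ (φ z) * ρ (χ z) * a * (ρ (χ z) * (adjoint (V z) * star M)) * ρ f) := by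
            simp only [compress, mul_assoc]
        _ = ρ g * (ρ (φ z) * a * ρ (ψ z) * ρ f) := by
            rw [hM', ← map_mul, ← map_mul, h.φ_mul_χ hr, h.χ_mul_ψ]
        _ = _ := by
            rw [h.rep_mul_prop ha, map_mul, map_smul]
            simp only [mul_smul_comm, smul_mul_assoc, mul_assoc]
    have hg1 : ∑ z ∈ F, g * ((c z : ℂ) • φ z) = g := by
      ext x
      rw [C0_sum_apply]
      simp only [ZeroAtInftyContinuousMap.mul_apply, ZeroAtInftyContinuousMap.smul_apply,
        smul_eq_mul]
      rw [← Finset.mul_sum]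
      rcases le_or_gt R (dist x p) with hx | hx
      · rw [hg x hx, zero_mul]
      · rw [h.sum_eq x F fun z hz => hFmem z ?_, mul_one]
        have := dist_triangle_left p (z : X) x
        linarith
    have h2 : ρ g * (L * (b * star M)) * ρ f = ρ g * (a * ρ f) := by
      rw [← mul_assoc L, ← mul_assoc (ρ g), hsum, Finset.sum_mul, Finset.sum_mul,
        Finset.sum_congr rfl fun z _ => hterm z, ← Finset.sum_mul, ← map_sum, hg1]
    rw [mul_sub, sub_mul, h2, mul_assoc, sub_self]
  have hρ := continuous_rep ρ
  rw [← sub_eq_zero]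
  refine hnd.eq_zero_of_mul fun f x => hnd.eq_zero_of_apply fun g => ?_
  have h1 : ρ g * (a - L * (b * star M)) * ρ f = 0 :=
    C0_induction p (P := fun g => ρ g * (a - L * (b * star M)) * ρ f = 0)
      (isClosed_eq (by fun_prop) continuous_const) (fun g R hg => key g R hg f) g
  exact DFunLike.congr_fun h1 x

end IsEquivariantPartition

end Factorization

/-- For every `a ∈ 𝕊(X)^Γ` there is `C_a > 0` bounding `‖σ(a)‖` for every
nondegenerate `*`-representation `σ` of `𝕊(X)^Γ` on any Hilbert space.  The representation
`ρ` of `C₀(X)` is assumed very ample: it is a countably infinite direct sum of copies of an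
ample representation `ρ₁` on `H₁`, which is expressed via the unitary `U : H ≅ ℓ²(ℕ, H₁)`. -/
theorem structure_algebra_norm_bound
    [ProperSpace X] [TopologicalSpace.SeparableSpace X]
    [ProperlyDiscontinuousSMul Γ X]
    (hiso : ∀ γ : Γ, Isometry fun x : X => γ • x)
    (hfree : ∀ (γ : Γ) (x : X), γ • x = x → γ = 1)
    (hbg : BoundedGeometry X)
    [TopologicalSpace.SeparableSpace H]
    (ρ : C₀(X, ℂ) →⋆ₙₐ[ℂ] (H →L[ℂ] H)) (u : Γ →* unitary (H →L[ℂ] H))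
    (hnd : NondegRep ρ) (hcov : CovariantRep ρ u)
    -- `ρ` is very ample: a countable direct sum of copies of the ample representation `ρ₁`
    {H₁ : Type} [NormedAddCommGroup H₁] [InnerProductSpace ℂ H₁] [CompleteSpace H₁]
    (ρ₁ : C₀(X, ℂ) →⋆ₙₐ[ℂ] (H₁ →L[ℂ] H₁)) (hample₁ : AmpleRep ρ₁)
    (U : H ≃ₗᵢ[ℂ] lp (fun _ : ℕ => H₁) 2)
    (hU : ∀ (f : C₀(X, ℂ)) (v : H) (n : ℕ), (U (ρ f v)) n = ρ₁ f ((U v) n)) :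
    ∀ a ∈ StructAlgSet ρ u, ∃ C : ℝ, 0 < C ∧
      ∀ (H₀ : Type) [NormedAddCommGroup H₀] [InnerProductSpace ℂ H₀] [CompleteSpace H₀]
        (σ : (H →L[ℂ] H) → (H₀ →L[ℂ] H₀)),
        IsStarRepOn (StructAlgSet ρ u) σ → IsNondegRepOn (StructAlgSet ρ u) σ →
        ‖σ a‖ ≤ C := by
  intro a ha
  have hle : ∀ (D : NonUnitalStarSubalgebra ℂ (H →L[ℂ] H)),
      IsClosed (D : Set (H →L[ℂ] H)) → (D : Set (H →L[ℂ] H)) ⊆ StructAlgSet ρ u → ∀ T ∈ D,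
      ∀ (H₀ : Type) [NormedAddCommGroup H₀] [InnerProductSpace ℂ H₀] [CompleteSpace H₀]
        (σ : (H →L[ℂ] H) → (H₀ →L[ℂ] H₀)), IsStarRepOn (StructAlgSet ρ u) σ → ‖σ T‖ ≤ ‖T‖ :=
    fun D hD hDR T hT _ _ _ _ σ hσ => hσ.norm_le D hD hDR hT
  rcases isEmpty_or_nonempty X with hX | hX
  · have ha0 : a ∈ equivariantCommutant ρ u := by
      have h0 : a = 0 := hnd.eq_zero_of_mul fun f x => by
        rw [show f = 0 from ZeroAtInftyContinuousMap.ext fun y => hX.elim y, map_zero,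
          zero_apply, map_zero]
      rw [h0]
      exact zero_mem _
    refine ⟨‖a‖ + 1, by positivity, fun H₀ _ _ _ σ hσ _ => ?_⟩
    linarith [hle _ isClosed_equivariantCommutant equivariantCommutant_subset a ha0 H₀ σ hσ]
  have p : X := hX.some
  obtain ⟨r, hr, hprop⟩ := ha.2.2
  obtain ⟨Z, c, A, φ, ψ, χ, hA, hfin, hP⟩ := exists_equivariantPartition (Γ := Γ) hiso hbg r
  have : Countable Z := countable_of_finite_balls (Z := (Z : Set X)) hfin
  obtain ⟨θ, hθ, hθρ⟩ := exists_commuting_isometries ρ₁ U hU Z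
  obtain ⟨V, hV₁, hV₂, hV₃⟩ := exists_equivariant_isometries hiso hfree hnd hcov hθ hθρ
  have hV : IsEquivariantFrame ρ u V := ⟨hV₁, hV₂, hV₃⟩
  obtain ⟨L, hLmem, hL⟩ := hV.exists_glue_rep hcov hP.φ_bound hP.φ_smul
  obtain ⟨M, hMmem, hM⟩ := hV.exists_glue_rep hcov hP.ψ_bound hP.ψ_smul
  obtain ⟨b, hbmem, hb, hb0⟩ := hV.exists_blockDiagonal p hcov hfin hP.χ_smul hP.χ_star
    hP.χ_bound hP.χ_supp ha.1 ha.2.1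
  have hbR := blockAlgebra_subset (u := u) (Z := Z) hV₂ (by positivity : 0 ≤ A + r + 2)
  have hM' := star_mem hMmem
  have hfact := hP.factorization p hr hfin hnd hV hprop hb hb0 hL hM
  refine ⟨‖L‖ * (‖b‖ * ‖star M‖) + 1, by positivity, fun H₀ _ _ _ σ hσ _ => ?_⟩
  have h1 := hle _ isClosed_equivariantCommutant equivariantCommutant_subset L hLmem H₀ σ hσ
  have h2 := hle _ isClosed_blockAlgebra hbR b hbmem H₀ σ hσ
  have h3 := hle _ isClosed_equivariantCommutant equivariantCommutant_subset _ hM' H₀ σ hσ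
  have hmul := hσ.2.2.1
  calc ‖σ a‖ = ‖σ L * (σ b * σ (star M))‖ := by
        rw [hfact, hmul L (equivariantCommutant_subset hLmem) _
          (StructAlgSet.mul_mem_of_commutant (hbR hbmem) hM'),
          hmul b (hbR hbmem) _ (equivariantCommutant_subset hM')]
    _ ≤ ‖σ L‖ * (‖σ b‖ * ‖σ (star M)‖) :=
        (norm_mul_le _ _).trans (by gcongr; exact norm_mul_le _ _)
    _ ≤ ‖L‖ * (‖b‖ * ‖star M‖) := by gcongr
    _ ≤ _ := by linarith
end
end
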